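/- arXiv:1202.1670 — 9 statements merged into one kernel-verified Lean document; each statement's English description precedes it below -/
import Mathlib

section
/- Let k ≥ 1 and n > k+1 be integers. Then |A_k(n) − C_k · f_k(n) · n^k/k!| ≤ ((2+e)/√(2πk)) · (e² · log n)^k · n^{k−1}. -/
open Real

/-- `ψ_k(x) = (x^k − (x−1)^k + (−1)^k)/x`. -/
noncomputable def psi (k : ℕ) (x : ℝ) : ℝ := (x ^ k - (x - 1) ^ k + (-1 : ℝ) ^ k) / x

/-- `C_k = ∏_p (1 − ψ_k(p)/p^k)` over all primes `p`. -/
noncomputable def C (k : ℕ) : ℝ := ∏' p : Nat.Primes, (1 - psi k (p : ℕ) / ((p : ℕ) : ℝ) ^ k)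

/-- `f_k(n) = ∏_{p ∣ n} (1 + (−1)^k/(p^k − ψ_k(p)))` over the distinct prime divisors of `n`. -/
noncomputable def f (k n : ℕ) : ℝ :=
  ∏ p ∈ n.primeFactors, (1 + (-1 : ℝ) ^ k / ((p : ℝ) ^ k - psi k (p : ℝ)))

/-- `A_k(n)` is the number of `(k+1)`-tuples `(x, y_1, …, y_k)` of positive integers with
`x + y_1 + ⋯ + y_k = n` and `gcd(x, y_1⋯y_k) = 1`. -/
noncomputable def A (k n : ℕ) : ℕ :=
  Nat.card {v : Fin (k + 1) → ℕ // (∀ i, 0 < v i) ∧ (∑ i, v i) = n ∧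
    Nat.gcd (v 0) (∏ i ∈ Finset.univ.erase 0, v i) = 1}

section

open Finset

section LocalCount

variable {F : Type*} [Field F] [Fintype F] [DecidableEq F]

/-- The number of `k`-tuples of nonzero elements of `F` with sum `c`. -/
def cardNonzeroSum (k : ℕ) (c : F) : ℕ :=
  #{y : Fin k → F | (∀ i, y i ≠ 0) ∧ ∑ i, y i = c}

/-- The tuples in `F ^ (k + 1)` with given sum whose tail satisfies `P` are determined by the
tail. -/
lemma card_cons_sum_eq {G : Type*} [AddCommGroup G] [Fintype G] [DecidableEq G] (k : ℕ) (c : G)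
    (P : G → (Fin k → G) → Prop) [∀ a y, Decidable (P a y)] :
    #{y : Fin (k + 1) → G | P (y 0) (Fin.tail y) ∧ ∑ i, y i = c} =
      #{y : Fin k → G | P (c - ∑ i, y i) y} := by
  refine card_nbij' (fun y => Fin.tail y) (fun y => Fin.cons (c - ∑ i, y i) y) ?_ ?_ ?_ ?_
  · intro y hy
    simp only [coe_filter, mem_univ, true_and, Set.mem_ofPred_eq] at hy ⊢
    obtain ⟨h, rfl⟩ := hy
    rw [Fin.sum_univ_succ]
    simpa [Fin.tail] using h
  · intro y hy
    simp only [coe_filter, mem_univ, true_and, Set.mem_ofPred_eq] at hy ⊢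
    simpa [Fin.sum_univ_succ] using hy
  · intro y hy
    simp only [coe_filter, mem_univ, true_and, Set.mem_ofPred_eq] at hy
    obtain ⟨h, rfl⟩ := hy
    rw [Fin.sum_univ_succ]
    conv_rhs => rw [← Fin.cons_self_tail y]
    simp [Fin.tail]
  · intro y hy
    simp

lemma cardNonzeroSum_succ_add (k : ℕ) (c : F) :
    cardNonzeroSum (k + 1) c + cardNonzeroSum k c = (Fintype.card F - 1) ^ k := by
  have h1 : cardNonzeroSum (k + 1) c =
      #{y : Fin k → F | (∀ i, y i ≠ 0) ∧ ¬ ∑ i, y i = c} := by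
    have := card_cons_sum_eq k c (fun a y => a ≠ 0 ∧ ∀ i, y i ≠ 0)
    rw [cardNonzeroSum]
    simpa only [ne_eq, Fin.forall_fin_succ, Fin.tail, sub_eq_zero, eq_comm (a := c), and_comm,
      and_assoc, and_left_comm] using this
  have h2 : #{y : Fin k → F | ∀ i, y i ≠ 0} = (Fintype.card F - 1) ^ k := by
    have : ({y : Fin k → F | ∀ i, y i ≠ 0} : Finset _) =
        Fintype.piFinset fun _ => univ.erase 0 := by
      ext y; simp
    rw [this, Fintype.card_piFinset]
    simp [card_erase_of_mem]
  rw [h1, cardNonzeroSum, ← h2, add_comm, ← filter_filter, ← filter_filter,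
    card_filter_add_card_filter_not]

lemma cast_cardNonzeroSum_succ (k : ℕ) (c : F) :
    (cardNonzeroSum (k + 1) c : ℝ) = ((Fintype.card F : ℝ) - 1) ^ k - cardNonzeroSum k c := by
  have h := cardNonzeroSum_succ_add k c
  have h1 : 1 ≤ Fintype.card F := Fintype.card_pos
  rw [eq_sub_iff_add_eq]
  exact_mod_cast congrArg (Nat.cast : ℕ → ℝ) h

lemma card_mul_cardNonzeroSum (k : ℕ) (c : F) :
    (Fintype.card F : ℝ) * cardNonzeroSum k c =
      ((Fintype.card F : ℝ) - 1) ^ k +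
        (-1) ^ k * (if c = 0 then (Fintype.card F : ℝ) - 1 else -1) := by
  induction k with
  | zero =>
    have : cardNonzeroSum 0 c = if c = 0 then 1 else 0 := by
      unfold cardNonzeroSum
      split_ifs with h
      · simp [h]
      · simp [Ne.symm h]
    rw [this]
    split_ifs <;> simp
  | succ k ih =>
    rw [cast_cardNonzeroSum_succ, mul_sub, ih]
    ring

/-- The tuples `r` over `R` with `r 0 = 0`, `r 1 ⋯ r k = 0` and `r 0 + ⋯ + r k = n`. -/
abbrev DegenerateTuple (k n : ℕ) (R : Type*) [CommRing R] : Type _ :=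
  {r : Fin (k + 1) → R // r 0 = 0 ∧ ∏ i ∈ univ.erase 0, r i = 0 ∧ ∑ i, r i = (n : R)}

lemma prod_erase_zero_eq {M : Type*} [CommMonoid M] {k : ℕ} (v : Fin (k + 1) → M) :
    ∏ i ∈ univ.erase 0, v i = ∏ i : Fin k, v i.succ := by
  have : (univ.erase 0 : Finset (Fin (k + 1))) = univ.map (Fin.succEmb k) := by
    ext i
    simp only [mem_erase, mem_univ, and_true, mem_map, true_and]
    exact Fin.exists_succ_eq.symm
  rw [this, prod_map]
  rfl

lemma card_degenerateTuple_add (k n : ℕ) :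
    Nat.card (DegenerateTuple (k + 1) n F) + cardNonzeroSum (k + 1) (n : F) =
      Fintype.card F ^ k := by
  have h1 : Nat.card (DegenerateTuple (k + 1) n F) =
      #{y : Fin (k + 1) → F | (¬ ∀ i, y i ≠ 0) ∧ ∑ i, y i = (n : F)} := by
    rw [Nat.card_eq_fintype_card, Fintype.card_subtype]
    refine card_nbij' (fun y => Fin.tail y) (fun y => Fin.cons 0 y) ?_ ?_ ?_ ?_
    · intro y hy
      simp only [coe_filter, mem_univ, true_and, Set.mem_ofPred_eq, prod_erase_zero_eq,
        prod_eq_zero_iff, Fin.sum_univ_succ (n := k + 1)] at hy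
      simp only [coe_filter, mem_univ, true_and, Set.mem_ofPred_eq]
      obtain ⟨h0, h, hs⟩ := hy
      rw [h0, zero_add] at hs
      refine ⟨?_, hs⟩
      push Not
      exact h
    · intro y hy
      simp only [coe_filter, mem_univ, true_and, Set.mem_ofPred_eq] at hy
      simp only [coe_filter, mem_univ, true_and, Set.mem_ofPred_eq, prod_erase_zero_eq,
        prod_eq_zero_iff, Fin.sum_univ_succ (n := k + 1), Fin.cons_zero, Fin.cons_succ, zero_add]
      have := hy.1
      push Not at this
      exact ⟨this, hy.2⟩
    · intro y hy
      simp only [coe_filter, mem_univ, true_and, Set.mem_ofPred_eq] at hy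
      conv_rhs => rw [← Fin.cons_self_tail y]
      simp [hy.1]
    · intro y hy
      simp
  have h2 : #{y : Fin (k + 1) → F | ∑ i, y i = (n : F)} = Fintype.card F ^ k := by
    have := card_cons_sum_eq k (n : F) (fun _ _ => True)
    simpa using this
  rw [h1, cardNonzeroSum, ← h2, add_comm]
  simp_rw [and_comm (b := ∑ i, _ = (n : F))]
  rw [← filter_filter, ← filter_filter, card_filter_add_card_filter_not]

lemma card_degenerateTuple_le (k n : ℕ) :
    (Nat.card (DegenerateTuple (k + 2) n F) : ℝ) ≤ (k + 2) * (Fintype.card F : ℝ) ^ k := by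
  have hq1 : (1 : ℝ) ≤ Fintype.card F := by exact_mod_cast (Fintype.card_pos : 0 < Fintype.card F)
  have h : (Nat.card (DegenerateTuple (k + 2) n F) : ℝ) + cardNonzeroSum (k + 2) (n : F) =
      (Fintype.card F : ℝ) ^ (k + 1) := by
    exact_mod_cast congrArg (Nat.cast : ℕ → ℝ) (card_degenerateTuple_add (F := F) (k + 1) n)
  have h2 := cast_cardNonzeroSum_succ (k + 1) (n : F)
  have h3 := cast_cardNonzeroSum_succ k (n : F)
  generalize (Fintype.card F : ℝ) = q at *
  have h4 : (cardNonzeroSum (k + 1) (n : F) : ℝ) ≤ q ^ k := by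
    have : (q - 1) ^ k ≤ q ^ k := pow_le_pow_left₀ (by linarith) (by linarith) k
    have : (0 : ℝ) ≤ cardNonzeroSum k (n : F) := Nat.cast_nonneg _
    linarith
  have h5 : q ^ (k + 1) - (q - 1) ^ (k + 1) ≤ (k + 1) * q ^ k := by
    have := (le_abs_self _).trans (abs_pow_sub_pow_le q (q - 1) (k + 1))
    rw [max_eq_left (abs_le_abs (by linarith) (by linarith)), abs_of_nonneg (by linarith : 0 ≤ q)]
      at this
    simpa using this
  linarith

end LocalCount

lemma card_degenerateTuple_zmod {k n p : ℕ} (hk : 1 ≤ k) (hp : p.Prime) :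
    (Nat.card (DegenerateTuple k n (ZMod p)) : ℝ) =
      psi k p - (if p ∣ n then (-1) ^ k else 0) := by
  have := Fact.mk hp
  obtain ⟨k, rfl⟩ := Nat.exists_eq_succ_of_ne_zero (by omega : k ≠ 0)
  have h : (Nat.card (DegenerateTuple (k + 1) n (ZMod p)) : ℝ) +
      cardNonzeroSum (k + 1) (n : ZMod p) = (p : ℝ) ^ k := by
    have := card_degenerateTuple_add (F := ZMod p) k n
    rw [ZMod.card] at this
    exact_mod_cast congrArg (Nat.cast : ℕ → ℝ) this
  have h2 := card_mul_cardNonzeroSum (k + 1) (n : ZMod p)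
  simp only [ZMod.card, ZMod.natCast_eq_zero_iff] at h2
  have hp0 : (p : ℝ) ≠ 0 := by exact_mod_cast hp.ne_zero
  refine mul_left_cancel₀ hp0 ?_
  rw [psi, Nat.succ_eq_add_one, mul_sub, mul_div_cancel₀ _ hp0]
  have h3 := congrArg ((p : ℝ) * ·) h
  simp only [mul_add, h2] at h3
  split_ifs at h3 ⊢ <;> linear_combination h3

lemma psi_nonneg_and_le {k p : ℕ} (hk : 2 ≤ k) (hp : p.Prime) :
    0 ≤ psi k p ∧ psi k p ≤ k * (p : ℝ) ^ (k - 2) := by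
  have := Fact.mk hp
  obtain ⟨k, rfl⟩ := Nat.exists_eq_add_of_le' hk
  have h := card_degenerateTuple_zmod (n := 1) (by omega : 1 ≤ k + 2) hp
  rw [if_neg (by simpa using hp.ne_one), sub_zero] at h
  have h2 := card_degenerateTuple_le (F := ZMod p) k 1
  rw [h, ZMod.card] at h2
  refine ⟨h ▸ Nat.cast_nonneg _, ?_⟩
  simpa using h2

lemma psi_lt_pow {k p : ℕ} (hk : 1 ≤ k) (hp : p.Prime) : psi k p < (p : ℝ) ^ k := by
  have hp2 : (2 : ℝ) ≤ p := by exact_mod_cast hp.two_le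
  rw [psi, div_lt_iff₀ (by linarith)]
  have h1 : (-1 : ℝ) ^ k ≤ 1 := by
    rcases neg_one_pow_eq_or ℝ k with h | h <;> rw [h]; norm_num
  have h2 : (1 : ℝ) ≤ (p - 1 : ℝ) ^ k := one_le_pow₀ (by linarith)
  have h3 : (1 : ℝ) < (p : ℝ) ^ k := one_lt_pow₀ (by linarith) (by omega)
  nlinarith

lemma card_degenerateTuple_congr {k n : ℕ} {R S : Type*} [CommRing R] [CommRing S]
    (e : R ≃+* S) : Nat.card (DegenerateTuple k n R) = Nat.card (DegenerateTuple k n S) := by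
  refine Nat.card_congr ((Equiv.arrowCongr (Equiv.refl _) e.toEquiv).subtypeEquiv fun r => ?_)
  simp only [Equiv.arrowCongr_apply, Function.comp_apply, Equiv.refl_symm, Equiv.refl_apply,
    RingEquiv.toEquiv_eq_coe, EquivLike.coe_coe, ← map_prod, ← map_sum, map_eq_zero_iff e e.injective]
  rw [← map_natCast e n, e.injective.eq_iff]

lemma card_degenerateTuple_pi {k n : ℕ} {ι : Type*} [Fintype ι] (R : ι → Type*)
    [∀ i, CommRing (R i)] :
    Nat.card (DegenerateTuple k n (Π i, R i)) = ∏ i, Nat.card (DegenerateTuple k n (R i)) := by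
  rw [← Nat.card_pi]
  refine Nat.card_congr
    { toFun := fun r i => ⟨fun j => r.1 j i, ?_, ?_, ?_⟩
      invFun := fun w => ⟨fun j i => (w i).1 j, ?_, ?_, ?_⟩
      left_inv := fun r => rfl
      right_inv := fun w => rfl }
  · exact congrFun r.2.1 i
  · simpa using congrFun r.2.2.1 i
  · simpa using congrFun r.2.2.2 i
  · funext i; exact (w i).2.1
  · funext i; simpa using (w i).2.2.1
  · funext i; simpa using (w i).2.2.2

lemma card_degenerateTuple_prod (k n : ℕ) (t : Finset ℕ) (ht : ∀ p ∈ t, p.Prime) :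
    Nat.card (DegenerateTuple k n (ZMod (∏ p ∈ t, p))) =
      ∏ p ∈ t, Nat.card (DegenerateTuple k n (ZMod p)) := by
  rw [← prod_coe_sort t fun p => p,
    card_degenerateTuple_congr (ZMod.prodEquivPi (fun p : t => (p : ℕ)) ?_),
    card_degenerateTuple_pi,
    prod_coe_sort t fun p => Nat.card (DegenerateTuple k n (ZMod p))]
  intro p q hpq
  exact (Nat.coprime_primes (ht p p.2) (ht q q.2)).2 fun h => hpq (Subtype.ext h)

section ClassCount

lemma card_piAntidiag_fin (k q : ℕ) :
    #(piAntidiag (univ : Finset (Fin (k + 1))) q) = (q + k).choose k := by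
  have h := card_finsuppAntidiag_nat_eq_choose (s := (univ : Finset (Fin (k + 1)))) q
  rw [finsuppAntidiag, card_map, card_attach, card_univ, Fintype.card_fin] at h
  rw [h, show k + 1 + q - 1 = q + k by omega, Nat.choose_symm_add]

/-- The `(k + 1)`-tuples of positive integers with sum `n`. -/
def positiveTuples (k n : ℕ) : Finset (Fin (k + 1) → ℕ) :=
  {v ∈ piAntidiag univ n | ∀ i, 0 < v i}

lemma mem_positiveTuples {k n : ℕ} {v : Fin (k + 1) → ℕ} :
    v ∈ positiveTuples k n ↔ (∀ i, 0 < v i) ∧ ∑ i, v i = n := by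
  simp [positiveTuples, and_comm]

/-- The tuples in `positiveTuples k n` that reduce to `r` modulo `d`. -/
def residueClass (k n d : ℕ) (r : Fin (k + 1) → ZMod d) : Finset (Fin (k + 1) → ℕ) :=
  {v ∈ positiveTuples k n | (fun i => (v i : ZMod d)) = r}

lemma exists_eq_add_mul_of_cast_eq {d s v : ℕ} (hs : s ≤ d) (hv : 0 < v)
    (h : (v : ZMod d) = s) : ∃ t, v = s + d * t := by
  rw [ZMod.natCast_eq_natCast_iff] at h
  have hle : s ≤ v := by
    by_contra! hlt
    have := Nat.le_of_dvd (by omega) ((Nat.modEq_iff_dvd' hlt.le).1 h)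
    omega
  obtain ⟨t, ht⟩ := (Nat.modEq_iff_dvd' hle).1 h.symm
  exact ⟨t, by omega⟩

lemma residueClass_eq_empty {k n d : ℕ} {s : Fin (k + 1) → ℕ} (hs : ∀ i, s i ≤ d)
    (hn : n < ∑ i, s i) : residueClass k n d (fun i => (s i : ZMod d)) = ∅ := by
  rw [residueClass, filter_eq_empty_iff]
  intro v hv h
  rw [mem_positiveTuples] at hv
  have : ∑ i, s i ≤ ∑ i, v i := by
    refine sum_le_sum fun i _ => ?_
    obtain ⟨t, ht⟩ := exists_eq_add_mul_of_cast_eq (hs i) (hv.1 i) (congrFun h i)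
    omega
  omega

lemma card_residueClass {k n d q : ℕ} (hd : 0 < d) {s : Fin (k + 1) → ℕ}
    (hs : ∀ i, 0 < s i ∧ s i ≤ d) (hn : n = ∑ i, s i + d * q) :
    #(residueClass k n d (fun i => (s i : ZMod d))) = (q + k).choose k := by
  rw [← card_piAntidiag_fin]
  symm
  refine card_bij (fun t _ i => s i + d * t i) ?_ ?_ ?_
  · intro t ht
    rw [mem_piAntidiag] at ht
    rw [residueClass, mem_filter, mem_positiveTuples]
    refine ⟨⟨fun i => Nat.add_pos_left (hs i).1 _, ?_⟩, ?_⟩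
    · rw [sum_add_distrib, ← mul_sum, ht.1, hn]
    · funext i; simp
  · intro t _ t' _ h
    funext i
    have := congrFun h i
    exact Nat.eq_of_mul_eq_mul_left hd (Nat.add_left_cancel this)
  · intro v hv
    rw [residueClass, mem_filter, mem_positiveTuples] at hv
    choose t ht using fun i =>
      exists_eq_add_mul_of_cast_eq (hs i).2 (hv.1.1 i) (congrFun hv.2 i)
    refine ⟨t, ?_, (funext ht).symm⟩
    rw [mem_piAntidiag]
    refine ⟨?_, fun i _ => mem_univ i⟩
    have h := hv.1.2
    rw [sum_congr rfl fun i _ => ht i, sum_add_distrib, ← mul_sum, hn] at h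
    exact Nat.eq_of_mul_eq_mul_left hd (Nat.add_left_cancel h)

lemma abs_choose_sub_pow_div_factorial_le {k q : ℕ} {a : ℝ} (hk : 1 ≤ k) (h1 : (q : ℝ) + 1 ≤ a)
    (h2 : a ≤ q + 1 + k) :
    |((q + k).choose k : ℝ) - a ^ k / k.factorial| ≤
      (k : ℝ) ^ (k + 1) * a ^ (k - 1) / k.factorial := by
  have hq : (0 : ℝ) ≤ q := Nat.cast_nonneg q
  have hk' : (1 : ℝ) ≤ k := by exact_mod_cast hk
  have hf : (0 : ℝ) < k.factorial := by exact_mod_cast k.factorial_pos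
  have hasc : ((q + k).choose k : ℝ) * k.factorial = ((q + 1).ascFactorial k : ℕ) := by
    rw [Nat.ascFactorial_eq_factorial_mul_choose]; push_cast; ring
  have hlow : ((q : ℝ) + 1) ^ k ≤ ((q + 1).ascFactorial k : ℕ) := by
    exact_mod_cast Nat.pow_succ_le_ascFactorial (q + 1) k
  have hup : (((q + 1).ascFactorial k : ℕ) : ℝ) ≤ ((q : ℝ) + k) ^ k := by
    exact_mod_cast Nat.ascFactorial_le_pow_add q k
  have key : |(((q + 1).ascFactorial k : ℕ) : ℝ) - a ^ k| ≤ (k : ℝ) ^ (k + 1) * a ^ (k - 1) := by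
    rw [abs_sub_le_iff]
    constructor
    · have h3 : ((q : ℝ) + k) ^ k ≤ (a + (k - 1)) ^ k :=
        pow_le_pow_left₀ (by positivity) (by linarith) k
      have h4 := (le_abs_self _).trans (abs_pow_sub_pow_le (a + (k - 1)) a k)
      rw [abs_of_nonneg (by linarith : (0 : ℝ) ≤ a + (k - 1)), abs_of_nonneg (by linarith : 0 ≤ a),
        max_eq_left (by linarith), add_sub_cancel_left, abs_of_nonneg (by linarith)] at h4
      have h5 : (a + (k - 1)) ^ (k - 1) ≤ (k * a) ^ (k - 1) :=
        pow_le_pow_left₀ (by linarith) (by nlinarith) _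
      calc _ ≤ ((k : ℝ) - 1) * k * (a + (k - 1)) ^ (k - 1) := by linarith
        _ ≤ k * k * (k * a) ^ (k - 1) := by
          refine mul_le_mul ?_ h5 (pow_nonneg (by linarith) _) (by positivity)
          exact mul_le_mul_of_nonneg_right (by linarith) (by positivity)
        _ = k * k ^ (k - 1 + 1) * a ^ (k - 1) := by rw [mul_pow]; ring
        _ = _ := by rw [Nat.sub_add_cancel hk]; ring
    · have h4 := (le_abs_self _).trans (abs_pow_sub_pow_le a (q + 1) k)
      rw [abs_of_nonneg (by linarith : (0 : ℝ) ≤ q + 1), abs_of_nonneg (by linarith : 0 ≤ a),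
        max_eq_left (by linarith), abs_of_nonneg (by linarith)] at h4
      have h5 : (k : ℝ) ^ 2 ≤ (k : ℝ) ^ (k + 1) := pow_le_pow_right₀ hk' (by omega)
      have ha : 0 ≤ a := by linarith
      calc _ ≤ (a - (q + 1)) * k * a ^ (k - 1) := by linarith
        _ ≤ k * k * a ^ (k - 1) := by gcongr; linarith
        _ ≤ _ := by rw [← sq]; gcongr
  rw [show ((q + k).choose k : ℝ) - a ^ k / k.factorial =
    ((((q + 1).ascFactorial k : ℕ) : ℝ) - a ^ k) / k.factorial by rw [← hasc]; field_simp,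
    abs_div, abs_of_pos hf]
  gcongr

lemma exists_pos_le_cast_eq {d : ℕ} (hd : 0 < d) (r : ZMod d) :
    ∃ s : ℕ, (0 < s ∧ s ≤ d) ∧ (s : ZMod d) = r := by
  have : NeZero d := ⟨hd.ne'⟩
  by_cases h : r = 0
  · exact ⟨d, ⟨hd, le_rfl⟩, by simp [h]⟩
  · exact ⟨r.val, ⟨Nat.pos_of_ne_zero (by simpa using h), (ZMod.val_lt r).le⟩, by simp⟩

lemma abs_card_residueClass_sub_le {k n d : ℕ} {ε : ℝ} (hk : 1 ≤ k) (hn : 0 < n) (hd : 0 < d)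
    (hε : 0 ≤ ε) (hε1 : ε ≤ 1) {r : Fin (k + 1) → ZMod d} (hr0 : r 0 = 0)
    (hr : ∑ i, r i = (n : ZMod d)) :
    |(#(residueClass k n d r) : ℝ) - ((n : ℝ) / d) ^ k / k.factorial| ≤
      (k : ℝ) ^ (k + 1) * ((n : ℝ) / d) ^ (k - 1) / k.factorial * ((n : ℝ) / d) ^ ε := by
  choose s hs hsr using fun i => exists_pos_le_cast_eq hd (r i)
  obtain rfl : (fun i => (s i : ZMod d)) = r := funext hsr
  have hdR : (0 : ℝ) < d := by exact_mod_cast hd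
  have hnR : (0 : ℝ) < n := by exact_mod_cast hn
  have hk' : (1 : ℝ) ≤ k := by exact_mod_cast hk
  have hkk : (k : ℝ) ≤ (k : ℝ) ^ (k + 1) := le_self_pow₀ hk' (by omega)
  have hf : (0 : ℝ) < k.factorial := by exact_mod_cast k.factorial_pos
  have ha : 0 < (n : ℝ) / d := by positivity
  have hs0 : s 0 = d := by
    have h1 := hs 0
    have := Nat.le_of_dvd h1.1 ((ZMod.natCast_eq_zero_iff _ _).1 hr0)
    omega
  have hlow : d + k ≤ ∑ i, s i := by
    rw [Fin.sum_univ_succ, hs0]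
    have : ∑ _i : Fin k, 1 ≤ ∑ i : Fin k, s i.succ := sum_le_sum fun i _ => (hs _).1
    simp at this
    omega
  have hup : ∑ i, s i ≤ (k + 1) * d := by
    calc _ ≤ ∑ _i : Fin (k + 1), d := sum_le_sum fun i _ => (hs i).2
      _ = _ := by simp
  have hmod : ∑ i, s i ≡ n [MOD d] := by
    rw [← ZMod.natCast_eq_natCast_iff]
    push_cast
    exact hr
  have hpow : ((n : ℝ) / d) ^ k = ((n : ℝ) / d) * ((n : ℝ) / d) ^ (k - 1) := by
    rw [← pow_succ', Nat.sub_add_cancel hk]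
  by_cases hle : ∑ i, s i ≤ n
  · obtain ⟨q, hq⟩ := (Nat.modEq_iff_dvd' hle).1 hmod
    have hnq : n = ∑ i, s i + d * q := by omega
    rw [card_residueClass hd hs hnq]
    have e1 : d * (q + 1) ≤ n := by rw [mul_add, mul_one]; omega
    have e2 : n ≤ (q + 1 + k) * d := by nlinarith
    have h1 : (q : ℝ) + 1 ≤ (n : ℝ) / d := by
      rw [le_div_iff₀ hdR, mul_comm]; exact_mod_cast e1
    have h2 : (n : ℝ) / d ≤ q + 1 + k := by
      rw [div_le_iff₀ hdR]; exact_mod_cast e2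
    refine (abs_choose_sub_pow_div_factorial_le hk h1 h2).trans ?_
    refine le_mul_of_one_le_right (by positivity) (Real.one_le_rpow ?_ hε)
    have : (0 : ℝ) ≤ q := Nat.cast_nonneg q
    linarith
  · push Not at hle
    rw [residueClass_eq_empty (fun i => (hs i).2) hle]
    obtain ⟨q, hq⟩ := (Nat.modEq_iff_dvd' hle.le).1 hmod.symm
    have hq0 : 0 < q := by
      rcases Nat.eq_zero_or_pos q with rfl | h
      · omega
      · exact h
    have e1 : n ≤ k * d := by
      have : d * 1 ≤ d * q := Nat.mul_le_mul_left d hq0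
      rw [add_mul] at hup
      omega
    have h1 : (n : ℝ) / d ≤ k := by
      rw [div_le_iff₀ hdR]; exact_mod_cast e1
    have h2 : (n : ℝ) / d ≤ (k : ℝ) ^ (k + 1) * ((n : ℝ) / d) ^ ε := by
      rcases le_total 1 ((n : ℝ) / d) with h | h
      · exact (h1.trans hkk).trans (le_mul_of_one_le_right (by positivity) (Real.one_le_rpow h hε))
      · have : (n : ℝ) / d ≤ ((n : ℝ) / d) ^ ε := by
          simpa using Real.rpow_le_rpow_of_exponent_ge ha h hε1
        exact this.trans (le_mul_of_one_le_left (by positivity) (hk'.trans hkk))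
    rw [card_empty, Nat.cast_zero, zero_sub, abs_neg, abs_of_nonneg (by positivity), hpow]
    calc _ ≤ (k : ℝ) ^ (k + 1) * ((n : ℝ) / d) ^ ε * ((n : ℝ) / d) ^ (k - 1) / k.factorial := by
          gcongr
      _ = _ := by ring

end ClassCount

/-- The tuples of `positiveTuples k n` for which `d` divides both `v 0` and `v 1 ⋯ v k`. -/
def commonDivisorTuples (k n d : ℕ) : Finset (Fin (k + 1) → ℕ) :=
  {v ∈ positiveTuples k n | d ∣ v 0 ∧ d ∣ ∏ i ∈ univ.erase 0, v i}

lemma abs_card_commonDivisorTuples_sub_le {k n d : ℕ} {ε : ℝ} (hk : 1 ≤ k) (hn : 0 < n)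
    (hd : 0 < d) (hε : 0 ≤ ε) (hε1 : ε ≤ 1) :
    |(#(commonDivisorTuples k n d) : ℝ) -
        Nat.card (DegenerateTuple k n (ZMod d)) * (((n : ℝ) / d) ^ k / k.factorial)| ≤
      Nat.card (DegenerateTuple k n (ZMod d)) *
        ((k : ℝ) ^ (k + 1) * ((n : ℝ) / d) ^ (k - 1) / k.factorial * ((n : ℝ) / d) ^ ε) := by
  have : NeZero d := ⟨hd.ne'⟩
  set S : Finset (Fin (k + 1) → ZMod d) :=
    {r | r 0 = 0 ∧ ∏ i ∈ univ.erase 0, r i = 0 ∧ ∑ i, r i = (n : ZMod d)} with hS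
  have hcard : Nat.card (DegenerateTuple k n (ZMod d)) = #S := by
    rw [Nat.card_eq_fintype_card, Fintype.card_subtype]
  have hmem : ∀ v ∈ positiveTuples k n, (fun i => (v i : ZMod d)) ∈ S ↔
      d ∣ v 0 ∧ d ∣ ∏ i ∈ univ.erase 0, v i := by
    intro v hv
    rw [mem_positiveTuples] at hv
    rw [hS, mem_filter, ← hv.2, ← ZMod.natCast_eq_zero_iff, ← ZMod.natCast_eq_zero_iff]
    push_cast
    simp
  have hsum : #(commonDivisorTuples k n d) = ∑ r ∈ S, #(residueClass k n d r) := by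
    rw [card_eq_sum_card_fiberwise (f := fun v i => (v i : ZMod d)) (t := S)]
    · refine sum_congr rfl fun r hr => ?_
      rw [commonDivisorTuples, residueClass, filter_filter]
      congr 1
      refine filter_congr fun v hv => ?_
      constructor
      · exact fun h => h.2
      · rintro rfl
        exact ⟨(hmem v hv).1 hr, rfl⟩
    · intro v hv
      rw [mem_coe, commonDivisorTuples, mem_filter] at hv
      exact (hmem v hv.1).2 hv.2
  rw [hcard, hsum, Nat.cast_sum, ← nsmul_eq_mul, ← nsmul_eq_mul, ← sum_const, ← sum_const,
    ← sum_sub_distrib]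
  refine (abs_sum_le_sum_abs _ _).trans (sum_le_sum fun r hr => ?_)
  rw [hS, mem_filter] at hr
  exact abs_card_residueClass_sub_le hk hn hd hε hε1 hr.2.1 hr.2.2.2

lemma prod_primes_dvd_iff {t : Finset ℕ} (ht : ∀ p ∈ t, p.Prime) (m : ℕ) :
    ∏ p ∈ t, p ∣ m ↔ ∀ p ∈ t, p ∣ m :=
  ⟨fun h _ hp => (dvd_prod_of_mem _ hp).trans h,
    fun h => prod_primes_dvd m (fun p hp => (ht p hp).prime) h⟩

lemma A_eq_card (k n : ℕ) :
    A k n = #{v ∈ positiveTuples k n | Nat.gcd (v 0) (∏ i ∈ univ.erase 0, v i) = 1} := by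
  rw [A]
  refine Nat.subtype_card _ fun v => ?_
  rw [mem_filter, mem_positiveTuples, and_assoc]

lemma ite_gcd_eq_one_eq_sum {n a b : ℕ} (ha : 0 < a) (han : a ≤ n) {s : Finset ℕ}
    (hs : ∀ p ∈ s, p.Prime) (hsn : ∀ p ≤ n, p.Prime → p ∈ s) :
    (if Nat.gcd a b = 1 then (1 : ℝ) else 0) =
      ∑ t ∈ s.powerset, (-1) ^ #t * if ∏ p ∈ t, p ∣ a ∧ ∏ p ∈ t, p ∣ b then (1 : ℝ) else 0 := by
  have h1 : (if Nat.gcd a b = 1 then (1 : ℝ) else 0) =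
      ∏ p ∈ s, (1 - if p ∣ a ∧ p ∣ b then (1 : ℝ) else 0) := by
    split_ifs with h
    · refine (prod_eq_one fun p hp => ?_).symm
      rw [if_neg, sub_zero]
      rintro ⟨h1, h2⟩
      have := Nat.dvd_gcd h1 h2
      rw [h] at this
      exact (hs p hp).ne_one (Nat.dvd_one.1 this)
    · obtain ⟨p, hp, hpd⟩ := Nat.exists_prime_and_dvd h
      have hpa := hpd.trans (Nat.gcd_dvd_left a b)
      have hps := hsn p ((Nat.le_of_dvd ha hpa).trans han) hp
      refine (prod_eq_zero hps ?_).symm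
      rw [if_pos ⟨hpa, hpd.trans (Nat.gcd_dvd_right a b)⟩, sub_self]
  rw [h1, prod_sub]
  refine sum_congr rfl fun t ht => ?_
  have htp : ∀ p ∈ t, p.Prime := fun p hp => hs p (mem_powerset.1 ht hp)
  rw [prod_const_one, mul_one, prod_ite_zero, prod_const_one]
  congr 2
  rw [prod_primes_dvd_iff htp, prod_primes_dvd_iff htp, ← forall₂_and]

lemma A_eq_sum_powerset {k n : ℕ} {s : Finset ℕ} (hs : ∀ p ∈ s, p.Prime)
    (hsn : ∀ p ≤ n, p.Prime → p ∈ s) :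
    (A k n : ℝ) =
      ∑ t ∈ s.powerset, (-1) ^ #t * (#(commonDivisorTuples k n (∏ p ∈ t, p)) : ℝ) := by
  have h : (A k n : ℝ) = ∑ v ∈ positiveTuples k n,
      if Nat.gcd (v 0) (∏ i ∈ univ.erase 0, v i) = 1 then (1 : ℝ) else 0 := by
    rw [A_eq_card, sum_boole]
  rw [h, sum_congr rfl fun v hv => ite_gcd_eq_one_eq_sum (n := n) ((mem_positiveTuples.1 hv).1 0)
    (((mem_positiveTuples.1 hv).2) ▸ single_le_sum (fun _ _ => Nat.zero_le _) (mem_univ 0))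
    hs hsn, sum_comm]
  refine sum_congr rfl fun t _ => ?_
  rw [← mul_sum, sum_boole, commonDivisorTuples]

lemma abs_A_sub_prod_le {k n : ℕ} {ε : ℝ} (hk : 2 ≤ k) (hn : 0 < n) (hε : 0 ≤ ε) (hε1 : ε ≤ 1)
    {s : Finset ℕ} (hs : ∀ p ∈ s, p.Prime) (hsn : ∀ p ≤ n, p.Prime → p ∈ s) :
    |(A k n : ℝ) - (∏ p ∈ s, (1 - (Nat.card (DegenerateTuple k n (ZMod p)) : ℝ) / (p : ℝ) ^ k)) *
        ((n : ℝ) ^ k / k.factorial)| ≤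
      (k : ℝ) ^ (k + 1) * (n : ℝ) ^ (k - 1) / k.factorial * (n : ℝ) ^ ε *
        ∏ p ∈ s, (1 + k * (p : ℝ) ^ (-(1 + ε))) := by
  rw [A_eq_sum_powerset hs hsn, prod_sub, sum_mul, prod_one_add, mul_sum, ← sum_sub_distrib]
  refine (abs_sum_le_sum_abs _ _).trans (sum_le_sum fun t ht => ?_)
  have htp : ∀ p ∈ t, p.Prime := fun p hp => hs p (mem_powerset.1 ht hp)
  have hp0 : ∀ p ∈ t, (0 : ℝ) < p := fun p hp => by exact_mod_cast (htp p hp).pos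
  have hd : 0 < ∏ p ∈ t, p := prod_pos fun p hp => (htp p hp).pos
  have hdR : (0 : ℝ) < ∏ p ∈ t, (p : ℝ) := prod_pos hp0
  have hmain := abs_card_commonDivisorTuples_sub_le (k := k) (by omega) hn hd hε hε1
  rw [card_degenerateTuple_prod k n t htp, Nat.cast_prod, Nat.cast_prod] at hmain
  have e1 : (-1 : ℝ) ^ #t * (#(commonDivisorTuples k n (∏ p ∈ t, p)) : ℝ) -
      (-1) ^ #t * (∏ p ∈ s \ t, (1 : ℝ)) *
        (∏ p ∈ t, (Nat.card (DegenerateTuple k n (ZMod p)) : ℝ) / (p : ℝ) ^ k) *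
        ((n : ℝ) ^ k / k.factorial) =
      (-1) ^ #t * ((#(commonDivisorTuples k n (∏ p ∈ t, p)) : ℝ) -
        (∏ p ∈ t, (Nat.card (DegenerateTuple k n (ZMod p)) : ℝ)) *
          (((n : ℝ) / ∏ p ∈ t, (p : ℝ)) ^ k / k.factorial)) := by
    rw [prod_const_one, prod_div_distrib, prod_pow, div_pow]
    field_simp
  rw [e1, abs_mul, abs_pow, abs_neg, abs_one, one_pow, one_mul]
  refine hmain.trans ?_
  have e2 : (∏ p ∈ t, (Nat.card (DegenerateTuple k n (ZMod p)) : ℝ)) *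
      ((k : ℝ) ^ (k + 1) * ((n : ℝ) / ∏ p ∈ t, (p : ℝ)) ^ (k - 1) / k.factorial *
        ((n : ℝ) / ∏ p ∈ t, (p : ℝ)) ^ ε) =
      (k : ℝ) ^ (k + 1) * (n : ℝ) ^ (k - 1) / k.factorial * (n : ℝ) ^ ε *
        ∏ p ∈ t, ((Nat.card (DegenerateTuple k n (ZMod p)) : ℝ) /
          ((p : ℝ) ^ (k - 1) * (p : ℝ) ^ ε)) := by
    rw [prod_div_distrib, prod_mul_distrib, prod_pow,
      Real.finsetProd_rpow _ _ (fun p hp => (hp0 p hp).le), div_pow,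
      Real.div_rpow (Nat.cast_nonneg n) hdR.le]
    field_simp
  rw [e2]
  refine mul_le_mul_of_nonneg_left (prod_le_prod (fun p hp => ?_) fun p hp => ?_) (by positivity)
  · positivity
  · have := Fact.mk (htp p hp)
    have h := hp0 p hp
    obtain ⟨j, rfl⟩ := Nat.exists_eq_add_of_le' hk
    have hle := card_degenerateTuple_le (F := ZMod p) j n
    rw [ZMod.card] at hle
    rw [div_le_iff₀ (by positivity), Real.rpow_neg h.le, Real.rpow_add h, Real.rpow_one]
    have hε' := Real.rpow_pos_of_pos h ε
    refine hle.trans (le_of_eq ?_)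
    rw [show j + 2 - 1 = j + 1 by omega, pow_succ]
    push_cast
    field_simp

lemma sum_Icc_rpow_le {ε : ℝ} (hε : 0 < ε) {N : ℕ} (hN : 1 ≤ N) :
    ∑ m ∈ Icc 1 N, (m : ℝ) ^ (-(1 + ε)) ≤ 1 + 1 / ε - (N : ℝ) ^ (-ε) / ε := by
  induction N, hN using Nat.le_induction with
  | base => simp
  | succ N hN ih =>
    rw [sum_Icc_succ_top (by omega)]
    have hN0 : (0 : ℝ) < N := by exact_mod_cast hN
    have hx : (0 : ℝ) < ((N + 1 : ℕ) : ℝ) := by positivity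
    set x : ℝ := ((N + 1 : ℕ) : ℝ) with hxdef
    have hxN : x = N + 1 := by rw [hxdef]; push_cast; rfl
    have h1 : 1 + ε / x ≤ (x / N) ^ ε := by
      have hlog : 1 / x ≤ Real.log (x / N) := by
        refine le_trans (le_of_eq ?_) (Real.one_sub_inv_le_log_of_pos (by positivity))
        rw [inv_div, hxN]; field_simp; ring
      rw [Real.rpow_def_of_pos (by positivity)]
      have h2 := Real.add_one_le_exp (Real.log (x / N) * ε)
      have h3 : 1 / x * ε ≤ Real.log (x / N) * ε := by gcongr
      have h4 : ε / x = 1 / x * ε := by ring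
      linarith
    have h2 : (N : ℝ) ^ (-ε) = x ^ (-ε) * (x / N) ^ ε := by
      have := Real.rpow_pos_of_pos hx ε
      rw [Real.div_rpow hx.le hN0.le, Real.rpow_neg hx.le, Real.rpow_neg hN0.le]
      field_simp
    have h3 : x ^ (-(1 + ε)) = x ^ (-ε) / x := by
      rw [neg_add, Real.rpow_add hx, Real.rpow_neg_one]; ring
    have h4 : x ^ (-ε) * (1 + ε / x) ≤ (N : ℝ) ^ (-ε) := by
      rw [h2]; gcongr
    have h5 : x ^ (-(1 + ε)) ≤ ((N : ℝ) ^ (-ε) - x ^ (-ε)) / ε := by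
      rw [le_div_iff₀ hε, h3]
      have : x ^ (-ε) * (1 + ε / x) = x ^ (-ε) + x ^ (-ε) / x * ε := by ring
      linarith
    rw [sub_div] at h5
    linarith

lemma prod_one_add_rpow_le {ε : ℝ} (hε : 0 < ε) {s : Finset ℕ} (hs : ∀ p ∈ s, p.Prime) :
    ∏ p ∈ s, (1 + (p : ℝ) ^ (-(1 + ε))) ≤ 1 + 1 / ε := by
  have hN : 1 ≤ ∏ p ∈ s, p := prod_pos fun p hp => (hs p hp).pos
  have hinj : Set.InjOn (fun t : Finset ℕ => ∏ p ∈ t, p) (s.powerset : Set (Finset ℕ)) := by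
    intro t ht t' ht' h
    rw [mem_coe, mem_powerset] at ht ht'
    have h' := congrArg Nat.primeFactors h
    simpa only [Nat.primeFactors_prod fun p hp => hs p (ht hp),
      Nat.primeFactors_prod fun p hp => hs p (ht' hp)] using h'
  calc ∏ p ∈ s, (1 + (p : ℝ) ^ (-(1 + ε)))
      = ∑ t ∈ s.powerset, ((∏ p ∈ t, p : ℕ) : ℝ) ^ (-(1 + ε)) := by
        rw [prod_one_add]
        refine sum_congr rfl fun t _ => ?_
        rw [Real.finsetProd_rpow _ _ (fun p _ => Nat.cast_nonneg p), Nat.cast_prod]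
    _ = ∑ m ∈ s.powerset.image (fun t => ∏ p ∈ t, p), (m : ℝ) ^ (-(1 + ε)) :=
        (sum_image (f := fun m : ℕ => (m : ℝ) ^ (-(1 + ε))) hinj).symm
    _ ≤ ∑ m ∈ Icc 1 (∏ p ∈ s, p), (m : ℝ) ^ (-(1 + ε)) := by
        refine sum_le_sum_of_subset_of_nonneg ?_ fun m _ _ => by positivity
        intro m hm
        obtain ⟨t, ht, rfl⟩ := mem_image.1 hm
        rw [mem_powerset] at ht
        rw [mem_Icc]
        exact ⟨prod_pos fun p hp => (hs p (ht hp)).pos,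
          Nat.le_of_dvd hN (prod_dvd_prod_of_subset _ _ _ ht)⟩
    _ ≤ 1 + 1 / ε - ((∏ p ∈ s, p : ℕ) : ℝ) ^ (-ε) / ε := sum_Icc_rpow_le hε hN
    _ ≤ 1 + 1 / ε := by
        have : 0 ≤ ((∏ p ∈ s, p : ℕ) : ℝ) ^ (-ε) / ε := by positivity
        linarith

lemma prod_one_add_mul_rpow_le {ε : ℝ} (hε : 0 < ε) (k : ℕ) {s : Finset ℕ}
    (hs : ∀ p ∈ s, p.Prime) :
    ∏ p ∈ s, (1 + k * (p : ℝ) ^ (-(1 + ε))) ≤ (1 + 1 / ε) ^ k := by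
  calc _ ≤ ∏ p ∈ s, (1 + (p : ℝ) ^ (-(1 + ε))) ^ k := by
        refine prod_le_prod (fun p _ => by positivity) fun p _ => ?_
        refine one_add_mul_le_pow ?_ k
        have : (0 : ℝ) ≤ (p : ℝ) ^ (-(1 + ε)) := by positivity
        linarith
    _ = (∏ p ∈ s, (1 + (p : ℝ) ^ (-(1 + ε)))) ^ k := prod_pow _ _ _
    _ ≤ _ := pow_le_pow_left₀ (prod_nonneg fun p _ => by positivity) (prod_one_add_rpow_le hε hs) k

lemma prod_one_sub_card_degenerateTuple {k n : ℕ} (hk : 1 ≤ k) (hn : 0 < n) {s : Finset ℕ}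
    (hs : ∀ p ∈ s, p.Prime) (hsn : ∀ p ≤ n, p.Prime → p ∈ s) :
    ∏ p ∈ s, (1 - (Nat.card (DegenerateTuple k n (ZMod p)) : ℝ) / (p : ℝ) ^ k) =
      (∏ p ∈ s, (1 - psi k p / (p : ℝ) ^ k)) * f k n := by
  have hfac : n.primeFactors = {p ∈ s | p ∣ n} := by
    ext p
    rw [Nat.mem_primeFactors, mem_filter]
    exact ⟨fun h => ⟨hsn p (Nat.le_of_dvd hn h.2.1) h.1, h.2.1⟩,
      fun h => ⟨hs p h.1, h.2, hn.ne'⟩⟩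
  rw [f, hfac, prod_filter, ← prod_mul_distrib]
  refine prod_congr rfl fun p hp => ?_
  have h1 := psi_lt_pow hk (hs p hp)
  have h2 : (0 : ℝ) < (p : ℝ) ^ k := by
    have : (0 : ℝ) < p := by exact_mod_cast (hs p hp).pos
    positivity
  have h3 : (p : ℝ) ^ k - psi k p ≠ 0 := by linarith
  rw [card_degenerateTuple_zmod hk (hs p hp)]
  split_ifs
  · field_simp
    ring
  · simp

lemma multipliable_one_sub_psi {k : ℕ} (hk : 2 ≤ k) :
    Multipliable fun p : Nat.Primes => 1 - psi k (p : ℕ) / ((p : ℕ) : ℝ) ^ k := by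
  simp_rw [sub_eq_add_neg]
  refine multipliable_one_add_of_summable (Summable.of_nonneg_of_le (fun _ => norm_nonneg _)
    (fun p => ?_) ((Nat.Primes.summable_rpow.2 (by norm_num : (-2 : ℝ) < -1)).mul_left (k : ℝ)))
  obtain ⟨h1, h2⟩ := psi_nonneg_and_le hk p.2
  have hp : (0 : ℝ) < (p : ℕ) := by exact_mod_cast p.2.pos
  rw [norm_neg, Real.norm_of_nonneg (by positivity), div_le_iff₀ (by positivity),
    Real.rpow_neg hp.le, Real.rpow_two]
  refine h2.trans (le_of_eq ?_)
  obtain ⟨j, rfl⟩ := Nat.exists_eq_add_of_le' hk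
  rw [Nat.add_sub_cancel, pow_add]
  field_simp

lemma abs_A_sub_main_le {k n : ℕ} {ε : ℝ} (hk : 2 ≤ k) (hn : 0 < n) (hε : 0 < ε) (hε1 : ε ≤ 1) :
    |(A k n : ℝ) - C k * f k n * (n : ℝ) ^ k / (k.factorial : ℝ)| ≤
      (k : ℝ) ^ (k + 1) * (n : ℝ) ^ (k - 1) / k.factorial * (n : ℝ) ^ ε * (1 + 1 / ε) ^ k := by
  have hprod := (multipliable_one_sub_psi hk).hasProd
  rw [HasProd] at hprod
  have hlim := ((((hprod.mul_const (f k n)).mul_const ((n : ℝ) ^ k)).div_const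
    (k.factorial : ℝ)).const_sub (A k n : ℝ)).abs
  refine le_of_tendsto hlim ?_
  filter_upwards [Filter.eventually_ge_atTop ((Finset.range (n + 1)).subtype Nat.Prime)] with T hT
  set s : Finset ℕ := T.map ⟨fun p : Nat.Primes => (p : ℕ), Subtype.val_injective⟩ with hsdef
  have hs : ∀ p ∈ s, p.Prime := by
    intro p hp
    obtain ⟨q, _, rfl⟩ := mem_map.1 hp
    exact q.2
  have hsn : ∀ p ≤ n, p.Prime → p ∈ s := by
    intro p hpn hp
    exact mem_map.2 ⟨⟨p, hp⟩, hT (mem_subtype.2 (mem_range.2 (by simpa [Nat.lt_succ_iff] using hpn))),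
      rfl⟩
  have hprod' : ∏ p ∈ T, (1 - psi k (p : ℕ) / ((p : ℕ) : ℝ) ^ k) =
      ∏ p ∈ s, (1 - psi k p / (p : ℝ) ^ k) := by
    rw [hsdef, prod_map]; rfl
  rw [hprod', ← prod_one_sub_card_degenerateTuple (by omega) hn hs hsn, mul_div_assoc]
  refine (abs_A_sub_prod_le hk hn hε.le hε1 hs hsn).trans ?_
  exact mul_le_mul_of_nonneg_left (prod_one_add_mul_rpow_le hε k hs) (by positivity)

lemma A_one {n : ℕ} (hn : 1 < n) : A 1 n = n.totient := by
  rw [A, Nat.totient_eq_card_lt_and_coprime]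
  refine Nat.card_congr
    { toFun := fun v => ⟨v.1 0, ?_⟩
      invFun := fun m => ⟨![m.1, n - m.1], ?_⟩
      left_inv := ?_
      right_inv := fun m => by simp }
  · obtain ⟨v, hv, hs, hg⟩ := v
    rw [prod_erase_zero_eq] at hg
    simp only [Fin.prod_univ_one, Fin.succ_zero_eq_one] at hg
    rw [Fin.sum_univ_two v] at hs
    have := hv 1
    refine ⟨show v 0 < n by omega, show n.Coprime (v 0) from ?_⟩
    rw [← hs, Nat.coprime_comm]
    simpa using hg
  · obtain ⟨m, hm, hc⟩ := m
    have hm0 : 0 < m := by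
      rcases Nat.eq_zero_or_pos m with rfl | h
      · simp at hc; omega
      · exact h
    refine ⟨?_, ?_, ?_⟩
    · simp [Fin.forall_fin_two]; omega
    · simp; omega
    · rw [prod_erase_zero_eq]
      simpa using (Nat.coprime_sub_self_right hm.le).2 hc.symm
  · rintro ⟨v, hv, hs, hg⟩
    rw [Fin.sum_univ_two v] at hs
    ext i
    fin_cases i
    · rfl
    · simp; omega

lemma C_one_mul_f_one {n : ℕ} : C 1 * f 1 n * n = n.totient := by
  have hpsi : ∀ p : ℕ, psi 1 p = 0 := fun p => by simp [psi]
  have hC : C 1 = 1 := by simp [C, hpsi]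
  have h := congrArg (Rat.cast : ℚ → ℝ) (Nat.totient_eq_mul_prod_factors n)
  push_cast at h
  rw [hC, h, one_mul, f, mul_comm]
  congr 1
  refine prod_congr rfl fun p _ => ?_
  rw [hpsi]
  simp [neg_div, ← sub_eq_add_neg]

lemma stirling_error_le {k n : ℕ} (hn : 4 ≤ n) :
    (k : ℝ) ^ (k + 1) * (n : ℝ) ^ (k - 1) / k.factorial * Real.exp 1 * (1 + Real.log n) ^ k ≤
      (2 + Real.exp 1) / Real.sqrt (2 * Real.pi * k) *
        (Real.exp 1 ^ 2 * Real.log n) ^ k * (n : ℝ) ^ (k - 1) := by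
  rcases Nat.eq_zero_or_pos k with rfl | hk
  · simp
  have hk' : (0 : ℝ) < k := by exact_mod_cast hk
  have he := Real.exp_one_gt_d9
  set e := Real.exp 1
  set L := Real.log n
  have hL : 1.386 ≤ L := by
    have h4 : Real.log 4 = 2 * Real.log 2 := by
      rw [show (4 : ℝ) = 2 ^ 2 by norm_num, Real.log_pow]; norm_num
    have : Real.log 4 ≤ L := Real.log_le_log (by norm_num) (by exact_mod_cast hn)
    linarith [Real.log_two_gt_d9]
  have hsq : (k : ℝ) ≤ (25 / 16) ^ k := by
    have h1 : 1 + (k : ℝ) * (1 / 4) ≤ (1 + 1 / 4) ^ k := one_add_mul_le_pow (by norm_num) k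
    have h2 : (25 / 16 : ℝ) ^ k = ((1 + 1 / 4) ^ k) ^ 2 := by
      rw [← pow_mul, mul_comm, pow_mul]; norm_num
    rw [h2]
    nlinarith [sq_nonneg (1 - (k : ℝ) * (1 / 4))]
  have hlog : (25 / 16) * (1 + L) ≤ e * L := by nlinarith
  have hmain : k * e * (1 + L) ^ k ≤ (2 + e) * (e * L) ^ k := by
    calc k * e * (1 + L) ^ k ≤ (25 / 16) ^ k * (2 + e) * (1 + L) ^ k := by
          gcongr; linarith
      _ = (2 + e) * (25 / 16 * (1 + L)) ^ k := by rw [mul_pow]; ring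
      _ ≤ _ := by gcongr
  have hst := Stirling.le_factorial_stirling k
  have hroot : 0 < Real.sqrt (2 * Real.pi * k) := by positivity
  set S := Real.sqrt (2 * Real.pi * k)
  calc _ ≤ (k : ℝ) ^ (k + 1) * (n : ℝ) ^ (k - 1) / (S * (k / e) ^ k) * e * (1 + L) ^ k := by
        gcongr
    _ = k * e * (1 + L) ^ k * (e ^ k * (n : ℝ) ^ (k - 1) / S) := by
        rw [div_pow, pow_succ]; field_simp
    _ ≤ (2 + e) * (e * L) ^ k * (e ^ k * (n : ℝ) ^ (k - 1) / S) := by gcongr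
    _ = _ := by rw [sq, mul_assoc e e L, mul_pow e (e * L)]; ring

end

theorem statement0 (k n : ℕ) (hk : 1 ≤ k) (hn : k + 1 < n) :
    |(A k n : ℝ) - C k * f k n * (n : ℝ) ^ k / (Nat.factorial k : ℝ)| ≤
      (2 + Real.exp 1) / Real.sqrt (2 * Real.pi * k) *
        (Real.exp 1 ^ 2 * Real.log n) ^ k * (n : ℝ) ^ (k - 1) := by
  rcases hk.eq_or_lt with rfl | hk2
  · have h := C_one_mul_f_one (n := n)
    rw [A_one (by omega), pow_one, Nat.factorial_one, Nat.cast_one, div_one, h, sub_self, abs_zero]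
    have := Real.log_natCast_nonneg n
    positivity
  · have hn4 : 4 ≤ n := by omega
    have hL : 1 ≤ Real.log n := by
      rw [Real.le_log_iff_exp_le (by positivity)]
      have : (4 : ℝ) ≤ n := by exact_mod_cast hn4
      linarith [Real.exp_one_lt_three]
    have hexp : (n : ℝ) ^ (1 / Real.log n) = Real.exp 1 := by
      rw [Real.rpow_def_of_pos (by positivity), mul_one_div_cancel (by positivity)]
    have h := abs_A_sub_main_le (k := k) (n := n) (ε := 1 / Real.log n) hk2 (by omega)
      (by positivity) (by rw [div_le_one (by positivity)]; exact hL)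
    rw [hexp, one_div_one_div] at h
    exact h.trans (stirling_error_le hn4)
end

section
/- For every integer k ≥ 2, the infinite product C_k = ∏_p (1 − ψ_k(p)/p^k) over all primes p converges and satisfies 0 < C_k < 1. Furthermore, for every positive integer n, 2/3 < f_k(n) < 2. -/
open Real

theorem neg_one_pow_mem (k : ℕ) : (-1 : ℝ) ≤ (-1) ^ k ∧ (-1 : ℝ) ^ k ≤ 1 := by
  rcases neg_one_pow_eq_or ℝ k with h | h <;> rw [h] <;> norm_num

theorem sub_one_pow_le {x : ℝ} (hx : 1 ≤ x) (k : ℕ) :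
    (x - 1) ^ (k + 1) ≤ (x - 1) * x ^ k := by
  rw [pow_succ']
  exact mul_le_mul_of_nonneg_left (pow_le_pow_left₀ (by linarith) (by linarith) k) (by linarith)

theorem psi_pos {k : ℕ} (hk : 2 ≤ k) {x : ℝ} (hx : 2 ≤ x) : 0 < psi k x := by
  obtain ⟨j, rfl⟩ := Nat.exists_eq_add_of_le' hk
  have h1 := sub_one_pow_le (by linarith : 1 ≤ x) (j + 1)
  have h2 := (neg_one_pow_mem (j + 2)).1
  have h3 : x ≤ x ^ (j + 1) := le_self_pow₀ (by linarith) (by lia)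
  have h4 : x ^ (j + 2) = x * x ^ (j + 1) := pow_succ' _ _
  exact div_pos (by linarith) (by linarith)

/-- The quantity `x ^ k - ψ_k(x)` is at least `x ^ (k - 1) * (x - 1)`. -/
theorem le_pow_sub_psi {k : ℕ} {x : ℝ} (hx : 2 ≤ x) :
    x ^ k * (x - 1) ≤ x ^ (k + 1) - psi (k + 1) x := by
  have h1 : 1 ≤ (x - 1) ^ (k + 1) := one_le_pow₀ (by linarith)
  have h2 := (neg_one_pow_mem (k + 1)).2
  have h3 : psi (k + 1) x ≤ x ^ k := by
    rw [psi, div_le_iff₀ (by linarith), ← pow_succ]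
    linarith
  linarith [pow_succ x k]

theorem psi_div_pow_le {k : ℕ} (hk : 2 ≤ k) {x : ℝ} (hx : 1 ≤ x) :
    psi k x / x ^ k ≤ (k + 1) * (x ^ 2)⁻¹ := by
  obtain ⟨j, rfl⟩ := Nat.exists_eq_add_of_le' hk
  have hx0 : 0 < x := by linarith
  have hp : ∀ i : ℕ, x ^ (i + 1) - (x - 1) ^ (i + 1) ≤ (i + 1) * x ^ i := by
    intro i
    induction i with
    | zero => simp
    | succ i ih =>
      have h := pow_le_pow_left₀ (by linarith : 0 ≤ x - 1) (by linarith : x - 1 ≤ x) (i + 1)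
      have h' := mul_le_mul_of_nonneg_left ih hx0.le
      push_cast
      rw [pow_succ' x (i + 1), pow_succ' (x - 1) (i + 1)]
      rw [pow_succ' x i] at *
      nlinarith
  have h1 := hp (j + 1)
  have h2 := (neg_one_pow_mem (j + 2)).2
  have h3 : 1 ≤ x ^ (j + 1) := one_le_pow₀ hx
  have h4 : psi (j + 2) x ≤ (j + 3) * x ^ j := by
    rw [psi, div_le_iff₀ hx0, mul_assoc, ← pow_succ]
    push_cast at h1
    linarith
  rw [div_le_iff₀ (by positivity), pow_add]
  field_simp
  push_cast
  linarith

theorem summable_psi_div_pow {k : ℕ} (hk : 2 ≤ k) :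
    Summable fun p : Nat.Primes => -(psi k (p : ℕ) / ((p : ℕ) : ℝ) ^ k) := by
  have hs : Summable fun p : Nat.Primes => ((k : ℝ) + 1) * (((p : ℕ) : ℝ) ^ 2)⁻¹ :=
    ((Real.summable_nat_pow_inv.2 one_lt_two).comp_injective
      Nat.Primes.coe_nat_injective).mul_left _
  refine (Summable.of_nonneg_of_le (fun p => ?_) (fun p => ?_) hs).neg
  · have hp : (2 : ℝ) ≤ (p : ℕ) := mod_cast p.2.two_le
    exact div_nonneg (psi_pos hk hp).le (by positivity)
  · exact psi_div_pow_le hk (mod_cast p.2.one_le)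

theorem psi_two {x : ℝ} (hx : x ≠ 0) : psi 2 x = 2 := by
  rw [psi]
  field_simp
  ring

theorem sq_sub_two_le_pow_sub_psi {k : ℕ} (hk : Even k) (hk2 : 2 ≤ k) {x : ℝ} (hx : 2 ≤ x) :
    x ^ 2 - 2 ≤ x ^ k - psi k x := by
  rcases hk2.eq_or_lt with rfl | h
  · rw [psi_two (by linarith)]
  · obtain ⟨j, rfl⟩ := Nat.exists_eq_add_of_le' hk2
    refine le_trans ?_ (le_pow_sub_psi hx)
    have : x ^ 2 ≤ x ^ (j + 1) := pow_le_pow_right₀ (by linarith) (by lia)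
    nlinarith

theorem sq_mul_sub_one_le_pow_sub_psi {k : ℕ} (hk : 3 ≤ k) {x : ℝ} (hx : 2 ≤ x) :
    x ^ 2 * (x - 1) ≤ x ^ k - psi k x := by
  obtain ⟨j, rfl⟩ := Nat.exists_eq_add_of_le' hk
  refine le_trans ?_ (le_pow_sub_psi hx)
  exact mul_le_mul_of_nonneg_right (pow_le_pow_right₀ (by linarith) (by lia)) (by linarith)

theorem prod_primesBelow_add_two {M : Type*} [CommMonoid M] (g : ℕ → M) {j : ℕ} (hj : 1 ≤ j) :
    ∏ p ∈ Nat.primesBelow (2 * j + 3), g p =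
      (∏ p ∈ Nat.primesBelow (2 * j + 1), g p) * if (2 * j + 1).Prime then g (2 * j + 1) else 1 := by
  have h : ¬ (2 * j + 2).Prime := fun h => by
    have := (h.even_iff).1 ⟨j + 1, by ring⟩
    lia
  simp only [Nat.primesBelow, Finset.prod_filter]
  rw [Finset.prod_range_succ, Finset.prod_range_succ, if_neg h, mul_one]

theorem prod_primesBelow_le {j : ℕ} (hj : 2 ≤ j) :
    ∏ p ∈ Nat.primesBelow (2 * j + 1), (1 + 1 / ((p : ℝ) ^ 2 - 2)) ≤
      2 * (4 * (j : ℝ) - 2) / (4 * j - 1) := by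
  induction j, hj using Nat.le_induction with
  | base =>
    have : Nat.primesBelow (2 * 2 + 1) = {2, 3} := by decide
    rw [this]
    norm_num
  | succ j hj ih =>
    rw [show 2 * (j + 1) + 1 = 2 * j + 3 by ring, prod_primesBelow_add_two _ (by lia)]
    have hj' : (2 : ℝ) ≤ j := mod_cast hj
    have hD : (0 : ℝ) < (2 * j + 1) ^ 2 - 2 := by nlinarith
    have h1 : (if (2 * j + 1).Prime then 1 + 1 / (((2 * j + 1 : ℕ) : ℝ) ^ 2 - 2) else 1) ≤
        1 + 1 / ((2 * (j : ℝ) + 1) ^ 2 - 2) := by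
      split_ifs
      · push_cast; rfl
      · have := one_div_pos.2 hD
        linarith
    have hB : (0 : ℝ) < 4 * j - 1 := by linarith
    have hB' : (0 : ℝ) < 4 * (j + 1) - 1 := by linarith
    have h0 : (0 : ℝ) ≤ 2 * (4 * j - 2) / (4 * j - 1) := div_nonneg (by linarith) hB.le
    refine (mul_le_mul ih h1 (by split_ifs <;> push_cast <;> positivity) h0).trans ?_
    push_cast
    rw [one_add_div hD.ne', div_mul_div_comm, div_le_div_iff₀ (by positivity) hB']
    have h3 : (0 : ℝ) ≤ (j - 2) ^ 2 := sq_nonneg _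
    nlinarith [mul_nonneg (sub_nonneg.2 hj') h3]

theorem le_prod_primesBelow {j : ℕ} (hj : 1 ≤ j) :
    (8 * (j : ℝ) + 1) / (12 * j) ≤
      ∏ p ∈ Nat.primesBelow (2 * j + 1), (1 - 1 / ((p : ℝ) ^ 2 * (p - 1))) := by
  induction j, hj using Nat.le_induction with
  | base =>
    have : Nat.primesBelow (2 * 1 + 1) = {2} := by decide
    rw [this]
    norm_num
  | succ j hj ih =>
    rw [show 2 * (j + 1) + 1 = 2 * j + 3 by ring, prod_primesBelow_add_two _ (by lia)]
    have hj' : (1 : ℝ) ≤ j := mod_cast hj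
    have hD : (0 : ℝ) < (2 * j + 1) ^ 2 * (2 * j + 1 - 1) := by
      have : (0 : ℝ) < 2 * j + 1 - 1 := by linarith
      positivity
    have hD1 : (1 : ℝ) ≤ (2 * j + 1) ^ 2 * (2 * j + 1 - 1) := by nlinarith
    have h1 : 1 - 1 / ((2 * (j : ℝ) + 1) ^ 2 * (2 * j + 1 - 1)) ≤
        if (2 * j + 1).Prime then
          1 - 1 / (((2 * j + 1 : ℕ) : ℝ) ^ 2 * (((2 * j + 1 : ℕ) : ℝ) - 1)) else 1 := by
      split_ifs
      · push_cast; rfl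
      · have := one_div_pos.2 hD
        linarith
    have h0 : (0 : ℝ) ≤ 1 - 1 / ((2 * (j : ℝ) + 1) ^ 2 * (2 * j + 1 - 1)) :=
      sub_nonneg.2 ((div_le_one hD).2 hD1)
    refine le_trans ?_ (mul_le_mul ih h1 h0 (le_trans (by positivity) ih))
    push_cast
    rw [one_sub_div hD.ne', div_mul_div_comm, div_le_div_iff₀ (by positivity) (by positivity)]
    have h3 : (0 : ℝ) ≤ (j - 1) ^ 2 := sq_nonneg _
    have h4 : (0 : ℝ) ≤ j * (8 * j ^ 3 - 7 * j - 1) := by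
      have : (0 : ℝ) ≤ 8 * j ^ 3 - 7 * j - 1 := by nlinarith [mul_nonneg (sub_nonneg.2 hj') h3]
      positivity
    nlinarith

theorem primeFactors_subset_primesBelow {n N : ℕ} (hn : n < N) :
    n.primeFactors ⊆ Nat.primesBelow N := fun p hp => by
  rw [Nat.mem_primesBelow]
  exact ⟨(Nat.le_of_mem_primeFactors hp).trans_lt hn, Nat.prime_of_mem_primeFactors hp⟩

theorem f_bounds_of_even {k : ℕ} (hk : Even k) (hk2 : 2 ≤ k) (n : ℕ) :
    1 ≤ f k n ∧ f k n < 2 := by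
  have hD {p : ℕ} (hp : p.Prime) : 0 < (p : ℝ) ^ 2 - 2 ∧
      (p : ℝ) ^ 2 - 2 ≤ (p : ℝ) ^ k - psi k p := by
    have h2 : (2 : ℝ) ≤ p := mod_cast hp.two_le
    exact ⟨by nlinarith, sq_sub_two_le_pow_sub_psi hk hk2 h2⟩
  rw [f, hk.neg_one_pow]
  constructor
  · refine Finset.one_le_prod fun p hp => ?_
    have h := hD (Nat.prime_of_mem_primeFactors hp)
    have := one_div_pos.2 (h.1.trans_le h.2)
    linarith
  · have hj : (2 : ℝ) ≤ (n + 2 : ℕ) := by push_cast; linarith [n.cast_nonneg (α := ℝ)]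
    calc ∏ p ∈ n.primeFactors, (1 + 1 / ((p : ℝ) ^ k - psi k p))
        ≤ ∏ p ∈ n.primeFactors, (1 + 1 / ((p : ℝ) ^ 2 - 2)) := by
          refine Finset.prod_le_prod (fun p hp => ?_) fun p hp => ?_
          all_goals have h := hD (Nat.prime_of_mem_primeFactors hp)
          · have := one_div_pos.2 (h.1.trans_le h.2)
            linarith
          · linarith [one_div_le_one_div_of_le h.1 h.2]
      _ ≤ ∏ p ∈ Nat.primesBelow (2 * (n + 2) + 1), (1 + 1 / ((p : ℝ) ^ 2 - 2)) := by
          refine Finset.prod_le_prod_of_subset_of_one_le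
            (primeFactors_subset_primesBelow (by lia)) (fun p hp => ?_) fun p hp _ => ?_
          · have := one_div_pos.2 (hD (Nat.prime_of_mem_primeFactors hp)).1
            linarith
          · have := one_div_pos.2 (hD (Nat.prime_of_mem_primesBelow hp)).1
            linarith
      _ ≤ _ := prod_primesBelow_le (by lia)
      _ < 2 := by
          rw [div_lt_iff₀ (by linarith)]
          linarith

theorem f_bounds_of_odd {k : ℕ} (hk : Odd k) (hk2 : 2 ≤ k) (n : ℕ) :
    2 / 3 < f k n ∧ f k n ≤ 1 := by
  have hk3 : 3 ≤ k := by
    obtain ⟨m, rfl⟩ := hk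
    lia
  have hD {p : ℕ} (hp : p.Prime) : 1 ≤ (p : ℝ) ^ 2 * (p - 1) ∧
      (p : ℝ) ^ 2 * (p - 1) ≤ (p : ℝ) ^ k - psi k p := by
    have h2 : (2 : ℝ) ≤ p := mod_cast hp.two_le
    exact ⟨by nlinarith, sq_mul_sub_one_le_pow_sub_psi hk3 h2⟩
  have hU {D : ℝ} (h : 1 ≤ D) : 0 ≤ 1 - 1 / D ∧ 1 - 1 / D ≤ 1 := by
    have h0 : 0 < D := by linarith
    exact ⟨sub_nonneg.2 ((div_le_one h0).2 h), by linarith [one_div_pos.2 h0]⟩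
  rw [f, hk.neg_one_pow]
  simp only [neg_div, ← sub_eq_add_neg]
  constructor
  · have hj : (0 : ℝ) < (n + 1 : ℕ) := by positivity
    calc (2 / 3 : ℝ) < (8 * (n + 1 : ℕ) + 1) / (12 * (n + 1 : ℕ)) := by
          rw [div_lt_div_iff₀ (by norm_num) (by linarith)]
          linarith
      _ ≤ ∏ p ∈ Nat.primesBelow (2 * (n + 1) + 1), (1 - 1 / ((p : ℝ) ^ 2 * (p - 1))) :=
          le_prod_primesBelow (by lia)
      _ ≤ ∏ p ∈ n.primeFactors, (1 - 1 / ((p : ℝ) ^ 2 * (p - 1))) := by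
          refine Finset.prod_le_prod_of_subset_of_le_one
            (primeFactors_subset_primesBelow (by lia)) (fun p hp => ?_) fun p hp _ => ?_
          all_goals have h := hU (hD (Nat.prime_of_mem_primesBelow hp)).1
          exacts [h.1, h.2]
      _ ≤ _ := by
          refine Finset.prod_le_prod (fun p hp => ?_) fun p hp => ?_
          all_goals have h := hD (Nat.prime_of_mem_primeFactors hp)
          · exact (hU h.1).1
          · linarith [one_div_le_one_div_of_le (by linarith) h.2]
  · refine Finset.prod_le_one (fun p hp => ?_) fun p hp => ?_
    all_goals
      have h := hD (Nat.prime_of_mem_primeFactors hp)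
      have h' := hU (h.1.trans h.2)
    exacts [h'.1, h'.2]

theorem statement1 (k : ℕ) (hk : 2 ≤ k) :
    Multipliable (fun p : Nat.Primes => 1 - psi k (p : ℕ) / ((p : ℕ) : ℝ) ^ k) ∧
    0 < C k ∧ C k < 1 ∧
    ∀ n : ℕ, 0 < n → 2 / 3 < f k n ∧ f k n < 2 := by
  have hs := summable_psi_div_pow hk
  have hlog := Real.summable_log_one_add_of_summable hs
  simp only [← sub_eq_add_neg] at hlog
  have hp2 (p : Nat.Primes) : (2 : ℝ) ≤ (p : ℕ) := mod_cast p.2.two_le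
  have hlt (p : Nat.Primes) : 1 - psi k (p : ℕ) / ((p : ℕ) : ℝ) ^ k < 1 := by
    have := hp2 p
    have := div_pos (psi_pos hk (hp2 p)) (by positivity : 0 < ((p : ℕ) : ℝ) ^ k)
    linarith
  have hpos (p : Nat.Primes) : 0 < 1 - psi k (p : ℕ) / ((p : ℕ) : ℝ) ^ k := by
    have h2 := hp2 p
    obtain ⟨j, rfl⟩ := Nat.exists_eq_add_of_le' (one_le_two.trans hk)
    have h := le_pow_sub_psi (k := j) h2
    have h0 : 0 < ((p : ℕ) : ℝ) ^ j * ((p : ℕ) - 1) := mul_pos (by positivity) (by linarith)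
    rw [sub_pos, div_lt_one (by positivity)]
    linarith
  have hC := Real.rexp_tsum_eq_tprod hpos hlog
  refine ⟨Real.multipliable_of_summable_log hpos hlog, ?_, ?_, fun n _ => ?_⟩
  · rw [C, ← hC]
    exact Real.exp_pos _
  · rw [C, ← hC, Real.exp_lt_one_iff]
    have h := hlog.neg.tsum_pos (fun p => neg_nonneg.2 (Real.log_nonpos (hpos p).le (hlt p).le))
      ⟨2, Nat.prime_two⟩ (neg_pos.2 (Real.log_neg (hpos _) (hlt _)))
    rw [tsum_neg] at h
    linarith
  · rcases k.even_or_odd with h | h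
    · have := f_bounds_of_even h hk n
      exact ⟨by linarith, this.2⟩
    · have := f_bounds_of_odd h hk n
      exact ⟨this.1, by linarith⟩
end

section
/- Let k ≥ 2 be an integer and let n be an integer with n ≥ e^{k·2^{k+2}}. Then |B_k(n) − D_k · g_k(n) · n^{k−1}/(k−1)!| ≤ 707 · n^{k−1}/log n. -/
open Real

/-- `δ_k(x) = ((x−1)^k + k(x−1)^{k−1} + (−1)^k(k−1))/x`. -/
noncomputable def delta (k : ℕ) (x : ℝ) : ℝ :=
  ((x - 1) ^ k + (k : ℝ) * (x - 1) ^ (k - 1) + (-1 : ℝ) ^ k * ((k : ℝ) - 1)) / x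

/-- `D_k = ∏_p δ_k(p)/p^{k−1}` over all primes `p`. -/
noncomputable def D (k : ℕ) : ℝ := ∏' p : Nat.Primes, delta k ((p : ℕ) : ℝ) / ((p : ℕ) : ℝ) ^ (k - 1)

/-- `g_k(n) = ∏_{p ∣ n} (1 + (−1)^{k−1}(k−1)/δ_k(p))` over the distinct prime divisors of `n`. -/
noncomputable def g (k n : ℕ) : ℝ :=
  ∏ p ∈ n.primeFactors, (1 + (-1 : ℝ) ^ (k - 1) * ((k : ℝ) - 1) / delta k (p : ℝ))

/-- `B_k(n)` is the number of `k`-tuples of positive integers summing to `n` whose entries are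
pairwise coprime. -/
noncomputable def B (k n : ℕ) : ℕ :=
  Nat.card {v : Fin k → ℕ // (∀ i, 0 < v i) ∧ (∑ i, v i) = n ∧
    ∀ i j, i ≠ j → Nat.gcd (v i) (v j) = 1}

section

open Finset

lemma card_piAntidiag_univ {ι : Type*} [Fintype ι] [DecidableEq ι] (c m : ℕ)
    (hc : Fintype.card ι = c + 1) :
    #(piAntidiag (univ : Finset ι) m) = (m + c).choose c := by
  have h : #(piAntidiag (univ : Finset ι) m) = #((univ : Finset ι).finsuppAntidiag m) := by
    refine Finset.card_equiv Finsupp.equivFunOnFinite.symm fun f => ?_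
    simp [mem_finsuppAntidiag]
  rw [h, card_finsuppAntidiag_nat_eq_choose, card_univ, hc,
    show c + 1 + m - 1 = m + c by omega]
  exact Nat.choose_symm_of_eq_add (by omega)

/-- The tuples of positive integers indexed by `ι` with sum `n`. -/
def posTuples (ι : Type*) [Fintype ι] [DecidableEq ι] (n : ℕ) : Finset (ι → ℕ) :=
  {v ∈ piAntidiag univ n | ∀ i, 0 < v i}

lemma mem_posTuples {ι : Type*} [Fintype ι] [DecidableEq ι] {n : ℕ} {v : ι → ℕ} :
    v ∈ posTuples ι n ↔ ∑ i, v i = n ∧ ∀ i, 0 < v i := by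
  simp [posTuples]

lemma factorial_mul_card_posTuples_le {ι : Type*} [Fintype ι] [DecidableEq ι] (c s : ℕ)
    (hc : Fintype.card ι = c + 1) :
    c.factorial * #(posTuples ι s) ≤ s ^ c := by
  rcases (posTuples ι s).eq_empty_or_nonempty with h0 | ⟨w, hw⟩
  · simp [h0]
  have hs : c + 1 ≤ s := by
    rw [mem_posTuples] at hw
    rw [← hw.1, ← hc, ← card_univ, card_eq_sum_ones]
    exact sum_le_sum fun i _ => hw.2 i
  obtain ⟨m, rfl⟩ := Nat.exists_eq_add_of_le hs
  have h : #(posTuples ι (c + 1 + m)) ≤ #(piAntidiag (univ : Finset ι) m) := by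
    refine card_le_card_of_injOn (fun v i => v i - 1) ?_ ?_
    · intro v hv
      rw [mem_coe, mem_posTuples] at hv
      have h1 : ∑ i, (v i - 1) + ∑ i : ι, 1 = ∑ i, v i := by
        rw [← sum_add_distrib]
        exact sum_congr rfl fun i _ => Nat.sub_add_cancel (hv.2 i)
      simp only [sum_const, card_univ, hc, smul_eq_mul, mul_one] at h1
      simp only [mem_coe, mem_piAntidiag, mem_univ, implies_true, and_true]
      omega
    · intro v hv w hw hvw
      rw [mem_coe, mem_posTuples] at hv hw
      funext i
      have := congrFun hvw i
      have h1 := hv.2 i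
      have h2 := hw.2 i
      simp only at this
      omega
  calc c.factorial * #(posTuples ι (c + 1 + m))
      ≤ c.factorial * (m + c).choose c := by
        rw [← card_piAntidiag_univ c m hc]; gcongr
    _ = (m + 1).ascFactorial c := (Nat.ascFactorial_eq_factorial_mul_choose _ _).symm
    _ ≤ (m + c) ^ c := Nat.ascFactorial_le_pow_add _ _
    _ ≤ (c + 1 + m) ^ c := Nat.pow_le_pow_left (by omega) _

/-- Representative of a residue class modulo `P` in `{1, …, P}`. -/
def posRep {P : ℕ} (r : ZMod P) : ℕ := (r - 1).val + 1

lemma natCast_posRep {P : ℕ} [NeZero P] (r : ZMod P) : ((posRep r : ℕ) : ZMod P) = r := by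
  simp [posRep]

lemma posRep_le {P : ℕ} [NeZero P] (r : ZMod P) : posRep r ≤ P := ZMod.val_lt (r - 1)

lemma card_posTuples_residue {K P n : ℕ} [NeZero P] (s : Fin (K + 1) → ZMod P)
    (hs : ∑ i, s i = n) (hn : (K + 1) * P ≤ n) :
    (n - (K + 1) * P) ^ K ≤
        P ^ K * (K.factorial * #{v ∈ posTuples (Fin (K + 1)) n | ∀ i, (v i : ZMod P) = s i}) ∧
      P ^ K * (K.factorial * #{v ∈ posTuples (Fin (K + 1)) n | ∀ i, (v i : ZMod P) = s i}) ≤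
        (n + (K + 1) * P) ^ K := by
  have hle : ∑ i, posRep (s i) ≤ (K + 1) * P := by
    calc ∑ i, posRep (s i) ≤ ∑ _i : Fin (K + 1), P := sum_le_sum fun i _ => posRep_le _
      _ = (K + 1) * P := by simp
  have hdvd : P ∣ n - ∑ i, posRep (s i) := by
    rw [← ZMod.natCast_eq_zero_iff, Nat.cast_sub (hle.trans hn)]
    simp [natCast_posRep, hs]
  obtain ⟨m, hm⟩ := hdvd
  have hP : 0 < P := NeZero.pos P
  have hcard : #{v ∈ posTuples (Fin (K + 1)) n | ∀ i, (v i : ZMod P) = s i} =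
      #(piAntidiag (univ : Finset (Fin (K + 1))) m) := by
    symm
    refine card_bij (fun y _ i => posRep (s i) + P * y i) ?_ ?_ ?_
    · intro y hy
      simp only [mem_piAntidiag, mem_univ, implies_true, and_true] at hy
      simp only [mem_filter, mem_posTuples, sum_add_distrib, ← mul_sum, hy, Nat.cast_add,
        natCast_posRep, Nat.cast_mul, CharP.cast_eq_zero, zero_mul, add_zero, implies_true,
        and_true]
      refine ⟨by omega, fun i => ?_⟩
      simp [posRep]
    · intro y _ w _ h
      funext i
      have := congrFun h i
      simp only [add_right_inj] at this
      exact Nat.eq_of_mul_eq_mul_left hP this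
    · intro v hv
      simp only [mem_filter, mem_posTuples] at hv
      obtain ⟨⟨h1, h2⟩, h3⟩ := hv
      have key : ∀ i, ∃ y, v i = posRep (s i) + P * y := by
        intro i
        have hge : posRep (s i) ≤ v i := by
          have : s i - 1 = ((v i - 1 : ℕ) : ZMod P) := by
            rw [Nat.cast_sub (h2 i), h3 i]; simp
          have h4 := h2 i
          rw [posRep, this, ZMod.val_natCast]
          have := Nat.mod_le (v i - 1) P
          omega
        have : P ∣ v i - posRep (s i) := by
          rw [← ZMod.natCast_eq_zero_iff, Nat.cast_sub hge, natCast_posRep, h3, sub_self]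
        obtain ⟨y, hy⟩ := this
        exact ⟨y, by omega⟩
      choose y hy using key
      refine ⟨y, ?_, funext fun i => (hy i).symm⟩
      simp only [mem_piAntidiag, mem_univ, implies_true, and_true]
      have : ∑ i, posRep (s i) + P * ∑ i, y i = n := by
        rw [← h1, mul_sum, ← sum_add_distrib]
        exact sum_congr rfl fun i _ => (hy i).symm
      refine Nat.eq_of_mul_eq_mul_left hP ?_
      change P * ∑ i, y i = P * m
      omega
  rw [hcard, card_piAntidiag_univ K m (by simp), ← Nat.ascFactorial_eq_factorial_mul_choose]
  constructor
  · calc (n - (K + 1) * P) ^ K ≤ (P * (m + 1)) ^ K := by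
          apply Nat.pow_le_pow_left
          rw [mul_add, ← hm]
          omega
      _ = P ^ K * (m + 1) ^ K := mul_pow _ _ _
      _ ≤ _ := by gcongr; exact Nat.pow_succ_le_ascFactorial _ _
  · calc P ^ K * (m + 1).ascFactorial K ≤ P ^ K * (m + K) ^ K := by
          gcongr; exact Nat.ascFactorial_le_pow_add _ _
      _ = (P * (m + K)) ^ K := (mul_pow _ _ _).symm
      _ ≤ _ := by
          apply Nat.pow_le_pow_left
          rw [mul_add, ← hm]
          have : P * K ≤ (K + 1) * P := by nlinarith
          omega

lemma card_posTuples_sieve {K n : ℕ} {ι : Type*} [Fintype ι] [DecidableEq ι] (a : ι → ℕ)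
    [∀ p, NeZero (a p)] (hco : Pairwise (Function.onFun Nat.Coprime a))
    (V : ∀ p, Finset (Fin (K + 1) → ZMod (a p))) (hV : ∀ p, ∀ f ∈ V p, ∑ i, f i = n)
    (hn : (K + 1) * ∏ p, a p ≤ n) :
    (n - (K + 1) * ∏ p, a p) ^ K * ∏ p, #(V p) ≤
        (∏ p, a p) ^ K * (K.factorial * #{v ∈ posTuples (Fin (K + 1)) n |
          ∀ p, (fun i => (v i : ZMod (a p))) ∈ V p}) ∧
      (∏ p, a p) ^ K * (K.factorial * #{v ∈ posTuples (Fin (K + 1)) n |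
          ∀ p, (fun i => (v i : ZMod (a p))) ∈ V p}) ≤
        (n + (K + 1) * ∏ p, a p) ^ K * ∏ p, #(V p) := by
  classical
  set P := ∏ p, a p with hP
  have : NeZero P := ⟨Finset.prod_ne_zero_iff.2 fun p _ => NeZero.ne (a p)⟩
  let e : ZMod P ≃+* Π p, ZMod (a p) := ZMod.prodEquivPi a hco
  have hfib : #{v ∈ posTuples (Fin (K + 1)) n | ∀ p, (fun i => (v i : ZMod (a p))) ∈ V p} =
      ∑ r ∈ Fintype.piFinset V, #{v ∈ posTuples (Fin (K + 1)) n |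
        ∀ i, (v i : ZMod P) = e.symm fun p => r p i} := by
    rw [card_eq_sum_card_fiberwise (f := fun v p i => (v i : ZMod (a p)))
      (t := Fintype.piFinset V)]
    · refine sum_congr rfl fun r hr => ?_
      congr 1
      ext v
      have : ((fun p i => (v i : ZMod (a p))) = r) ↔
          ∀ i, (v i : ZMod P) = e.symm fun p => r p i := by
        constructor
        · rintro h i
          rw [RingEquiv.eq_symm_apply, map_natCast]
          funext p
          rw [← h]; simp
        · intro h
          funext p i
          have := congrFun ((RingEquiv.eq_symm_apply e).1 (h i)) p
          rw [map_natCast] at this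
          simpa using this
      simp only [mem_filter, this]
      constructor
      · rintro ⟨⟨h1, h2⟩, h3⟩
        exact ⟨h1, h3⟩
      · rintro ⟨h1, h3⟩
        refine ⟨⟨h1, fun p => ?_⟩, h3⟩
        have h4 := congrFun (this.2 h3) p
        rw [h4]
        exact Fintype.mem_piFinset.1 hr p
    · intro v hv
      rw [mem_coe, mem_filter] at hv
      exact Fintype.mem_piFinset.2 hv.2
  have hsum : ∀ r ∈ Fintype.piFinset V, ∑ i, (e.symm fun p => r p i) = n := by
    intro r hr
    rw [← map_sum, RingEquiv.symm_apply_eq, map_natCast]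
    funext p
    simpa using hV p (r p) (Fintype.mem_piFinset.1 hr p)
  rw [hfib, mul_sum, mul_sum, ← Fintype.card_piFinset, mul_comm _ #(_), mul_comm _ #(_),
    ← smul_eq_mul, ← smul_eq_mul #(_) ((n + _) ^ K), ← sum_const, ← sum_const]
  exact ⟨sum_le_sum fun r hr => (card_posTuples_residue _ (hsum r hr) hn).1,
    sum_le_sum fun r hr => (card_posTuples_residue _ (hsum r hr) hn).2⟩

/-- At most one coordinate of `f` vanishes. -/
def AtMostOneZero {ι M : Type*} [Zero M] (f : ι → M) : Prop :=
  ∀ i j, i ≠ j → ¬(f i = 0 ∧ f j = 0)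

instance {ι M : Type*} [Zero M] [Fintype ι] [DecidableEq ι] [DecidableEq M] (f : ι → M) :
    Decidable (AtMostOneZero f) :=
  inferInstanceAs (Decidable (∀ i j, i ≠ j → ¬(f i = 0 ∧ f j = 0)))

lemma atMostOneZero_cons {k : ℕ} {M : Type*} [Zero M] (a : M) (f : Fin k → M) :
    AtMostOneZero (Fin.cons a f : Fin (k + 1) → M) ↔
      (a = 0 ∧ ∀ i, f i ≠ 0) ∨ (a ≠ 0 ∧ AtMostOneZero f) := by
  constructor
  · intro h
    by_cases ha : a = 0
    · left
      refine ⟨ha, fun i hi => h 0 i.succ (Fin.succ_ne_zero i).symm ⟨by simpa, by simpa⟩⟩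
    · right
      refine ⟨ha, fun i j hij hf => h i.succ j.succ (by simpa) (by simpa)⟩
  · rintro (⟨ha, hf⟩ | ⟨ha, hf⟩) i j hij
    · rcases Fin.eq_zero_or_eq_succ i with rfl | ⟨i, rfl⟩
      · rcases Fin.eq_zero_or_eq_succ j with rfl | ⟨j, rfl⟩
        · exact absurd rfl hij
        · simp [hf]
      · simp [hf]
    · rcases Fin.eq_zero_or_eq_succ i with rfl | ⟨i, rfl⟩
      · simp [ha]
      · rcases Fin.eq_zero_or_eq_succ j with rfl | ⟨j, rfl⟩
        · simp [ha]
        · simpa using hf i j (by simpa using hij)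

lemma card_filter_sum_eq_succ {F : Type*} [AddCommGroup F] [Fintype F] [DecidableEq F] {k : ℕ}
    (c : F) (Q : (Fin (k + 1) → F) → Prop) [DecidablePred Q] :
    #{f : Fin (k + 1) → F | ∑ i, f i = c ∧ Q f} =
      #{f : Fin k → F | Q (Fin.cons (c - ∑ i, f i) f)} := by
  refine card_nbij' Fin.tail (fun f => Fin.cons (c - ∑ i, f i) f) ?_ ?_ ?_ ?_
  · intro f hf
    simp only [mem_coe, mem_filter, mem_univ, true_and] at hf ⊢
    have h : c - ∑ i, Fin.tail f i = f 0 := by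
      rw [← hf.1, Fin.sum_univ_succ]; simp [Fin.tail]
    rw [h, Fin.cons_self_tail]
    exact hf.2
  · intro f hf
    simp only [mem_coe, mem_filter, mem_univ, true_and] at hf ⊢
    refine ⟨?_, hf⟩
    rw [Fin.sum_univ_succ]; simp
  · intro f hf
    simp only [mem_coe, mem_filter, mem_univ, true_and] at hf
    have h : c - ∑ i, Fin.tail f i = f 0 := by
      rw [← hf.1, Fin.sum_univ_succ]; simp [Fin.tail]
    simp only [h, Fin.cons_self_tail]
  · intro f _
    simp

/-- Tuples modulo `p` with sum `c` and at most one vanishing coordinate. -/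
def localTuples (k p : ℕ) [NeZero p] (c : ZMod p) : Finset (Fin k → ZMod p) :=
  {f | ∑ i, f i = c ∧ AtMostOneZero f}

section LocalCount

variable {p : ℕ} [NeZero p]

lemma card_nonzeroTuples (k : ℕ) :
    (#{f : Fin k → ZMod p | ∀ i, f i ≠ 0} : ℝ) = ((p : ℝ) - 1) ^ k := by
  have h : ({f : Fin k → ZMod p | ∀ i, f i ≠ 0} : Finset _) =
      Fintype.piFinset fun _ => univ.erase 0 := by
    ext f; simp
  rw [h, Fintype.card_piFinset_const, card_erase_of_mem (mem_univ _), card_univ, ZMod.card,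
    Nat.cast_pow, Nat.cast_sub (NeZero.pos p), Nat.cast_one]

lemma card_nonzeroTuples_sum (k : ℕ) (c : ZMod p) :
    (p : ℝ) * #{f : Fin k → ZMod p | ∑ i, f i = c ∧ ∀ i, f i ≠ 0} =
      ((p : ℝ) - 1) ^ k + (-1) ^ k * ((if c = 0 then (p : ℝ) else 0) - 1) := by
  induction k generalizing c with
  | zero =>
    by_cases hc : c = 0
    · simp [hc]
    · simp [hc, Ne.symm hc]
  | succ k ih =>
    have h1 : #{f : Fin (k + 1) → ZMod p | ∑ i, f i = c ∧ ∀ i, f i ≠ 0} +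
        #{f : Fin k → ZMod p | ∑ i, f i = c ∧ ∀ i, f i ≠ 0} =
        #{f : Fin k → ZMod p | ∀ i, f i ≠ 0} := by
      rw [card_filter_sum_eq_succ,
        ← card_filter_add_card_filter_not (s := {f : Fin k → ZMod p | ∀ i, f i ≠ 0})
          (fun f => ∑ i, f i = c), add_comm]
      simp only [filter_filter]
      congr 2
      · ext f; simp [and_comm]
      · ext f
        simp only [mem_filter, mem_univ, true_and, Fin.forall_fin_succ, Fin.cons_zero,
          Fin.cons_succ, sub_ne_zero, ne_comm (a := c)]
        exact and_comm
    have h2 : (#{f : Fin (k + 1) → ZMod p | ∑ i, f i = c ∧ ∀ i, f i ≠ 0} : ℝ) +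
        #{f : Fin k → ZMod p | ∑ i, f i = c ∧ ∀ i, f i ≠ 0} = ((p : ℝ) - 1) ^ k := by
      rw [← card_nonzeroTuples]; exact_mod_cast h1
    rw [eq_sub_of_add_eq h2, mul_sub, ih]
    ring

lemma card_localTuples_succ (k : ℕ) (c : ZMod p) :
    #(localTuples (k + 1) p c) + #(localTuples k p c) =
      #{f : Fin k → ZMod p | ∑ i, f i = c ∧ ∀ i, f i ≠ 0} +
        #{f : Fin k → ZMod p | AtMostOneZero f} := by
  have h1 : #(localTuples (k + 1) p c) =
      #{f : Fin k → ZMod p | ∑ i, f i = c ∧ ∀ i, f i ≠ 0} +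
        #{f : Fin k → ZMod p | AtMostOneZero f ∧ ¬ ∑ i, f i = c} := by
    rw [localTuples, card_filter_sum_eq_succ, ← card_union_of_disjoint]
    · congr 1
      ext f
      simp only [mem_filter, mem_univ, true_and, mem_union, atMostOneZero_cons, sub_eq_zero,
        ne_eq, eq_comm (a := c)]
      tauto
    · rw [disjoint_filter]
      tauto
  have h2 := card_filter_add_card_filter_not (s := {f : Fin k → ZMod p | AtMostOneZero f})
    (fun f => ∑ i, f i = c)
  simp only [filter_filter] at h2
  have h3 : #(localTuples k p c) = #{f : Fin k → ZMod p | AtMostOneZero f ∧ ∑ i, f i = c} := by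
    rw [localTuples]; congr 1; ext f; simp [and_comm]
  omega

lemma card_atMostOneZero (k : ℕ) :
    (#{f : Fin k → ZMod p | AtMostOneZero f} : ℝ) =
      ((p : ℝ) - 1) ^ k + k * ((p : ℝ) - 1) ^ (k - 1) := by
  have hfib : ∀ k, #{f : Fin k → ZMod p | AtMostOneZero f} = ∑ c, #(localTuples k p c) := by
    intro k
    rw [card_eq_sum_card_fiberwise (f := fun f => ∑ i, f i) (t := univ) (by simp [Set.MapsTo])]
    refine sum_congr rfl fun c _ => ?_
    rw [localTuples, filter_filter]; congr 1; ext f; simp [and_comm]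
  have hnz : ∀ k, #{f : Fin k → ZMod p | ∀ i, f i ≠ 0} =
      ∑ c, #{f : Fin k → ZMod p | ∑ i, f i = c ∧ ∀ i, f i ≠ 0} := by
    intro k
    rw [card_eq_sum_card_fiberwise (f := fun f => ∑ i, f i) (t := univ) (by simp [Set.MapsTo])]
    refine sum_congr rfl fun c _ => ?_
    rw [filter_filter]; congr 1; ext f; simp [and_comm]
  induction k with
  | zero => simp [AtMostOneZero]
  | succ k ih =>
    have h := sum_congr rfl fun c (_ : c ∈ (univ : Finset (ZMod p))) => card_localTuples_succ k c
    rw [sum_add_distrib, sum_add_distrib, ← hfib, ← hfib, ← hnz, sum_const, card_univ,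
      ZMod.card, smul_eq_mul] at h
    have h' : (#{f : Fin (k + 1) → ZMod p | AtMostOneZero f} : ℝ) +
        #{f : Fin k → ZMod p | AtMostOneZero f} =
        #{f : Fin k → ZMod p | ∀ i, f i ≠ 0} + p * #{f : Fin k → ZMod p | AtMostOneZero f} := by
      exact_mod_cast h
    rw [eq_sub_of_add_eq h', card_nonzeroTuples, ih]
    rcases k with _ | k
    · simp
    · push_cast
      ring

lemma card_localTuples (k : ℕ) (c : ZMod p) :
    (p : ℝ) * #(localTuples k p c) =
      ((p : ℝ) - 1) ^ k + k * ((p : ℝ) - 1) ^ (k - 1) + (-1) ^ k * (k - 1) -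
        (-1) ^ k * (k - 1) * (if c = 0 then (p : ℝ) else 0) := by
  induction k with
  | zero =>
    by_cases hc : c = 0
    · simp [hc, localTuples, AtMostOneZero]
    · simp [hc, localTuples, Ne.symm hc]
  | succ k ih =>
    have h : (#(localTuples (k + 1) p c) : ℝ) + #(localTuples k p c) =
      #{f : Fin k → ZMod p | ∑ i, f i = c ∧ ∀ i, f i ≠ 0} +
        #{f : Fin k → ZMod p | AtMostOneZero f} := by
      exact_mod_cast card_localTuples_succ k c
    rw [eq_sub_of_add_eq h, mul_sub, mul_add, card_nonzeroTuples_sum, ih, card_atMostOneZero]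
    push_cast
    rcases k with _ | k
    · by_cases hc : c = 0 <;> simp [hc]
    · simp only [add_tsub_cancel_right]
      push_cast
      ring

lemma card_localTuples_le (k : ℕ) (c : ZMod p) : #(localTuples (k + 1) p c) ≤ p ^ k := by
  rw [localTuples, card_filter_sum_eq_succ]
  exact (card_filter_le _ _).trans (by simp [ZMod.card])

lemma card_two_zeros_le (K : ℕ) (c : ZMod p) (i j : Fin (K + 3)) (hij : i ≠ j) :
    #{f : Fin (K + 3) → ZMod p | ∑ l, f l = c ∧ (f i = 0 ∧ f j = 0)} ≤ p ^ K := by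
  obtain ⟨l, hl⟩ : ∃ l, l ∉ ({i, j} : Finset (Fin (K + 3))) := by
    by_contra! h
    have h1 : #(univ : Finset (Fin (K + 3))) ≤ #({i, j} : Finset (Fin (K + 3))) :=
      card_le_card fun x _ => h x
    rw [card_univ, Fintype.card_fin] at h1
    have := card_le_two (a := i) (b := j)
    omega
  simp only [mem_insert, mem_singleton, not_or] at hl
  set T : Finset (Fin (K + 3)) := {i, j, l}
  have hT : #T = 3 := card_eq_three.2 ⟨i, j, l, hij, Ne.symm hl.1, Ne.symm hl.2, rfl⟩
  have hcard : #(univ : Finset ({x // x ∈ Tᶜ} → ZMod p)) = p ^ K := by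
    rw [card_univ, Fintype.card_fun, Fintype.card_coe, card_compl, hT, ZMod.card,
      Fintype.card_fin]
    rfl
  rw [← hcard]
  refine card_le_card_of_injOn (fun f x => f x) (by simp [Set.MapsTo]) ?_
  intro f hf g hg hfg
  simp only [mem_coe, mem_filter, mem_univ, true_and] at hf hg
  have hout : ∀ x ∈ Tᶜ, f x = g x := fun x hx => congrFun hfg ⟨x, hx⟩
  have hsum := hf.1.trans hg.1.symm
  rw [← sum_add_sum_compl T, ← sum_add_sum_compl T g, sum_congr rfl hout, add_left_inj] at hsum
  have hne : i ∉ ({j, l} : Finset (Fin (K + 3))) := by simp [hij, Ne.symm hl.1]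
  have hne' : j ∉ ({l} : Finset (Fin (K + 3))) := by simp [Ne.symm hl.2]
  simp only [T, sum_insert hne, sum_insert hne', sum_singleton, hf.2, hg.2, zero_add] at hsum
  funext x
  by_cases hx : x ∈ T
  · simp only [T, mem_insert, mem_singleton] at hx
    rcases hx with rfl | rfl | rfl
    · rw [hf.2.1, hg.2.1]
    · rw [hf.2.2, hg.2.2]
    · exact hsum
  · exact hout x (mem_compl.2 hx)

lemma le_card_localTuples (K : ℕ) (c : ZMod p) :
    p ^ (K + 2) ≤ #(localTuples (K + 3) p c) + (K + 3) * (K + 2) * p ^ K := by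
  have htot : #{f : Fin (K + 3) → ZMod p | ∑ i, f i = c ∧ True} = p ^ (K + 2) := by
    rw [card_filter_sum_eq_succ]
    simp [ZMod.card]
  rw [← htot]
  calc #{f : Fin (K + 3) → ZMod p | ∑ i, f i = c ∧ True}
      ≤ #(localTuples (K + 3) p c ∪ (univ : Finset (Fin (K + 3))).offDiag.biUnion fun x =>
          {f : Fin (K + 3) → ZMod p | ∑ l, f l = c ∧ (f x.1 = 0 ∧ f x.2 = 0)}) := by
        refine card_le_card fun f hf => ?_
        simp only [mem_filter, mem_univ, true_and, and_true] at hf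
        by_cases h : AtMostOneZero f
        · exact mem_union_left _ (by simp [localTuples, hf, h])
        · refine mem_union_right _ ?_
          simp only [AtMostOneZero, not_forall, not_not] at h
          obtain ⟨i, j, hij, h⟩ := h
          rw [mem_biUnion]
          exact ⟨(i, j), by simp [hij], by simp [hf, h]⟩
    _ ≤ #(localTuples (K + 3) p c) + _ := card_union_le _ _
    _ ≤ #(localTuples (K + 3) p c) + (K + 3) * (K + 2) * p ^ K := by
        gcongr
        calc _ ≤ _ := card_biUnion_le
          _ ≤ ∑ _x ∈ (univ : Finset (Fin (K + 3))).offDiag, p ^ K :=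
              sum_le_sum fun x hx => card_two_zeros_le K c x.1 x.2 (mem_offDiag.1 hx).2.2
          _ = _ := by
              rw [sum_const, offDiag_card, card_univ, Fintype.card_fin, smul_eq_mul]
              congr 1
              rw [Nat.sub_eq_iff_eq_add (by nlinarith)]
              ring

end LocalCount

/-- The proportion of `k`-tuples modulo `m` of sum `n` with at most one vanishing coordinate when
`m` is prime, and `1` otherwise. -/
noncomputable def localDensity (k n m : ℕ) : ℝ :=
  if m.Prime then
    (delta k m + if m ∣ n then (-1 : ℝ) ^ (k - 1) * ((k : ℝ) - 1) else 0) / (m : ℝ) ^ (k - 1)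
  else 1

lemma localDensity_of_prime {k p : ℕ} (n : ℕ) (hk : k ≠ 0) (hp : p.Prime) [NeZero p] :
    localDensity k n p = #(localTuples k p (n : ZMod p)) / (p : ℝ) ^ (k - 1) := by
  have h := card_localTuples k (n : ZMod p)
  have hp0 : (p : ℝ) ≠ 0 := Nat.cast_ne_zero.2 hp.ne_zero
  rw [localDensity, if_pos hp]
  congr 1
  obtain ⟨k, rfl⟩ := Nat.exists_eq_succ_of_ne_zero hk
  rw [← mul_right_inj' hp0, h, delta, mul_add, mul_div_cancel₀ _ hp0]
  simp only [ZMod.natCast_eq_zero_iff]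
  split_ifs <;> simp [pow_succ]
  ring

lemma localDensity_nonneg (k n m : ℕ) (hk : k ≠ 0) : 0 ≤ localDensity k n m := by
  by_cases hm : m.Prime
  · have : NeZero m := ⟨hm.ne_zero⟩
    rw [localDensity_of_prime n hk hm]
    positivity
  · simp [localDensity, hm]

lemma localDensity_le_one (k n m : ℕ) (hk : k ≠ 0) : localDensity k n m ≤ 1 := by
  by_cases hm : m.Prime
  · have : NeZero m := ⟨hm.ne_zero⟩
    obtain ⟨k, rfl⟩ := Nat.exists_eq_succ_of_ne_zero hk
    rw [localDensity_of_prime n hk hm]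
    apply div_le_one_of_le₀ _ (by positivity)
    exact_mod_cast card_localTuples_le k (n : ZMod m)
  · simp [localDensity, hm]

lemma one_sub_localDensity_le (K n m : ℕ) :
    1 - localDensity (K + 3) n m ≤ (K + 3) * (K + 2) * ((m : ℝ) ^ 2)⁻¹ := by
  by_cases hm : m.Prime
  · have : NeZero m := ⟨hm.ne_zero⟩
    have hm0 : (m : ℝ) ≠ 0 := Nat.cast_ne_zero.2 hm.ne_zero
    rw [localDensity_of_prime n (by omega) hm, show K + 3 - 1 = K + 2 by omega]
    have h : (m : ℝ) ^ (K + 2) ≤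
        #(localTuples (K + 3) m (n : ZMod m)) + (K + 3) * (K + 2) * (m : ℝ) ^ K := by
      exact_mod_cast le_card_localTuples K (n : ZMod m)
    have hpos : (0 : ℝ) < (m : ℝ) ^ (K + 2) := by positivity
    have e : (K + 3) * (K + 2) * ((m : ℝ) ^ 2)⁻¹ =
        ((K + 3) * (K + 2) * (m : ℝ) ^ K) / (m : ℝ) ^ (K + 2) := by
      field_simp
      ring
    rw [e, sub_le_iff_le_add, ← add_div, le_div_iff₀ hpos]
    linarith
  · simp only [localDensity, hm, if_false, sub_self]
    positivity

open Classical in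
/-- Positive tuples of sum `n` no two entries of which share a prime factor at most `z`. -/
noncomputable def siftedTuples (k n z : ℕ) : Finset (Fin k → ℕ) :=
  {v ∈ posTuples (Fin k) n | ∀ p ∈ ({p ∈ range (z + 1) | p.Prime} : Finset ℕ),
    ∀ i j, i ≠ j → ¬(p ∣ v i ∧ p ∣ v j)}

lemma mem_siftedTuples {k n z : ℕ} {v : Fin k → ℕ} :
    v ∈ siftedTuples k n z ↔ v ∈ posTuples (Fin k) n ∧
      ∀ p ∈ ({p ∈ range (z + 1) | p.Prime} : Finset ℕ),
        ∀ i j, i ≠ j → ¬(p ∣ v i ∧ p ∣ v j) := by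
  simp only [siftedTuples, mem_filter]

lemma card_siftedTuples_bounds (K n z : ℕ) (hn : (K + 1) * primorial z ≤ n) :
    ((n : ℝ) - (K + 1) * primorial z) ^ K * ∏ m ∈ range (z + 1), localDensity (K + 1) n m ≤
        K.factorial * #(siftedTuples (K + 1) n z) ∧
      K.factorial * #(siftedTuples (K + 1) n z) ≤
        ((n : ℝ) + (K + 1) * primorial z) ^ K *
          ∏ m ∈ range (z + 1), localDensity (K + 1) n m := by
  set S : Finset ℕ := {p ∈ range (z + 1) | p.Prime} with hS
  have hprime : ∀ p : S, (p : ℕ).Prime := fun p => (mem_filter.1 p.2).2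
  have : ∀ p : S, NeZero (p : ℕ) := fun p => ⟨(hprime p).ne_zero⟩
  have hP : ∏ p : S, (p : ℕ) = primorial z := prod_coe_sort S fun p => p
  have hP0 : (0 : ℝ) < (primorial z : ℝ) ^ K := by
    have := primorial_pos z
    positivity
  have hsift : #{v ∈ posTuples (Fin (K + 1)) n |
      ∀ p : S, (fun i => (v i : ZMod p)) ∈ localTuples (K + 1) p (n : ZMod p)} =
      #(siftedTuples (K + 1) n z) := by
    congr 1
    ext v
    rw [mem_filter, mem_siftedTuples, Subtype.forall, ← hS]
    refine and_congr_right fun hv => forall₂_congr fun p _ => ?_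
    rw [localTuples, mem_filter]
    simp only [mem_univ, true_and, AtMostOneZero, ZMod.natCast_eq_zero_iff]
    refine and_iff_right ?_
    rw [← Nat.cast_sum, (mem_posTuples.1 hv).1]
  have hdens : ∏ m ∈ range (z + 1), localDensity (K + 1) n m =
      (∏ p : S, #(localTuples (K + 1) p (n : ZMod p)) : ℕ) / (primorial z : ℝ) ^ K := by
    have h1 : ∏ m ∈ range (z + 1), localDensity (K + 1) n m =
        ∏ m ∈ S, localDensity (K + 1) n m := by
      symm
      refine prod_subset (filter_subset _ _) fun m hm hmS => ?_
      have : ¬ m.Prime := fun h => hmS (mem_filter.2 ⟨hm, h⟩)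
      simp [localDensity, this]
    rw [h1, ← prod_coe_sort S, prod_congr rfl fun (p : S) _ =>
      localDensity_of_prime n (Nat.succ_ne_zero K) (hprime p), prod_div_distrib, ← hP]
    simp [prod_pow]
  obtain ⟨h1, h2⟩ := card_posTuples_sieve (K := K) (n := n) (fun p : S => (p : ℕ))
    (fun p q hpq => (Nat.coprime_primes (hprime p) (hprime q)).2 fun h => hpq (Subtype.ext h))
    (fun p => localTuples (K + 1) p (n : ZMod p)) (fun p f hf => (mem_filter.1 hf).2.1)
    (by rw [hP]; exact hn)
  rw [hP, hsift] at h1 h2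
  rw [hdens, ← mul_div_assoc, ← mul_div_assoc, div_le_iff₀ hP0, le_div_iff₀ hP0]
  have h1' := (Nat.cast_le (α := ℝ)).2 h1
  have h2' := (Nat.cast_le (α := ℝ)).2 h2
  push_cast [Nat.cast_sub hn] at h1' h2' ⊢
  constructor <;> linarith

lemma card_posTuples_dvd_pair_le (K n m : ℕ) (i j : Fin (K + 3)) (hij : i ≠ j) :
    K.factorial * #{v ∈ posTuples (Fin (K + 3)) n | m ∣ v i ∧ m ∣ v j} ≤
      (n / m) ^ 2 * n ^ K := by
  set T : Finset (Fin (K + 3)) := {i, j}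
  have hT : #T = 2 := card_pair hij
  have hfib : ∀ b ∈ ({x ∈ Ioc 0 n | m ∣ x} ×ˢ {x ∈ Ioc 0 n | m ∣ x} : Finset (ℕ × ℕ)),
      #{v ∈ {v ∈ posTuples (Fin (K + 3)) n | m ∣ v i ∧ m ∣ v j} | (v i, v j) = b} ≤
        n ^ K / K.factorial := by
    rintro ⟨a, b⟩ -
    rw [Nat.le_div_iff_mul_le (Nat.factorial_pos _), mul_comm]
    have hcard : Fintype.card {x // x ∈ Tᶜ} = K + 1 := by
      rw [Fintype.card_coe, card_compl, hT, Fintype.card_fin]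
      rfl
    refine le_trans ?_ ((factorial_mul_card_posTuples_le K (n - (a + b)) hcard).trans
      (Nat.pow_le_pow_left (Nat.sub_le _ _) _))
    gcongr
    refine card_le_card_of_injOn (fun f x => f x) ?_ ?_
    · intro v hv
      simp only [mem_coe, mem_filter, mem_posTuples, Prod.mk.injEq] at hv ⊢
      obtain ⟨⟨⟨h1, h2⟩, -⟩, rfl, rfl⟩ := hv
      refine ⟨?_, fun x => h2 _⟩
      rw [← sum_add_sum_compl T, sum_pair hij] at h1
      rw [sum_coe_sort Tᶜ v]
      omega
    · intro v hv w hw hvw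
      simp only [mem_coe, mem_filter, Prod.mk.injEq] at hv hw
      funext x
      by_cases hx : x ∈ T
      · simp only [T, mem_insert, mem_singleton] at hx
        rcases hx with rfl | rfl
        · rw [hv.2.1, hw.2.1]
        · rw [hv.2.2, hw.2.2]
      · exact congrFun hvw ⟨x, mem_compl.2 hx⟩
  have h := card_le_mul_card_image_of_maps_to (f := fun v : Fin (K + 3) → ℕ => (v i, v j))
    (s := {v ∈ posTuples (Fin (K + 3)) n | m ∣ v i ∧ m ∣ v j})
    (t := {x ∈ Ioc 0 n | m ∣ x} ×ˢ {x ∈ Ioc 0 n | m ∣ x}) ?_ _ hfib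
  · rw [card_product, Nat.Ioc_filter_dvd_card_eq_div, ← sq] at h
    calc K.factorial * _ ≤ K.factorial * (n ^ K / K.factorial * (n / m) ^ 2) := by gcongr
      _ = (n / m) ^ 2 * (K.factorial * (n ^ K / K.factorial)) := by ring
      _ ≤ (n / m) ^ 2 * n ^ K := by gcongr; exact Nat.mul_div_le _ _
  · intro v hv
    simp only [mem_filter, mem_posTuples] at hv
    obtain ⟨⟨h1, h2⟩, h3, h4⟩ := hv
    have hle : ∀ l, v l ≤ n := fun l => h1 ▸ single_le_sum (fun _ _ => Nat.zero_le _) (mem_univ l)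
    simp [h2, h3, h4, hle]

lemma B_eq_card (k n : ℕ) :
    B k n = #{v ∈ posTuples (Fin k) n | ∀ i j, i ≠ j → Nat.gcd (v i) (v j) = 1} := by
  refine Nat.subtype_card _ fun v => ?_
  simp only [mem_filter, mem_posTuples]
  exact ⟨fun h => ⟨h.1.2, h.1.1, h.2⟩, fun h => ⟨⟨h.2.1, h.1⟩, h.2.2⟩⟩

lemma B_le_card_siftedTuples (k n z : ℕ) : B k n ≤ #(siftedTuples k n z) := by
  rw [B_eq_card]
  refine card_le_card fun v hv => ?_
  rw [mem_siftedTuples]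
  rw [mem_filter] at hv
  refine ⟨hv.1, fun p hp i j hij h => (mem_filter.1 hp).2.ne_one ?_⟩
  exact Nat.dvd_one.1 (hv.2 i j hij ▸ Nat.dvd_gcd h.1 h.2)

lemma card_siftedTuples_le (k n z : ℕ) :
    #(siftedTuples k n z) ≤ B k n + ∑ m ∈ Ioc z n, ∑ x ∈ (univ : Finset (Fin k)).offDiag,
      #{v ∈ posTuples (Fin k) n | m ∣ v x.1 ∧ m ∣ v x.2} := by
  rw [B_eq_card]
  calc #(siftedTuples k n z)
      ≤ #({v ∈ posTuples (Fin k) n | ∀ i j, i ≠ j → Nat.gcd (v i) (v j) = 1} ∪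
          (Ioc z n).biUnion fun m => (univ : Finset (Fin k)).offDiag.biUnion fun x =>
            {v ∈ posTuples (Fin k) n | m ∣ v x.1 ∧ m ∣ v x.2}) := by
        refine card_le_card fun v hv => ?_
        obtain ⟨hv, hz⟩ := mem_siftedTuples.1 hv
        by_cases h : ∀ i j, i ≠ j → Nat.gcd (v i) (v j) = 1
        · exact mem_union_left _ (mem_filter.2 ⟨hv, h⟩)
        · push Not at h
          obtain ⟨i, j, hij, h⟩ := h
          obtain ⟨p, hp, hpd⟩ := Nat.exists_prime_and_dvd h
          have hpi := hpd.trans (Nat.gcd_dvd_left _ _)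
          have hpj := hpd.trans (Nat.gcd_dvd_right _ _)
          have hv' := mem_posTuples.1 hv
          have hpn : p ≤ n := (Nat.le_of_dvd (hv'.2 i) hpi).trans
            (hv'.1 ▸ single_le_sum (fun _ _ => Nat.zero_le _) (mem_univ i))
          have hpz : z < p := by
            by_contra! hle
            exact hz p (mem_filter.2 ⟨mem_range.2 (by omega), hp⟩) i j hij ⟨hpi, hpj⟩
          refine mem_union_right _ (mem_biUnion.2 ⟨p, mem_Ioc.2 ⟨hpz, hpn⟩, mem_biUnion.2
            ⟨(i, j), by simp [hij], mem_filter.2 ⟨hv, hpi, hpj⟩⟩⟩)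
    _ ≤ _ := by
        refine (card_union_le _ _).trans ?_
        gcongr
        exact card_biUnion_le.trans (sum_le_sum fun m _ => card_biUnion_le)

lemma card_siftedTuples_sub_B_le (K n z : ℕ) (hz : z ≠ 0) (hzn : z ≤ n) :
    K.factorial * ((#(siftedTuples (K + 3) n z) : ℝ) - B (K + 3) n) ≤
      (K + 3) * (K + 2) * (n : ℝ) ^ (K + 2) / z := by
  have h1 : (#(siftedTuples (K + 3) n z) : ℝ) - B (K + 3) n ≤
      ∑ m ∈ Ioc z n, ∑ x ∈ (univ : Finset (Fin (K + 3))).offDiag,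
        (#{v ∈ posTuples (Fin (K + 3)) n | m ∣ v x.1 ∧ m ∣ v x.2} : ℝ) := by
    rw [sub_le_iff_le_add']
    exact_mod_cast card_siftedTuples_le (K + 3) n z
  have hoff : (#((univ : Finset (Fin (K + 3))).offDiag) : ℝ) = (K + 3) * (K + 2) := by
    rw [offDiag_card, card_univ, Fintype.card_fin, Nat.cast_sub (by nlinarith)]
    push_cast; ring
  calc K.factorial * ((#(siftedTuples (K + 3) n z) : ℝ) - B (K + 3) n)
      ≤ K.factorial * ∑ m ∈ Ioc z n, ∑ x ∈ (univ : Finset (Fin (K + 3))).offDiag,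
        (#{v ∈ posTuples (Fin (K + 3)) n | m ∣ v x.1 ∧ m ∣ v x.2} : ℝ) := by gcongr
    _ ≤ ∑ m ∈ Ioc z n, ∑ x ∈ (univ : Finset (Fin (K + 3))).offDiag,
        (n : ℝ) ^ (K + 2) * ((m : ℝ) ^ 2)⁻¹ := by
        rw [mul_sum]
        refine sum_le_sum fun m _ => ?_
        rw [mul_sum]
        refine sum_le_sum fun x hx => ?_
        have h := (Nat.cast_le (α := ℝ)).2
          (card_posTuples_dvd_pair_le K n m x.1 x.2 (mem_offDiag.1 hx).2.2)
        push_cast at h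
        refine h.trans ?_
        calc ((n / m : ℕ) : ℝ) ^ 2 * (n : ℝ) ^ K ≤ ((n : ℝ) / m) ^ 2 * (n : ℝ) ^ K := by
              gcongr; exact Nat.cast_div_le
          _ = _ := by rw [div_pow, div_eq_mul_inv]; ring
    _ = (K + 3) * (K + 2) * (n : ℝ) ^ (K + 2) * ∑ m ∈ Ioc z n, ((m : ℝ) ^ 2)⁻¹ := by
        simp only [sum_const, nsmul_eq_mul, hoff, mul_sum, mul_assoc]
    _ ≤ (K + 3) * (K + 2) * (n : ℝ) ^ (K + 2) * (z : ℝ)⁻¹ := by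
        gcongr
        refine (sum_Ioc_inv_sq_le_sub hz hzn).trans ?_
        simp
    _ = _ := (div_eq_mul_inv _ _).symm

lemma delta_pos {k p : ℕ} (hk : k ≠ 0) (hp : p.Prime) : 0 < delta k p := by
  have hp2 : (2 : ℝ) ≤ p := by exact_mod_cast hp.two_le
  have hk1 : (1 : ℝ) ≤ k := by exact_mod_cast Nat.one_le_iff_ne_zero.2 hk
  have h1 : (1 : ℝ) ≤ ((p : ℝ) - 1) ^ (k - 1) := one_le_pow₀ (by linarith)
  have h2 : (1 : ℝ) ≤ ((p : ℝ) - 1) ^ k := one_le_pow₀ (by linarith)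
  have h3 : -((k : ℝ) - 1) ≤ (-1) ^ k * ((k : ℝ) - 1) := by
    rcases neg_one_pow_eq_or ℝ k with h | h <;> rw [h] <;> linarith
  rw [delta]
  apply div_pos _ (by linarith)
  nlinarith

lemma hasProd_localDensity_one (K : ℕ) : HasProd (localDensity (K + 3) 1) (D (K + 3)) := by
  have hm : Multipliable (localDensity (K + 3) 1) := by
    have h : Summable fun m : ℕ => ‖localDensity (K + 3) 1 m - 1‖ := by
      refine Summable.of_nonneg_of_le (fun _ => norm_nonneg _) (fun m => ?_)
        ((Real.summable_nat_pow_inv.2 one_lt_two).mul_left (((K : ℝ) + 3) * (K + 2)))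
      rw [Real.norm_eq_abs, abs_sub_comm,
        abs_of_nonneg (sub_nonneg.2 (localDensity_le_one _ _ _ (by omega)))]
      exact one_sub_localDensity_le K 1 m
    simpa using multipliable_one_add_of_summable h
  have hD : D (K + 3) = ∏' m, localDensity (K + 3) 1 m := by
    have h1 : ∀ p : Nat.Primes, delta (K + 3) ((p : ℕ) : ℝ) / ((p : ℕ) : ℝ) ^ (K + 3 - 1) =
        localDensity (K + 3) 1 p := by
      intro p
      rw [localDensity, if_pos p.2, if_neg (fun h => p.2.ne_one (Nat.dvd_one.1 h)), add_zero]
    rw [D, tprod_congr h1]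
    refine (_root_.tprod_subtype {p : ℕ | p.Prime} (localDensity (K + 3) 1)).trans
      (tprod_congr fun m => ?_)
    by_cases hm : m.Prime
    · exact Set.mulIndicator_of_mem (by exact hm) _
    · rw [Set.mulIndicator_of_notMem (by exact hm), localDensity, if_neg hm]
  rw [hD]
  exact hm.hasProd

lemma hasProd_localDensity (K n : ℕ) (hn : n ≠ 0) :
    HasProd (localDensity (K + 3) n) (D (K + 3) * g (K + 3) n) := by
  set h : ℕ → ℝ := fun m => if m ∈ n.primeFactors then
    1 + (-1 : ℝ) ^ (K + 3 - 1) * (((K + 3 : ℕ) : ℝ) - 1) / delta (K + 3) (m : ℝ) else 1 with hh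
  have hg : HasProd h (g (K + 3) n) := by
    have h1 : g (K + 3) n = ∏ m ∈ n.primeFactors, h m :=
      prod_congr rfl fun m hm => (if_pos hm).symm
    rw [h1]
    exact hasProd_prod_of_ne_finset_one fun m hm => if_neg hm
  convert (hasProd_localDensity_one K).mul hg using 2 with m
  by_cases hm : m.Prime
  · have h1 : ¬ m ∣ 1 := fun h => hm.ne_one (Nat.dvd_one.1 h)
    have hd := (delta_pos (k := K + 3) (by omega) hm).ne'
    by_cases hmn : m ∣ n
    · simp only [localDensity, hh, Nat.mem_primeFactors, hm, hmn, h1, hn, ne_eq,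
        not_false_eq_true, and_self, if_true, if_false]
      rw [add_zero, div_mul_eq_mul_div, mul_add, mul_one, mul_div_cancel₀ _ hd]
    · simp [localDensity, hh, hm, hmn, h1]
  · simp [localDensity, hh, hm]

lemma prod_localDensity_mem_Icc (k n N : ℕ) (hk : k ≠ 0) :
    ∏ m ∈ range N, localDensity k n m ∈ Set.Icc (0 : ℝ) 1 :=
  ⟨prod_nonneg fun m _ => localDensity_nonneg k n m hk,
    prod_le_one (fun m _ => localDensity_nonneg k n m hk) fun m _ => localDensity_le_one k n m hk⟩

lemma abs_prod_localDensity_sub_le (K n z : ℕ) (hn : n ≠ 0) (hz : z ≠ 0) :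
    |∏ m ∈ range (z + 1), localDensity (K + 3) n m - D (K + 3) * g (K + 3) n| ≤
      (K + 3) * (K + 2) / z := by
  have hstep : ∀ N, z ≤ N →
      ∏ m ∈ range (z + 1), localDensity (K + 3) n m -
        (K + 3) * (K + 2) * ∑ m ∈ Ioc z N, ((m : ℝ) ^ 2)⁻¹ ≤
          ∏ m ∈ range (N + 1), localDensity (K + 3) n m ∧
      ∏ m ∈ range (N + 1), localDensity (K + 3) n m ≤
        ∏ m ∈ range (z + 1), localDensity (K + 3) n m := by
    intro N hN
    induction N, hN using Nat.le_induction with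
    | base => simp
    | succ N hN ih =>
      obtain ⟨h0, h1⟩ := prod_localDensity_mem_Icc (K + 3) n (N + 1) (by omega)
      have h2 := localDensity_le_one (K + 3) n (N + 1) (by omega)
      have h3 := one_sub_localDensity_le K n (N + 1)
      rw [prod_range_succ _ (N + 1), sum_Ioc_succ_top hN]
      constructor
      · nlinarith
      · nlinarith
  have hlim := (hasProd_localDensity K n hn).tendsto_prod_nat
  have hup : D (K + 3) * g (K + 3) n ≤ ∏ m ∈ range (z + 1), localDensity (K + 3) n m := by
    refine le_of_tendsto hlim ?_
    filter_upwards [Filter.eventually_ge_atTop (z + 1)] with N hN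
    obtain ⟨N, rfl⟩ := Nat.exists_eq_add_of_le' (show 1 ≤ N by omega)
    exact (hstep N (by omega)).2
  have hlow : ∏ m ∈ range (z + 1), localDensity (K + 3) n m - (K + 3) * (K + 2) / z ≤
      D (K + 3) * g (K + 3) n := by
    refine ge_of_tendsto hlim ?_
    filter_upwards [Filter.eventually_ge_atTop (z + 1)] with N hN
    obtain ⟨N, rfl⟩ := Nat.exists_eq_add_of_le' (show 1 ≤ N by omega)
    refine le_trans ?_ (hstep N (by omega)).1
    have hs : ∑ m ∈ Ioc z N, ((m : ℝ) ^ 2)⁻¹ ≤ (z : ℝ)⁻¹ := by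
      refine (sum_Ioc_inv_sq_le_sub hz (by omega)).trans ?_
      simp
    rw [div_eq_mul_inv]
    gcongr
  rw [abs_le]
  constructor <;> [skip; linarith]
  have : (0 : ℝ) ≤ (K + 3) * (K + 2) / z := by positivity
  linarith

lemma mul_le_twelve_mul_factorial (K : ℕ) : (K + 3) * (K + 2) ≤ 12 * K.factorial := by
  induction K with
  | zero => norm_num
  | succ K ih =>
    rcases K with _ | _ | K
    · norm_num
    · norm_num [Nat.factorial]
    · rw [Nat.factorial_succ]
      nlinarith

lemma one_add_pow_le_one_add_two_mul (m : ℕ) {x : ℝ} (hx : 0 ≤ x) (hmx : m * x ≤ 1 / 2) :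
    (1 + x) ^ m ≤ 1 + 2 * (m * x) := by
  have h0 : 0 ≤ m * x := by positivity
  calc (1 + x) ^ m ≤ Real.exp x ^ m := by
        gcongr; linarith [Real.add_one_le_exp x]
    _ = Real.exp (m * x) := (Real.exp_nat_mul x m).symm
    _ ≤ 1 / (1 - m * x) := Real.exp_bound_div_one_sub_of_interval h0 (by linarith)
    _ ≤ 1 + 2 * (m * x) := by
        rw [div_le_iff₀ (by linarith)]
        nlinarith

lemma B_two_eq_totient {n : ℕ} (hn : 2 ≤ n) : B 2 n = n.totient := by
  rw [B_eq_card, Nat.totient]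
  refine card_bij (fun v _ => v 0) ?_ ?_ ?_
  · intro v hv
    simp only [mem_filter, mem_posTuples, Fin.sum_univ_two] at hv
    obtain ⟨⟨h1, h2⟩, h3⟩ := hv
    have h4 := h2 1
    have h5 : Nat.Coprime (v 0) (v 1) := h3 0 1 (by decide)
    rw [mem_filter, mem_range, ← h1, Nat.coprime_comm]
    exact ⟨by omega, by simpa using h5⟩
  · intro v hv w hw h
    simp only [mem_filter, mem_posTuples, Fin.sum_univ_two] at hv hw
    funext i
    fin_cases i
    · exact h
    · have := hv.1.1
      have := hw.1.1
      change v 1 = w 1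
      omega
  · intro a ha
    rw [mem_filter, mem_range] at ha
    have ha0 : 0 < a := by
      rcases Nat.eq_zero_or_pos a with rfl | h
      · have := ha.2
        rw [Nat.coprime_zero_right] at this
        omega
      · exact h
    have hco : Nat.Coprime a (n - a) := by
      rw [Nat.coprime_sub_self_right ha.1.le]
      exact ha.2.symm
    refine ⟨![a, n - a], ?_, rfl⟩
    simp only [mem_filter, mem_posTuples, Fin.sum_univ_two, Fin.forall_fin_two]
    simp only [Matrix.cons_val_zero, Matrix.cons_val_one]
    refine ⟨⟨by omega, ha0, by omega⟩, ⟨fun h => absurd rfl h, fun _ => hco⟩, fun _ => hco.symm,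
      fun h => absurd rfl h⟩

lemma delta_two {x : ℝ} (hx : x ≠ 0) : delta 2 x = x := by
  rw [delta]
  field_simp
  norm_num
  ring

lemma B_two_eq (n : ℕ) (hn : 2 ≤ n) : (B 2 n : ℝ) = D 2 * g 2 n * n := by
  have hD : D 2 = 1 := by
    refine (tprod_congr fun p => ?_).trans (tprod_one (β := Nat.Primes))
    have hp : ((p : ℕ) : ℝ) ≠ 0 := Nat.cast_ne_zero.2 p.2.ne_zero
    rw [delta_two hp, pow_one, div_self hp]
  have hg : g 2 n = ∏ p ∈ n.primeFactors, (1 - (p : ℝ)⁻¹) := by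
    refine prod_congr rfl fun p hp => ?_
    have hp : (p : ℝ) ≠ 0 := Nat.cast_ne_zero.2 (Nat.prime_of_mem_primeFactors hp).ne_zero
    rw [delta_two hp]
    norm_num
    ring
  have h := congrArg (Rat.cast : ℚ → ℝ) (Nat.totient_eq_mul_prod_factors n)
  push_cast at h
  rw [B_two_eq_totient hn, h, hD, hg]
  ring

lemma primorial_le_exp {z : ℕ} {L : ℝ} (hz : (z : ℝ) ≤ L / 4) :
    (primorial z : ℝ) ≤ Real.exp (L / 2) := by
  have h4 : (4 : ℝ) ≤ Real.exp 2 := by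
    have h := Real.add_one_le_exp (1 : ℝ)
    have e : Real.exp 2 = Real.exp 1 * Real.exp 1 := by rw [← Real.exp_add]; norm_num
    rw [e]; nlinarith
  calc (primorial z : ℝ) ≤ (4 : ℝ) ^ z := by exact_mod_cast primorial_le_four_pow z
    _ ≤ Real.exp 2 ^ z := by gcongr
    _ = Real.exp (z * 2) := (Real.exp_nat_mul 2 z).symm
    _ ≤ Real.exp (L / 2) := by gcongr; linarith

lemma abs_card_siftedTuples_sub_le (K n z : ℕ) (hn : n ≠ 0)
    (hz : (K + 2) * ((K + 3) * (primorial z / n : ℝ)) ≤ 1 / 2) :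
    |((K + 2).factorial : ℝ) * #(siftedTuples (K + 3) n z) -
        (∏ m ∈ range (z + 1), localDensity (K + 3) n m) * (n : ℝ) ^ (K + 2)| ≤
      2 * ((K + 2) * ((K + 3) * (primorial z / n : ℝ))) * (n : ℝ) ^ (K + 2) := by
  have hn0 : (0 : ℝ) < n := by exact_mod_cast Nat.pos_of_ne_zero hn
  set u : ℝ := (K + 3) * (primorial z / n : ℝ) with hu
  have hu0 : 0 ≤ u := by positivity
  have hu1 : u ≤ 1 / 2 := by nlinarith [(Nat.cast_nonneg K : (0 : ℝ) ≤ K)]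
  have hPn : ((K : ℝ) + 3) * primorial z = n * u := by rw [hu]; field_simp
  have hle : (K + 2 + 1) * primorial z ≤ n := by
    have : ((K : ℝ) + 3) * primorial z ≤ n := by rw [hPn]; nlinarith
    exact_mod_cast this
  obtain ⟨h1, h2⟩ := card_siftedTuples_bounds (K + 2) n z hle
  obtain ⟨hp0, hp1⟩ := prod_localDensity_mem_Icc (K + 3) n (z + 1) (by omega)
  set Q := ∏ m ∈ range (z + 1), localDensity (K + 3) n m
  have e1 : (n : ℝ) - ((K + 2 : ℕ) + 1) * primorial z = n * (1 + -u) := by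
    push_cast; linear_combination -hPn
  have e2 : (n : ℝ) + ((K + 2 : ℕ) + 1) * primorial z = n * (1 + u) := by
    push_cast; linear_combination hPn
  rw [e1, mul_pow] at h1
  rw [e2, mul_pow] at h2
  have hM : (0 : ℝ) < (n : ℝ) ^ (K + 2) := by positivity
  have b1 := one_add_mul_le_pow (a := -u) (by linarith) (K + 2)
  have b2 := one_add_pow_le_one_add_two_mul (K + 2) hu0 (by push_cast; exact hz)
  push_cast at b1 b2
  have ht0 : 0 ≤ (K + 2) * u := by positivity
  have hMQ : 0 ≤ (n : ℝ) ^ (K + 2) * Q := by positivity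
  have hMQ1 : (n : ℝ) ^ (K + 2) * Q ≤ (n : ℝ) ^ (K + 2) := by nlinarith
  have c1 := mul_le_mul_of_nonneg_left b1 hMQ
  have c2 := mul_le_mul_of_nonneg_left b2 hMQ
  have c3 := mul_le_mul_of_nonneg_right hMQ1 ht0
  rw [abs_le]
  constructor <;> nlinarith

lemma abs_B_sub_le (K n : ℕ) (hn : n ≠ 0) (hL : 96 ≤ Real.log n)
    (hK : 32 * ((K : ℝ) + 3) ≤ Real.log n) :
    |(B (K + 3) n : ℝ) - D (K + 3) * g (K + 3) n * (n : ℝ) ^ (K + 2) / (K + 2).factorial| ≤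
      707 * (n : ℝ) ^ (K + 2) / Real.log n := by
  set L := Real.log n with hLdef
  have hn0 : (0 : ℝ) < n := by exact_mod_cast Nat.pos_of_ne_zero hn
  have hnE : (n : ℝ) = Real.exp (L / 2) * Real.exp (L / 2) := by
    rw [← Real.exp_add, add_halves, hLdef, Real.exp_log hn0]
  set E := Real.exp (L / 2)
  have hE0 : 0 < E := Real.exp_pos _
  have hE : L ^ 3 ≤ 48 * E := by
    have h := Real.pow_div_factorial_le_exp (L / 2) (by linarith) 3
    norm_num [Nat.factorial] at h
    linarith
  set z := ⌊L / 4⌋₊ with hzdef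
  have hz1 : (z : ℝ) ≤ L / 4 := Nat.floor_le (by linarith)
  have hz2 : L / 5 ≤ z := by
    have := Nat.lt_floor_add_one (L / 4)
    linarith
  have hz0 : (0 : ℝ) < z := by linarith
  have hzne : z ≠ 0 := by rintro h; rw [h] at hz0; simp at hz0
  have hLE : L ≤ n := (Real.log_le_sub_one_of_pos hn0).trans (by linarith)
  have hzn : z ≤ n := by
    have : (z : ℝ) ≤ n := by linarith
    exact_mod_cast this
  have hP : (primorial z : ℝ) ≤ E := primorial_le_exp hz1
  have hPn : (primorial z : ℝ) / n ≤ 1 / E := by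
    rw [hnE, div_le_div_iff₀ (by positivity) hE0]
    nlinarith
  have hsmall : (K + 2) * ((K + 3) * (primorial z / n : ℝ)) ≤ 1 / (2 * L) := by
    have h1 : ((K : ℝ) + 2) * (K + 3) ≤ L ^ 2 / 1024 := by
      nlinarith [(Nat.cast_nonneg K : (0 : ℝ) ≤ K)]
    calc (K + 2) * ((K + 3) * (primorial z / n : ℝ))
        = ((K + 2) * (K + 3)) * (primorial z / n : ℝ) := by ring
      _ ≤ L ^ 2 / 1024 * (1 / E) := by gcongr
      _ ≤ 1 / (2 * L) := by
          rw [div_mul_div_comm, div_le_div_iff₀ (by positivity) (by positivity)]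
          nlinarith
  have hhalf : 1 / (2 * L) ≤ 1 / 2 := by
    rw [div_le_div_iff₀ (by positivity) (by norm_num)]
    linarith
  have hsift := abs_card_siftedTuples_sub_le K n z hn (hsmall.trans hhalf)
  have hB1 := card_siftedTuples_sub_B_le K n z hzne hzn
  have hB0 : (B (K + 3) n : ℝ) ≤ #(siftedTuples (K + 3) n z) := by
    exact_mod_cast B_le_card_siftedTuples (K + 3) n z
  have hprod := abs_prod_localDensity_sub_le K n z hn hzne
  set Q := ∏ m ∈ range (z + 1), localDensity (K + 3) n m
  set S : ℝ := (#(siftedTuples (K + 3) n z) : ℝ)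
  set G := D (K + 3) * g (K + 3) n
  set M := (n : ℝ) ^ (K + 2)
  have hM : 0 < M := by positivity
  have hfac : ((K + 3) * (K + 2) : ℝ) ≤ 12 * K.factorial := by
    exact_mod_cast mul_le_twelve_mul_factorial K
  have hK0 : (0 : ℝ) < K.factorial := by exact_mod_cast Nat.factorial_pos K
  have hF : (K.factorial : ℝ) ≤ (K + 2).factorial := by
    exact_mod_cast Nat.factorial_le (by omega)
  have hF0 : (0 : ℝ) < (K + 2).factorial := hK0.trans_le hF
  have hF1 : (1 : ℝ) ≤ (K + 2).factorial := by exact_mod_cast Nat.factorial_pos _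
  have hzinv : 1 / (z : ℝ) ≤ 5 / L := by
    rw [div_le_div_iff₀ hz0 (by linarith)]
    linarith
  have t1 : |(B (K + 3) n : ℝ) - S| ≤ 60 * (M / L) := by
    rw [abs_sub_comm, abs_of_nonneg (by linarith)]
    refine le_of_mul_le_mul_left ?_ hK0
    calc _ ≤ (K + 3) * (K + 2) * M / z := hB1
      _ = ((K + 3) * (K + 2)) * (M * (1 / z)) := by ring
      _ ≤ (12 * K.factorial) * (M * (5 / L)) := by gcongr
      _ = _ := by ring
  have t2 : |S - Q * M / (K + 2).factorial| ≤ M / L := by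
    have e : S - Q * M / (K + 2).factorial =
        ((K + 2).factorial * S - Q * M) / (K + 2).factorial := by field_simp
    rw [e, abs_div, abs_of_pos hF0]
    calc _ ≤ |(K + 2).factorial * S - Q * M| := div_le_self (abs_nonneg _) hF1
      _ ≤ _ := hsift
      _ ≤ 2 * (1 / (2 * L)) * M := by gcongr
      _ = M / L := by field_simp
  have hfac2 : ((K + 3) * (K + 2) : ℝ) ≤ 12 * (K + 2).factorial := by linarith
  have t3 : |Q * M / (K + 2).factorial - G * M / (K + 2).factorial| ≤ 60 * (M / L) := by
    have e : Q * M / (K + 2).factorial - G * M / (K + 2).factorial =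
        (Q - G) * (M / (K + 2).factorial) := by ring
    rw [e, abs_mul, abs_of_pos (by positivity : 0 < M / ((K + 2).factorial : ℝ))]
    calc _ ≤ (K + 3) * (K + 2) / z * (M / (K + 2).factorial) := by gcongr
      _ = ((K + 3) * (K + 2)) * (1 / z * (M / (K + 2).factorial)) := by ring
      _ ≤ (12 * (K + 2).factorial) * (5 / L * (M / (K + 2).factorial)) := by
          gcongr
      _ = 60 * (M / L) := by field_simp; norm_num
  have hML : 0 ≤ M / L := by positivity
  rw [mul_div_assoc 707]
  have a1 := abs_sub_le (B (K + 3) n : ℝ) S (G * M / (K + 2).factorial)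
  have a2 := abs_sub_le S (Q * M / (K + 2).factorial) (G * M / (K + 2).factorial)
  linarith

end


theorem statement2 (k n : ℕ) (hk : 2 ≤ k) (hn : Real.exp ((k : ℝ) * 2 ^ (k + 2)) ≤ (n : ℝ)) :
    |(B k n : ℝ) - D k * g k n * (n : ℝ) ^ (k - 1) / (Nat.factorial (k - 1) : ℝ)| ≤
      707 * (n : ℝ) ^ (k - 1) / Real.log n := by
  have hn0 : (0 : ℝ) < n := (Real.exp_pos _).trans_le hn
  have hn' : n ≠ 0 := by rintro rfl; simp at hn0
  have hlog : (k : ℝ) * 2 ^ (k + 2) ≤ Real.log n := (Real.le_log_iff_exp_le hn0).2 hn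
  rcases hk.eq_or_lt with rfl | hk3
  · norm_num at hlog
    have hn2 : 2 ≤ n := by
      have h1 := Real.log_le_sub_one_of_pos hn0
      have h2 : (2 : ℝ) ≤ n := by linarith
      exact_mod_cast h2
    rw [B_two_eq n hn2]
    norm_num
    positivity
  · obtain ⟨K, rfl⟩ := Nat.exists_eq_add_of_le' (show 3 ≤ k from hk3)
    have hpow : (32 : ℝ) ≤ 2 ^ (K + 3 + 2) := by
      calc (32 : ℝ) = 2 ^ 5 := by norm_num
        _ ≤ _ := pow_le_pow_right₀ (by norm_num) (by omega)
    push_cast at hlog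
    have hK : (0 : ℝ) ≤ K := Nat.cast_nonneg K
    exact abs_B_sub_le K n hn' (by nlinarith) (by nlinarith)
end

section
/- For every integer k ≥ 3, the infinite product D_k = ∏_p δ_k(p)/p^{k−1} over all primes p converges and satisfies 0 < D_k < 1. Furthermore, for every positive integer n, 1/(2k) < g_k(n) < 2k. -/
open Real

lemma neg_le_neg_one_pow_mul (k : ℕ) {c : ℝ} (hc : 0 ≤ c) : -c ≤ (-1 : ℝ) ^ k * c := by
  rcases neg_one_pow_eq_or ℝ k with h | h <;> rw [h] <;> linarith

lemma neg_one_pow_mul_le (k : ℕ) {c : ℝ} (hc : 0 ≤ c) : (-1 : ℝ) ^ k * c ≤ c := by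
  rcases neg_one_pow_eq_or ℝ k with h | h <;> rw [h] <;> linarith

lemma delta_pos_s3 {k : ℕ} (hk : 3 ≤ k) {x : ℝ} (hx : 2 ≤ x) : 0 < delta k x := by
  have hk' : (3 : ℝ) ≤ k := by exact_mod_cast hk
  have h1 : 1 ≤ (x - 1) ^ k := one_le_pow₀ (by linarith)
  have h2 : 1 ≤ (x - 1) ^ (k - 1) := one_le_pow₀ (by linarith)
  have h3 := neg_le_neg_one_pow_mul k (c := (k : ℝ) - 1) (by linarith)
  unfold delta
  apply div_pos _ (by linarith)
  nlinarith

lemma pow_add_mul_pow_add_le {k : ℕ} (hk : 3 ≤ k) {y : ℝ} (hy : 0 ≤ y) :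
    y ^ k + k * y ^ (k - 1) + (1 + k * y) ≤ (y + 1) ^ k := by
  induction k, hk using Nat.le_induction with
  | base => norm_num; nlinarith
  | succ k hk ih =>
    obtain ⟨m, rfl⟩ : ∃ m, k = m + 1 := ⟨k - 1, by omega⟩
    simp only [Nat.add_sub_cancel] at ih ⊢
    have h := mul_le_mul_of_nonneg_right ih (by linarith : 0 ≤ y + 1)
    have : 0 ≤ ((m + 1 : ℕ) : ℝ) * y ^ m := by positivity
    have : 0 ≤ ((m + 1 : ℕ) : ℝ) * y ^ 2 := by positivity
    rw [pow_succ (y + 1) (m + 1)]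
    refine le_trans ?_ h
    push_cast at *
    ring_nf at *
    linarith

lemma delta_div_pow_lt_one {k : ℕ} (hk : 3 ≤ k) {x : ℝ} (hx : 2 ≤ x) :
    delta k x / x ^ (k - 1) < 1 := by
  have hk' : (3 : ℝ) ≤ k := by exact_mod_cast hk
  have hx0 : 0 < x := by linarith
  have h := pow_add_mul_pow_add_le hk (y := x - 1) (by linarith)
  have h3 := neg_one_pow_mul_le k (c := (k : ℝ) - 1) (by linarith)
  have hxk : x ^ (k - 1) * x = x ^ k := pow_sub_one_mul (by omega) x
  rw [sub_add_cancel] at h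
  rw [div_lt_one (by positivity)]
  unfold delta
  rw [div_lt_iff₀ hx0, hxk]
  nlinarith

lemma one_sub_delta_div_pow_le {k : ℕ} (hk : 3 ≤ k) {x : ℝ} (hx : 2 ≤ x) :
    1 - delta k x / x ^ (k - 1) ≤ ((k : ℝ) ^ 2 - 1) * (x ^ 2)⁻¹ := by
  obtain ⟨m, rfl⟩ : ∃ m, k = m + 1 := ⟨k - 1, by omega⟩
  have hm : (2 : ℝ) ≤ m := by exact_mod_cast (by omega : 2 ≤ m)
  have hx0 : 0 < x := by linarith
  obtain ⟨u, rfl⟩ : ∃ u, x = u⁻¹ := ⟨x⁻¹, by simp⟩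
  have hu : 0 < u := inv_pos.mp hx0
  have hu1 : u ≤ 1 / 2 := by
    rw [le_inv_comm₀ (by norm_num) hu] at hx
    linarith
  have key : delta (m + 1) u⁻¹ / u⁻¹ ^ (m + 1 - 1) =
      (1 - u) ^ (m + 1) + (m + 1) * u * (1 - u) ^ m + (-1 : ℝ) ^ (m + 1) * (m * u ^ (m + 1)) := by
    have : u⁻¹ - 1 = (1 - u) / u := by field_simp
    unfold delta
    rw [this]
    simp only [Nat.add_sub_cancel, div_pow, inv_pow, pow_succ, Nat.cast_add, Nat.cast_one]
    field_simp
    ring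
  have h1 := one_add_mul_le_pow (a := -u) (by linarith) (m + 1)
  have h2 := one_add_mul_le_pow (a := -u) (by linarith) m
  have h3 := neg_le_neg_one_pow_mul (m + 1) (c := (m : ℝ) * u ^ (m + 1)) (by positivity)
  have h4 : u ^ (m + 1) ≤ u ^ 2 := pow_le_pow_of_le_one hu.le (by linarith) (by omega)
  have h5 : (m : ℝ) * u ^ (m + 1) ≤ m * u ^ 2 := by gcongr
  have h6 := mul_le_mul_of_nonneg_left h2 (by positivity : 0 ≤ ((m : ℝ) + 1) * u)
  rw [key]
  simp only [← sub_eq_add_neg] at h1 h6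
  push_cast at *
  rw [inv_pow, inv_inv]
  nlinarith

lemma summable_delta_div_pow_sub_one {k : ℕ} (hk : 3 ≤ k) :
    Summable fun p : Nat.Primes => delta k ((p : ℕ) : ℝ) / ((p : ℕ) : ℝ) ^ (k - 1) - 1 := by
  have hp : ∀ p : Nat.Primes, (2 : ℝ) ≤ (p : ℕ) := fun p => by exact_mod_cast p.2.two_le
  have hs : Summable fun p : Nat.Primes => ((k : ℝ) ^ 2 - 1) * (((p : ℕ) : ℝ) ^ 2)⁻¹ :=
    ((Real.summable_nat_pow_inv.mpr one_lt_two).comp_injective Subtype.val_injective).mul_left _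
  refine hs.of_norm_bounded fun p => ?_
  rw [Real.norm_eq_abs, abs_of_nonpos (by linarith [delta_div_pow_lt_one hk (hp p)]), neg_sub]
  exact one_sub_delta_div_pow_le hk (hp p)

lemma mul_cubic_le_two_mul_pow {k : ℕ} (hk : 4 ≤ k) {y : ℝ} (hy : 2 ≤ y) :
    ((k : ℝ) - 1) * (y * (y + 1) * (y + 2)) ≤ 2 * (y ^ k + k * y ^ (k - 1)) := by
  induction k, hk using Nat.le_induction with
  | base =>
    norm_num
    nlinarith [mul_nonneg (by linarith : 0 ≤ y - 2) (by positivity : 0 ≤ y ^ 3),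
      mul_nonneg (by linarith : 0 ≤ y - 2) (by positivity : 0 ≤ y ^ 2),
      mul_nonneg (by linarith : 0 ≤ y - 2) (by positivity : 0 ≤ y)]
  | succ k hk ih =>
    obtain ⟨m, rfl⟩ : ∃ m, k = m + 1 := ⟨k - 1, by omega⟩
    have hm : (3 : ℝ) ≤ m := by exact_mod_cast (by omega : 3 ≤ m)
    simp only [Nat.add_sub_cancel] at ih ⊢
    have h := mul_le_mul_of_nonneg_left ih (by linarith : 0 ≤ y)
    have hc : 0 ≤ y * (y + 1) * (y + 2) := by positivity
    have h0 : 0 ≤ y ^ (m + 1) := by positivity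
    have h1 : ((m : ℝ) + 1) * (y * (y + 1) * (y + 2)) ≤ y * (m * (y * (y + 1) * (y + 2))) := by
      rw [← mul_assoc y]
      exact mul_le_mul_of_nonneg_right (by nlinarith) hc
    push_cast at *
    calc _ = ((m : ℝ) + 1) * (y * (y + 1) * (y + 2)) := by ring
      _ ≤ _ := h1
      _ ≤ y * (2 * (y ^ (m + 1) + (m + 1) * y ^ m)) := by rwa [add_sub_cancel_right] at h
      _ = 2 * (y ^ (m + 1 + 1) + (m + 1) * y ^ (m + 1)) := by ring
      _ ≤ _ := by linarith

lemma le_delta_of_even {k : ℕ} (hk : 3 ≤ k) (hke : Even k) {x : ℝ} (hx : 3 ≤ x) :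
    ((k : ℝ) - 1) * ((x ^ 2 - 1) / 2) ≤ delta k x := by
  have h := mul_cubic_le_two_mul_pow (k := k) (by grind) (y := x - 1) (by linarith)
  have hk' : (3 : ℝ) ≤ k := by exact_mod_cast hk
  unfold delta
  rw [hke.neg_one_pow, le_div_iff₀ (by linarith)]
  linarith

lemma le_delta_of_odd {k : ℕ} (hk : 3 ≤ k) (hko : Odd k) {x : ℝ} (hx : 3 ≤ x) :
    ((k : ℝ) - 1) * ((x ^ 2 - 3) / 2) ≤ delta k x := by
  unfold delta
  rw [hko.neg_one_pow, le_div_iff₀ (by linarith)]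
  rcases hk.eq_or_lt with rfl | hk4
  · norm_num
    nlinarith
  have h := mul_cubic_le_two_mul_pow (k := k) (by omega) (y := x - 1) (by linarith)
  have hk' : (3 : ℝ) ≤ k := by exact_mod_cast hk
  nlinarith

/-- The factors of `g k` for even `k`, and their inverses for odd `k`. -/
noncomputable def gFactor (k : ℕ) (x : ℝ) : ℝ :=
  if Even k then 1 - ((k : ℝ) - 1) / delta k x else (1 + ((k : ℝ) - 1) / delta k x)⁻¹

lemma gFactor_two {k : ℕ} (hk : 3 ≤ k) : gFactor k 2 = 1 / k := by
  have hk' : (3 : ℝ) ≤ k := by exact_mod_cast hk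
  unfold gFactor delta
  split_ifs with h
  · have : (1 : ℝ) + k + (k - 1) = 2 * k := by ring
    rw [h.neg_one_pow]
    norm_num [this]
    field_simp
    ring
  · rw [(Nat.not_even_iff_odd.mp h).neg_one_pow]
    norm_num

lemma gFactor_le_one {k : ℕ} (hk : 3 ≤ k) {x : ℝ} (hx : 2 ≤ x) : gFactor k x ≤ 1 := by
  have hk' : (3 : ℝ) ≤ k := by exact_mod_cast hk
  have h0 : 0 ≤ ((k : ℝ) - 1) / delta k x :=
    div_nonneg (by linarith) (delta_pos_s3 hk hx).le
  unfold gFactor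
  split_ifs
  · linarith
  · exact inv_le_one_of_one_le₀ (by linarith)

lemma one_sub_le_gFactor {k : ℕ} (hk : 3 ≤ k) {x : ℝ} (hx : 3 ≤ x) :
    1 - 2 / (x ^ 2 - 1) ≤ gFactor k x := by
  have hk' : (3 : ℝ) ≤ k := by exact_mod_cast hk
  have hd := delta_pos_s3 hk (by linarith : 2 ≤ x)
  have hx2 : 0 < x ^ 2 - 3 := by nlinarith
  have hx1 : 0 < x ^ 2 - 1 := by linarith
  unfold gFactor
  split_ifs with h
  · have := le_delta_of_even hk h hx
    have : ((k : ℝ) - 1) / delta k x ≤ 2 / (x ^ 2 - 1) := by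
      rw [div_le_div_iff₀ hd hx1]
      linarith
    linarith
  · have := le_delta_of_odd hk (Nat.not_even_iff_odd.mp h) hx
    have hle : ((k : ℝ) - 1) / delta k x ≤ 2 / (x ^ 2 - 3) := by
      rw [div_le_div_iff₀ hd hx2]
      linarith
    have h0 : 0 ≤ ((k : ℝ) - 1) / delta k x := div_nonneg (by linarith) hd.le
    calc 1 - 2 / (x ^ 2 - 1) = (1 + 2 / (x ^ 2 - 3))⁻¹ := by
          have : x ^ 2 - 3 + 2 ≠ 0 := by linarith
          field_simp
          ring
      _ ≤ _ := by gcongr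

lemma sum_odd_two_div_sq_sub_one (N : ℕ) :
    ∑ m ∈ Finset.range (2 * N + 3), (if Odd m then 2 / ((m : ℝ) ^ 2 - 1) else 0) =
      1 / 2 - 1 / (2 * (N : ℝ) + 2) := by
  induction N with
  | zero => norm_num [Finset.sum_range_succ, Nat.odd_iff]
  | succ N ih =>
    rw [show 2 * (N + 1) + 3 = 2 * N + 3 + 1 + 1 by ring, Finset.sum_range_succ,
      Finset.sum_range_succ, ih, if_pos (by grind), if_neg (by grind)]
    push_cast
    have : (2 * (N : ℝ) + 3) ^ 2 - 1 = (2 * N + 2) * (2 * N + 4) := by ring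
    rw [this]
    field_simp
    ring

lemma sum_two_div_sq_sub_one_lt (s : Finset ℕ) (hs : ∀ p ∈ s, Odd p) :
    ∑ p ∈ s, 2 / ((p : ℝ) ^ 2 - 1) < 1 / 2 := by
  obtain ⟨N, hN⟩ := s.exists_nat_subset_range
  calc ∑ p ∈ s, 2 / ((p : ℝ) ^ 2 - 1)
      = ∑ p ∈ s, (if Odd p then 2 / ((p : ℝ) ^ 2 - 1) else 0) :=
        Finset.sum_congr rfl fun p hp => (if_pos (hs p hp)).symm
    _ ≤ ∑ m ∈ Finset.range (2 * N + 3), (if Odd m then 2 / ((m : ℝ) ^ 2 - 1) else 0) := by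
        refine Finset.sum_le_sum_of_subset_of_nonneg
          (hN.trans (Finset.range_mono (by omega))) fun m _ _ => ?_
        split_ifs with h
        · have : (1 : ℝ) ≤ m := by exact_mod_cast h.pos
          exact div_nonneg zero_le_two (by nlinarith)
        · rfl
    _ = 1 / 2 - 1 / (2 * N + 2) := sum_odd_two_div_sq_sub_one N
    _ < 1 / 2 := sub_lt_self _ (by positivity)

lemma one_sub_sum_le_prod {ι : Type*} (s : Finset ι) (a f : ι → ℝ)
    (ha : ∀ i ∈ s, 0 ≤ a i) (ha1 : ∀ i ∈ s, a i ≤ 1) (hf : ∀ i ∈ s, 1 - a i ≤ f i) :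
    1 - ∑ i ∈ s, a i ≤ ∏ i ∈ s, f i := by
  refine le_trans ?_ (Finset.prod_le_prod (fun i hi => sub_nonneg.mpr (ha1 i hi)) hf)
  classical
  induction s using Finset.induction_on with
  | empty => simp
  | insert i s hi ih =>
    simp only [Finset.forall_mem_insert] at ha ha1 hf
    have h := ih ha.2 ha1.2 hf.2
    have h0 : 0 ≤ ∑ i ∈ s, a i := Finset.sum_nonneg ha.2
    rw [Finset.sum_insert hi, Finset.prod_insert hi]
    nlinarith [mul_le_mul_of_nonneg_left h (sub_nonneg.mpr ha1.1), mul_nonneg ha.1 h0]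

lemma half_lt_prod_gFactor {k : ℕ} (hk : 3 ≤ k) (s : Finset ℕ)
    (hs : ∀ p ∈ s, 3 ≤ p ∧ Odd p) : 1 / 2 < ∏ p ∈ s, gFactor k p := by
  have h3 : ∀ p ∈ s, (3 : ℝ) ≤ p := fun p hp => by exact_mod_cast (hs p hp).1
  have h := one_sub_sum_le_prod s (fun p => 2 / ((p : ℝ) ^ 2 - 1)) (fun p => gFactor k p)
    (fun p hp => div_nonneg zero_le_two (by nlinarith [h3 p hp]))
    (fun p hp => (div_le_one (by nlinarith [h3 p hp])).mpr (by nlinarith [h3 p hp]))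
    (fun p hp => one_sub_le_gFactor hk (h3 p hp))
  linarith [sum_two_div_sq_sub_one_lt s fun p hp => (hs p hp).2]

lemma prod_gFactor_bounds {k : ℕ} (hk : 3 ≤ k) (n : ℕ) :
    1 / (2 * (k : ℝ)) < ∏ p ∈ n.primeFactors, gFactor k p ∧
      ∏ p ∈ n.primeFactors, gFactor k p ≤ 1 := by
  have hk' : (3 : ℝ) ≤ k := by exact_mod_cast hk
  have hhalf : 1 / 2 < ∏ p ∈ n.primeFactors.erase 2, gFactor k p := by
    refine half_lt_prod_gFactor hk _ fun p hp => ?_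
    obtain ⟨hp2, hp⟩ := Finset.mem_erase.mp hp
    have hpp := Nat.prime_of_mem_primeFactors hp
    have := hpp.two_le
    exact ⟨by omega, hpp.odd_of_ne_two hp2⟩
  have hpos : ∀ p ∈ n.primeFactors, 0 ≤ gFactor k p := fun p hp => by
    have hp2 := (Nat.prime_of_mem_primeFactors hp).two_le
    rcases hp2.eq_or_lt with rfl | hp3
    · rw [Nat.cast_ofNat, gFactor_two hk]
      positivity
    · have hp3 : (3 : ℝ) ≤ p := by exact_mod_cast hp3
      refine le_trans ?_ (one_sub_le_gFactor hk hp3)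
      rw [sub_nonneg, div_le_one (by nlinarith)]
      nlinarith
  refine ⟨?_, Finset.prod_le_one hpos fun p hp => gFactor_le_one hk ?_⟩
  · have hsplit : 1 / (2 * (k : ℝ)) = 1 / k * (1 / 2) := by ring
    by_cases h2 : 2 ∈ n.primeFactors
    · rw [← Finset.mul_prod_erase _ _ h2, Nat.cast_ofNat, gFactor_two hk, hsplit]
      gcongr
    · rw [Finset.erase_eq_of_notMem h2] at hhalf
      refine lt_trans ?_ hhalf
      gcongr
      linarith
  · exact_mod_cast (Nat.prime_of_mem_primeFactors hp).two_le

lemma g_eq_of_even {k : ℕ} (hk : 3 ≤ k) (hke : Even k) (n : ℕ) :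
    g k n = ∏ p ∈ n.primeFactors, gFactor k p := by
  have : Odd (k - 1) := by grind
  refine Finset.prod_congr rfl fun p _ => ?_
  rw [gFactor, if_pos hke, this.neg_one_pow]
  ring

lemma g_eq_of_odd {k : ℕ} (hko : Odd k) (n : ℕ) :
    g k n = (∏ p ∈ n.primeFactors, gFactor k p)⁻¹ := by
  have : Even (k - 1) := by grind
  simp [g, gFactor, Nat.not_even_iff_odd.mpr hko, this.neg_one_pow]

lemma g_bounds {k : ℕ} (hk : 3 ≤ k) (n : ℕ) :
    1 / (2 * (k : ℝ)) < g k n ∧ g k n < 2 * (k : ℝ) := by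
  have hk' : (3 : ℝ) ≤ k := by exact_mod_cast hk
  obtain ⟨h1, h2⟩ := prod_gFactor_bounds hk n
  rcases k.even_or_odd with h | h
  · rw [g_eq_of_even hk h]
    exact ⟨h1, by linarith⟩
  · rw [g_eq_of_odd h]
    have hpos : 0 < 1 / (2 * (k : ℝ)) := by positivity
    constructor
    · calc 1 / (2 * (k : ℝ)) < 1 := by rw [div_lt_one] <;> linarith
        _ ≤ _ := (one_le_inv₀ (hpos.trans h1)).mpr h2
    · rwa [inv_lt_comm₀ (hpos.trans h1) (by linarith), ← one_div]

theorem statement3 (k : ℕ) (hk : 3 ≤ k) :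
    Multipliable (fun p : Nat.Primes => delta k ((p : ℕ) : ℝ) / ((p : ℕ) : ℝ) ^ (k - 1)) ∧
    0 < D k ∧ D k < 1 ∧
    ∀ n : ℕ, 0 < n → 1 / (2 * (k : ℝ)) < g k n ∧ g k n < 2 * (k : ℝ) := by
  have hp : ∀ p : Nat.Primes, (2 : ℝ) ≤ (p : ℕ) := fun p => by exact_mod_cast p.2.two_le
  have hpos : ∀ p : Nat.Primes, 0 < delta k ((p : ℕ) : ℝ) / ((p : ℕ) : ℝ) ^ (k - 1) :=
    fun p => div_pos (delta_pos_s3 hk (hp p)) (pow_pos (by linarith [hp p]) _)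
  have hlog : Summable fun p : Nat.Primes =>
      Real.log (delta k ((p : ℕ) : ℝ) / ((p : ℕ) : ℝ) ^ (k - 1)) := by
    simpa using Real.summable_log_one_add_of_summable (summable_delta_div_pow_sub_one hk)
  have hneg : ∀ p : Nat.Primes,
      0 < -Real.log (delta k ((p : ℕ) : ℝ) / ((p : ℕ) : ℝ) ^ (k - 1)) :=
    fun p => neg_pos.mpr (Real.log_neg (hpos p) (delta_div_pow_lt_one hk (hp p)))
  have hD := Real.rexp_tsum_eq_tprod hpos hlog
  refine ⟨(Real.hasProd_of_hasSum_log hpos hlog.hasSum).multipliable, ?_, ?_,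
    fun n _ => g_bounds hk n⟩
  · rw [D, ← hD]
    exact Real.exp_pos _
  · rw [D, ← hD, Real.exp_lt_one_iff, ← neg_pos, ← tsum_neg]
    exact hlog.neg.tsum_pos (fun p => (hneg p).le) ⟨2, Nat.prime_two⟩ (hneg _)
end

section
/- Let k ≥ 1 and n ≥ 0 be integers and let p be a prime. The number of k-tuples (y_1*, …, y_k*) with y_i* ∈ {0, …, p−1} for every i, with y_1* + ⋯ + y_k* ≡ n (mod p), and with y_j* = 0 for at least one j ∈ {1, …, k}, equals φ_k(p) if p divides n, and equals ψ_k(p) if p does not divide n. -/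
/-- `φ_k(x) = (x^k − (x−1)^k + (−1)^{k+1}(x−1))/x`. -/
noncomputable def phi (k : ℕ) (x : ℝ) : ℝ :=
  (x ^ k - (x - 1) ^ k + (-1 : ℝ) ^ (k + 1) * (x - 1)) / x

theorem card_subtype_and_add_card_subtype_and_not {α : Type*} [Finite α] (P Q : α → Prop) :
    Nat.card {x // P x ∧ Q x} + Nat.card {x // P x ∧ ¬ Q x} = Nat.card {x // P x} := by
  classical
  have := Fintype.ofFinite α
  simp only [Nat.card_eq_fintype_card, Fintype.card_subtype, ← Finset.filter_filter]
  exact Finset.card_filter_add_card_filter_not _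

/-- Tuples with prescribed sum are determined by their tails. -/
theorem card_sum_eq_and {G : Type*} [AddCommGroup G] {k : ℕ} (a : G)
    (P : (Fin (k + 1) → G) → Prop) :
    Nat.card {y : Fin (k + 1) → G // ∑ i, y i = a ∧ P y} =
      Nat.card {t : Fin k → G // P (Fin.cons (a - ∑ i, t i) t)} := by
  have hcons (y : Fin (k + 1) → G) (hy : ∑ i, y i = a) :
      (Fin.cons (a - ∑ i, Fin.tail y i) (Fin.tail y) : Fin (k + 1) → G) = y := by
    rw [Fin.sum_univ_succ] at hy
    rw [← hy]
    simp [Fin.tail]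
  exact Nat.card_congr
    { toFun := fun y => ⟨Fin.tail y.1, by rw [hcons y.1 y.2.1]; exact y.2.2⟩
      invFun := fun t => ⟨Fin.cons (a - ∑ i, t.1 i) t.1, by simp [Fin.sum_univ_succ], t.2⟩
      left_inv := fun y => Subtype.ext (hcons y.1 y.2.1)
      right_inv := fun t => Subtype.ext (by simp only [Fin.tail_cons]) }

theorem card_forall_ne_zero (G : Type*) [Zero G] [Finite G] (k : ℕ) :
    Nat.card {t : Fin k → G // ∀ j, t j ≠ 0} = (Nat.card G - 1) ^ k := by
  classical
  have := Fintype.ofFinite G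
  rw [Nat.card_congr (Equiv.subtypePiEquivPi (p := fun _ (x : G) => x ≠ 0)), Nat.card_fun]
  simp [Fintype.card_subtype_compl]

open Classical in
/-- The number of `k`-tuples of nonzero elements of a finite abelian group with sum `a`. -/
theorem card_mul_card_sum_eq_and_forall_ne_zero {G : Type*} [AddCommGroup G] [Finite G]
    (k : ℕ) (a : G) :
    (Nat.card G : ℝ) * Nat.card {y : Fin k → G // ∑ i, y i = a ∧ ∀ j, y j ≠ 0} =
      ((Nat.card G : ℝ) - 1) ^ k + (-1) ^ k * (if a = 0 then (Nat.card G : ℝ) - 1 else -1) := by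
  induction k with
  | zero =>
    by_cases ha : a = 0
    · simp [ha]
    · simp [ha, Ne.symm ha]
  | succ k ih =>
    have hsplit := card_subtype_and_add_card_subtype_and_not
      (fun t : Fin k → G => ∀ j, t j ≠ 0) (fun t => ∑ i, t i = a)
    have hstep : Nat.card {y : Fin (k + 1) → G // ∑ i, y i = a ∧ ∀ j, y j ≠ 0} =
        Nat.card {t : Fin k → G // (∀ j, t j ≠ 0) ∧ ¬ ∑ i, t i = a} := by
      rw [card_sum_eq_and]
      simp only [Fin.forall_fin_succ, Fin.cons_zero, Fin.cons_succ, ne_eq, sub_eq_zero,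
        eq_comm (a := a), and_comm]
    rw [← hstep, card_forall_ne_zero] at hsplit
    simp only [and_comm (a := ∀ j, _)] at hsplit
    have hsplit' := congrArg (Nat.cast : ℕ → ℝ) hsplit
    have hpos : 1 ≤ Nat.card G := Nat.card_pos
    push_cast [hpos] at hsplit'
    linear_combination (Nat.card G : ℝ) * hsplit' - ih

theorem statement5 (k n : ℕ) (hk : 1 ≤ k) (p : ℕ) (hp : p.Prime) :
    (Nat.card {y : Fin k → ZMod p // (∑ i, y i) = (n : ZMod p) ∧ ∃ j, y j = 0} : ℝ) =
      if p ∣ n then phi k (p : ℝ) else psi k (p : ℝ) := by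
  have : NeZero p := ⟨hp.ne_zero⟩
  obtain ⟨m, rfl⟩ : ∃ m, k = m + 1 := ⟨k - 1, by omega⟩
  have hp0 : (p : ℝ) ≠ 0 := Nat.cast_ne_zero.mpr hp.ne_zero
  have hsplit := card_subtype_and_add_card_subtype_and_not
    (fun y : Fin (m + 1) → ZMod p => ∑ i, y i = (n : ZMod p)) (fun y => ∃ j, y j = 0)
  have htotal := card_sum_eq_and (n : ZMod p) (fun _ : Fin (m + 1) → ZMod p => True)
  have hnonzero := card_mul_card_sum_eq_and_forall_ne_zero (m + 1) (n : ZMod p)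
  simp only [and_true, Nat.card_eq_fintype_card (α := ZMod p), ZMod.card] at htotal hnonzero
  have hfun : Nat.card {t : Fin m → ZMod p // True} = p ^ m := by
    rw [Nat.card_congr (Equiv.subtypeUnivEquiv fun _ => trivial), Nat.card_fun]
    simp
  rw [htotal, hfun] at hsplit
  simp only [not_exists] at hsplit
  have hsplit' := congrArg (Nat.cast : ℕ → ℝ) hsplit
  push_cast at hsplit'
  simp only [ZMod.natCast_eq_zero_iff] at hnonzero
  split_ifs at hnonzero ⊢
  · rw [phi, eq_div_iff hp0]
    linear_combination (p : ℝ) * hsplit' - hnonzero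
  · rw [psi, eq_div_iff hp0]
    linear_combination (p : ℝ) * hsplit' - hnonzero
end

section
/- Let k ≥ 1 and n ≥ 0 be integers and let p be a prime. The number of k-tuples (y_1*, …, y_k*) with y_i* ∈ {0, …, p−1} for every i, with y_1* + ⋯ + y_k* ≡ n (mod p), and with y_j* = 0 for at most one index j ∈ {1, …, k}, equals η_k(p) if p divides n, and equals δ_k(p) if p does not divide n. -/
/-- `η_k(x) = ((x−1)^k + k(x−1)^{k−1} + (−1)^{k−1}(k−1)(x−1))/x`. -/
noncomputable def eta (k : ℕ) (x : ℝ) : ℝ :=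
  ((x - 1) ^ k + (k : ℝ) * (x - 1) ^ (k - 1) + (-1 : ℝ) ^ (k - 1) * ((k : ℝ) - 1) * (x - 1)) / x

theorem sum_fin_succ_pi (G : Type*) [Fintype G] (k : ℕ) (f : (Fin (k + 1) → G) → ℝ) :
    ∑ y, f y = ∑ b : G, ∑ y : Fin k → G, f (Fin.cons b y) := by
  rw [← Fintype.sum_prod_type']
  exact (Fintype.sum_equiv (Fin.consEquiv fun _ => G) _ _ fun _ => rfl).symm

section TuplesWithGivenSum

open scoped Classical

variable (G : Type*) [AddCommGroup G] [Fintype G]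

/-- The number of `k`-tuples of nonzero elements of `G` with sum `a`. -/
noncomputable def countNonzero (k : ℕ) (a : G) : ℝ :=
  ∑ y : Fin k → G, if (∑ i, y i) = a ∧ ∀ i, y i ≠ 0 then 1 else 0

/-- The number of `k`-tuples of elements of `G` with sum `a` and at most one zero entry. -/
noncomputable def countAtMostOneZero (k : ℕ) (a : G) : ℝ :=
  ∑ y : Fin k → G, if (∑ i, y i) = a ∧ ∀ i j, y i = 0 → y j = 0 → i = j then 1 else 0

/-- The character sum `∑ χ, χ a` over the nontrivial characters of `G`. -/
noncomputable def nontrivialCharSum (a : G) : ℝ :=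
  if a = 0 then (Fintype.card G : ℝ) - 1 else -1

theorem nontrivialCharSum_eq (a : G) :
    nontrivialCharSum G a = (if a = 0 then (Fintype.card G : ℝ) else 0) - 1 := by
  unfold nontrivialCharSum
  split_ifs <;> ring

theorem sum_nontrivialCharSum_sub (a : G) : ∑ b, nontrivialCharSum G (a - b) = 0 := by
  simp [nontrivialCharSum_eq, sub_eq_zero]

theorem countNonzero_succ (k : ℕ) (a : G) :
    countNonzero G (k + 1) a = ∑ b, countNonzero G k (a - b) - countNonzero G k a := by
  have key (b : G) : (∑ y : Fin k → G,
      if (∑ i, (Fin.cons b y : Fin (k + 1) → G) i) = a ∧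
        ∀ i, (Fin.cons b y : Fin (k + 1) → G) i ≠ 0 then (1 : ℝ) else 0) =
      countNonzero G k (a - b) - if b = 0 then countNonzero G k a else 0 := by
    rcases eq_or_ne b 0 with rfl | hb
    · simp [Fin.forall_fin_succ]
    · simp [Fin.forall_fin_succ, Fin.sum_univ_succ, hb, countNonzero, eq_sub_iff_add_eq']
  rw [countNonzero, sum_fin_succ_pi]
  simp only [key, Finset.sum_sub_distrib, Finset.sum_ite_eq', Finset.mem_univ, if_true]

theorem countAtMostOneZero_succ (k : ℕ) (a : G) :
    countAtMostOneZero G (k + 1) a =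
      ∑ b, countAtMostOneZero G k (a - b) - countAtMostOneZero G k a + countNonzero G k a := by
  have key (b : G) : (∑ y : Fin k → G,
      if (∑ i, (Fin.cons b y : Fin (k + 1) → G) i) = a ∧
        ∀ i j, (Fin.cons b y : Fin (k + 1) → G) i = 0 →
          (Fin.cons b y : Fin (k + 1) → G) j = 0 → i = j then (1 : ℝ) else 0) =
      countAtMostOneZero G k (a - b) - (if b = 0 then countAtMostOneZero G k a else 0) +
        if b = 0 then countNonzero G k a else 0 := by
    rcases eq_or_ne b 0 with rfl | hb
    · simp only [sub_zero, if_true, sub_self, zero_add, countNonzero]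
      refine Finset.sum_congr rfl fun y _ => if_congr (and_congr ?_ ?_) rfl rfl
      · simp [Fin.sum_univ_succ]
      · simp only [Fin.forall_fin_succ, Fin.cons_zero, Fin.cons_succ]
        refine ⟨fun h i hi => Fin.succ_ne_zero i (h.1.2 i trivial hi).symm, fun h => ?_⟩
        simp [h]
    · simp [Fin.forall_fin_succ, Fin.sum_univ_succ, hb, countAtMostOneZero, eq_sub_iff_add_eq']
  rw [countAtMostOneZero, sum_fin_succ_pi]
  simp only [key, Finset.sum_add_distrib, Finset.sum_sub_distrib, Finset.sum_ite_eq',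
    Finset.mem_univ, if_true]

theorem card_mul_countNonzero (k : ℕ) (a : G) :
    (Fintype.card G : ℝ) * countNonzero G k a =
      ((Fintype.card G : ℝ) - 1) ^ k + (-1) ^ k * nontrivialCharSum G a := by
  induction k generalizing a with
  | zero => simp [countNonzero, nontrivialCharSum_eq, eq_comm]
  | succ k ih =>
    rw [countNonzero_succ, mul_sub, Finset.mul_sum]
    simp only [ih, Finset.sum_add_distrib, ← Finset.mul_sum, sum_nontrivialCharSum_sub]
    simp only [Finset.sum_const, Finset.card_univ, nsmul_eq_mul]
    ring

theorem card_mul_countAtMostOneZero (k : ℕ) (a : G) :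
    (Fintype.card G : ℝ) * countAtMostOneZero G k a =
      ((Fintype.card G : ℝ) - 1) ^ k + k * ((Fintype.card G : ℝ) - 1) ^ (k - 1) +
        (-1) ^ k * (1 - k) * nontrivialCharSum G a := by
  induction k generalizing a with
  | zero => simp [countAtMostOneZero, nontrivialCharSum_eq, eq_comm]
  | succ k ih =>
    rw [countAtMostOneZero_succ, mul_add, mul_sub, Finset.mul_sum, card_mul_countNonzero]
    simp only [ih, Finset.sum_add_distrib, ← Finset.mul_sum, sum_nontrivialCharSum_sub]
    simp only [Finset.sum_const, Finset.card_univ, nsmul_eq_mul]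
    rcases k with _ | k
    · simp
    · push_cast [Nat.add_sub_cancel]
      ring

theorem natCard_eq_countAtMostOneZero (k : ℕ) (a : G) :
    (Nat.card {y : Fin k → G // (∑ i, y i) = a ∧ ∀ i j, y i = 0 → y j = 0 → i = j} : ℝ) =
      countAtMostOneZero G k a := by
  rw [Nat.card_eq_fintype_card, Fintype.card_subtype, countAtMostOneZero, Finset.sum_boole]

end TuplesWithGivenSum

theorem statement8 (k n : ℕ) (hk : 1 ≤ k) (p : ℕ) (hp : p.Prime) :
    (Nat.card {y : Fin k → ZMod p // (∑ i, y i) = (n : ZMod p) ∧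
        ∀ i j, y i = 0 → y j = 0 → i = j} : ℝ) =
      if p ∣ n then eta k (p : ℝ) else delta k (p : ℝ) := by
  have : NeZero p := ⟨hp.ne_zero⟩
  have hp0 : (p : ℝ) ≠ 0 := Nat.cast_ne_zero.mpr hp.ne_zero
  have h := card_mul_countAtMostOneZero (ZMod p) k n
  rw [ZMod.card, nontrivialCharSum, ZMod.natCast_eq_zero_iff, ZMod.card] at h
  rw [natCard_eq_countAtMostOneZero]
  obtain ⟨k, rfl⟩ := Nat.exists_eq_add_of_le' hk
  split_ifs at h ⊢
  · rw [eta, eq_div_iff hp0, mul_comm, h]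
    push_cast [Nat.add_sub_cancel]
    ring
  · rw [delta, eq_div_iff hp0, mul_comm, h]
    ring
end

section
/- For every integer k ≥ 3 and every prime p with p ≥ √(k·2^k), both p^{k−1}/η_k(p) ≤ 1 + k·2^k/p² and p^{k−1}/δ_k(p) ≤ 1 + k·2^k/p² hold. -/
/-- Second-order Bernoulli-type bound: the binomial expansion of `(q + 1) ^ (n + 2)` truncated
after two terms, with an upper bound for the remainder. -/
theorem add_one_pow_le_two_terms_add (q : ℝ) (hq : 0 ≤ q) (n : ℕ) :
    (q + 1) ^ (n + 2) ≤ q ^ (n + 2) + ((n : ℝ) + 2) * q ^ (n + 1)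
      + ((n : ℝ) + 2) * ((n : ℝ) + 1) / 2 * (q + 1) ^ n := by
  induction n with
  | zero =>
    norm_num
    nlinarith
  | succ n ih =>
    have h1 : q ^ (n + 1) ≤ (q + 1) ^ (n + 1) := by gcongr; linarith
    have h2 := mul_le_mul_of_nonneg_right ih (show 0 ≤ q + 1 by linarith)
    have h3 := mul_le_mul_of_nonneg_left h1 (show 0 ≤ (n : ℝ) + 2 by positivity)
    push_cast
    ring_nf at h2 h3 ⊢
    linarith

/-- If `N` is not much smaller than `x ^ (m + 3)`, then `x ^ (m + 2) / (N / x)` is close to `1`. -/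
theorem pow_div_div_le_one_add {x K D N : ℝ} {m : ℕ} (hx : 0 < x) (hD : 0 < D)
    (hKD : 2 * D ≤ K) (hKx : K ≤ x ^ 2) (hN : x ^ m * x * (x ^ 2 - D) ≤ N) :
    x ^ (m + 2) / (N / x) ≤ 1 + K / x ^ 2 := by
  have hpos : 0 < x ^ m * x * (x ^ 2 - D) := by
    have : 0 < x ^ 2 - D := by linarith
    positivity
  have hK : 0 < K := by linarith
  have key : x ^ 2 ≤ (1 + K / x ^ 2) * (x ^ 2 - D) := by
    have h : (1 + K / x ^ 2) * (x ^ 2 - D) - x ^ 2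
        = (K * x ^ 2 - D * x ^ 2 - K * D) / x ^ 2 := by
      field_simp
      ring
    have h' : 0 ≤ (K * x ^ 2 - D * x ^ 2 - K * D) / x ^ 2 := by
      apply div_nonneg _ (by positivity)
      nlinarith [mul_nonneg (sub_nonneg.2 hKD) (sq_nonneg x),
        mul_nonneg hK.le (show 0 ≤ x ^ 2 - 2 * D by linarith)]
    linarith
  rw [div_div_eq_mul_div, div_le_iff₀ (hpos.trans_le hN)]
  calc x ^ (m + 2) * x = x ^ m * x * x ^ 2 := by ring
    _ ≤ x ^ m * x * ((1 + K / x ^ 2) * (x ^ 2 - D)) := by gcongr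
    _ = (1 + K / x ^ 2) * (x ^ m * x * (x ^ 2 - D)) := by ring
    _ ≤ (1 + K / x ^ 2) * N := by gcongr

theorem statement11 (k : ℕ) (hk : 3 ≤ k) (p : ℕ) (hp : p.Prime)
    (hp2 : Real.sqrt ((k : ℝ) * 2 ^ k) ≤ (p : ℝ)) :
    (p : ℝ) ^ (k - 1) / eta k (p : ℝ) ≤ 1 + (k : ℝ) * 2 ^ k / (p : ℝ) ^ 2 ∧
    (p : ℝ) ^ (k - 1) / delta k (p : ℝ) ≤ 1 + (k : ℝ) * 2 ^ k / (p : ℝ) ^ 2 := by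
  obtain ⟨m, rfl⟩ := Nat.exists_eq_add_of_le' hk
  have hx : (2 : ℝ) ≤ p := by exact_mod_cast hp.two_le
  generalize (p : ℝ) = x at hx hp2 ⊢
  have hKx := (Real.sqrt_le_left (by linarith)).1 hp2
  have h2 : ((m : ℝ) + 4) ≤ 2 ^ (m + 3) := by
    exact_mod_cast Nat.lt_two_pow_self (n := m + 3)
  have hKD : 2 * (((m : ℝ) + 2) * ((m : ℝ) + 5) / 2) ≤ ((m + 3 : ℕ) : ℝ) * 2 ^ (m + 3) := by
    push_cast
    nlinarith [mul_le_mul_of_nonneg_left h2 (show 0 ≤ (m : ℝ) + 3 by positivity)]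
  have hmain : ∀ e : ℝ, -(((m : ℝ) + 2) * x) ≤ e →
      x ^ m * x * (x ^ 2 - ((m : ℝ) + 2) * ((m : ℝ) + 5) / 2)
        ≤ (x - 1) ^ (m + 3) + ((m + 3 : ℕ) : ℝ) * (x - 1) ^ (m + 2) + e := by
    intro e he
    have h := add_one_pow_le_two_terms_add (x - 1) (by linarith) (m + 1)
    rw [sub_add_cancel] at h
    have hX : 1 ≤ x ^ m := one_le_pow₀ (by linarith)
    have hXx := mul_le_mul_of_nonneg_right hX (show 0 ≤ ((m : ℝ) + 2) * x by positivity)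
    have e1 : x ^ (m + 1 + 2) = x ^ m * x ^ 3 := by ring
    have e2 : x ^ (m + 1) = x ^ m * x := by ring
    rw [e1, e2] at h
    push_cast at h ⊢
    rw [show m + 1 + 2 = m + 3 by ring, show m + 1 + 1 = m + 2 by ring] at h
    linear_combination h + hXx + he
  refine ⟨pow_div_div_le_one_add (by linarith) (by positivity) hKD hKx (hmain _ ?_),
    pow_div_div_le_one_add (by linarith) (by positivity) hKD hKx (hmain _ ?_)⟩
  · rcases neg_one_pow_eq_or ℝ (m + 3 - 1) with h | h <;> rw [h] <;> push_cast <;> nlinarith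
  · rcases neg_one_pow_eq_or ℝ (m + 3) with h | h <;> rw [h] <;> push_cast <;> nlinarith
end

section
/- For every integer k ≥ 3 and every prime p, both p^{k−1} − δ_k(p) ≤ k·2^{k−1}·p^{k−3} and p^{k−1} − η_k(p) ≤ k·2^{k−1}·p^{k−3} hold, and both quantities p^{k−1} − δ_k(p) and p^{k−1} − η_k(p) are nonnegative. -/
theorem mul_le_add_one_pow_sub (n : ℕ) {y : ℝ} (hy : 1 ≤ y) :
    ((n : ℝ) + 2) * y ≤ (y + 1) ^ (n + 3) - y ^ (n + 3) - ((n : ℝ) + 3) * y ^ (n + 2) := by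
  induction n with
  | zero => norm_num; nlinarith
  | succ n ih =>
    have h1 := mul_le_mul_of_nonneg_left ih (show 0 ≤ y + 1 by linarith)
    have h2 : 0 ≤ ((n : ℝ) + 3) * y ^ (n + 2) := by positivity
    have h3 : (2 : ℝ) * (((n : ℝ) + 2) * y) ≤ (y + 1) * (((n : ℝ) + 2) * y) := by
      gcongr; linarith
    have h4 : 0 ≤ (n : ℝ) * y := by positivity
    have h5 : (y + 1) ^ (n + 1 + 3) - y ^ (n + 1 + 3) - ((n : ℝ) + 1 + 3) * y ^ (n + 1 + 2) =
        (y + 1) * ((y + 1) ^ (n + 3) - y ^ (n + 3) - ((n : ℝ) + 3) * y ^ (n + 2)) +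
          ((n : ℝ) + 3) * y ^ (n + 2) := by ring
    push_cast
    rw [h5]
    linarith

theorem add_one_pow_sub_le_mul_pow (n : ℕ) {y : ℝ} (hy : 0 ≤ y) :
    (y + 1) ^ (n + 3) - y ^ (n + 3) - ((n : ℝ) + 3) * y ^ (n + 2) ≤
      ((n : ℝ) + 3) * (n + 2) / 2 * (y + 1) ^ (n + 1) := by
  induction n with
  | zero => norm_num; nlinarith
  | succ n ih =>
    have h1 := mul_le_mul_of_nonneg_left ih (show 0 ≤ y + 1 by linarith)
    have h2 : ((n : ℝ) + 3) * y ^ (n + 2) ≤ ((n : ℝ) + 3) * (y + 1) ^ (n + 2) := by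
      gcongr; linarith
    have h5 : (y + 1) ^ (n + 1 + 3) - y ^ (n + 1 + 3) - ((n : ℝ) + 1 + 3) * y ^ (n + 1 + 2) =
        (y + 1) * ((y + 1) ^ (n + 3) - y ^ (n + 3) - ((n : ℝ) + 3) * y ^ (n + 2)) +
          ((n : ℝ) + 3) * y ^ (n + 2) := by ring
    push_cast
    rw [h5]
    refine (add_le_add h1 h2).trans_eq ?_
    ring

theorem statement12 (k : ℕ) (hk : 3 ≤ k) (p : ℕ) (hp : p.Prime) :
    (0 ≤ (p : ℝ) ^ (k - 1) - delta k (p : ℝ) ∧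
      (p : ℝ) ^ (k - 1) - delta k (p : ℝ) ≤ (k : ℝ) * 2 ^ (k - 1) * (p : ℝ) ^ (k - 3)) ∧
    (0 ≤ (p : ℝ) ^ (k - 1) - eta k (p : ℝ) ∧
      (p : ℝ) ^ (k - 1) - eta k (p : ℝ) ≤ (k : ℝ) * 2 ^ (k - 1) * (p : ℝ) ^ (k - 3)) := by
  obtain ⟨n, rfl⟩ := Nat.exists_eq_add_of_le' hk
  obtain ⟨y, hy⟩ : ∃ y : ℝ, (p : ℝ) = y + 1 := ⟨p - 1, by ring⟩
  have hy1 : 1 ≤ y := by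
    have : (2 : ℝ) ≤ p := by exact_mod_cast hp.two_le
    linarith
  have hx : 0 < y + 1 := by linarith
  have hlo := mul_le_add_one_pow_sub n hy1
  have hup := add_one_pow_sub_le_mul_pow n (zero_le_one.trans hy1)
  have hpow : y + 1 ≤ (y + 1) ^ (n + 1) := le_self_pow₀ (by linarith) (by simp)
  have htwo : (n : ℝ) + 3 ≤ 2 ^ (n + 2) := by exact_mod_cast (Nat.lt_two_pow_self (n := n + 2))
  have hcoef : ((n : ℝ) + 3) * (n + 2) / 2 + (n + 2) ≤ (n + 3) * 2 ^ (n + 2) := by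
    nlinarith [(Nat.cast_nonneg n : (0 : ℝ) ≤ n)]
  have hbound := mul_le_mul_of_nonneg_right hcoef (pow_nonneg hx.le (n + 1))
  have hlin : ((n : ℝ) + 2) * (y + 1) ≤ (n + 2) * (y + 1) ^ (n + 1) := by gcongr
  have hone : (n : ℝ) + 2 ≤ (n + 2) * y := le_mul_of_one_le_right (by positivity) hy1
  -- Clear the denominator: a correction `e` with `|e| ≤ (n + 2) y` is harmless.
  have key : ∀ e : ℝ, |e| ≤ ((n : ℝ) + 2) * y →
      0 ≤ (y + 1) ^ (n + 2) - (y ^ (n + 3) + ((n : ℝ) + 3) * y ^ (n + 2) + e) / (y + 1) ∧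
      (y + 1) ^ (n + 2) - (y ^ (n + 3) + ((n : ℝ) + 3) * y ^ (n + 2) + e) / (y + 1) ≤
        ((n : ℝ) + 3) * 2 ^ (n + 2) * (y + 1) ^ n := by
    intro e he
    obtain ⟨he1, he2⟩ := abs_le.mp he
    have heq : (y + 1) ^ (n + 2) - (y ^ (n + 3) + ((n : ℝ) + 3) * y ^ (n + 2) + e) / (y + 1) =
        ((y + 1) ^ (n + 3) - y ^ (n + 3) - ((n : ℝ) + 3) * y ^ (n + 2) - e) / (y + 1) := by
      field_simp
      ring
    rw [heq]
    refine ⟨div_nonneg (by linarith) hx.le, ?_⟩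
    rw [div_le_iff₀ hx, mul_assoc, ← pow_succ]
    linarith
  have hn : ((n + 3 : ℕ) : ℝ) - 1 = n + 2 := by push_cast; ring
  have hn0 : (0 : ℝ) ≤ n + 2 := by positivity
  have h1 := key ((-1) ^ (n + 3) * (n + 2)) (by
    rw [abs_mul, abs_pow, abs_neg, abs_one, one_pow, one_mul, abs_of_nonneg hn0]
    exact hone)
  have h2 := key ((-1) ^ (n + 2) * (n + 2) * y) (by
    rw [abs_mul, abs_mul, abs_pow, abs_neg, abs_one, one_pow, one_mul, abs_of_nonneg hn0,
      abs_of_nonneg (zero_le_one.trans hy1)])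
  have hs1 : n + 3 - 1 = n + 2 := rfl
  have hs3 : n + 3 - 3 = n := rfl
  unfold delta eta
  rw [hy, hn, hs1, hs3, add_sub_cancel_right]
  push_cast
  exact ⟨h1, h2⟩
end

section
/- Let k ≥ 1 be an integer, let n be a positive integer, and let d be a squarefree positive integer with 1 ≤ d ≤ n. Then |K_{k,d}(n) − Θ_{k,n}(d) · (n/d)^k / k!| ≤ Θ_{k,n}(d) · (k + e^{k+1}/√(2πk)) · (n/d)^{k−1}. -/
/-- `Θ_{k,n}(d) = ∏_{p ∣ d, p ∣ n} φ_k(p) · ∏_{p ∣ d, p ∤ n} ψ_k(p)`. -/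
noncomputable def Theta (k n d : ℕ) : ℝ :=
  ∏ p ∈ d.primeFactors, (if p ∣ n then phi k (p : ℝ) else psi k (p : ℝ))

/-- `K_{k,d}(n)` is the number of `(k+1)`-tuples `(x, y_1, …, y_k)` of positive integers with
`x + y_1 + ⋯ + y_k = n` such that `d ∣ x` and `d ∣ y_1⋯y_k`. -/
noncomputable def K (k d n : ℕ) : ℕ :=
  Nat.card {v : Fin (k + 1) → ℕ // (∀ i, 0 < v i) ∧ (∑ i, v i) = n ∧
    d ∣ v 0 ∧ d ∣ ∏ i ∈ Finset.univ.erase 0, v i}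

lemma ascFactorial_cast_le (N j : ℕ) (t : ℝ) (ht : 1 ≤ t) (hN : (N : ℝ) ≤ t) :
    (N.ascFactorial (j + 1) : ℝ) ≤ t ^ (j + 1) + ((j + 1).factorial - 1 : ℝ) * t ^ j := by
  induction j with
  | zero => simpa [Nat.ascFactorial_succ] using hN
  | succ j ih =>
    have h1 : (1 : ℝ) ≤ (j + 1).factorial := by exact_mod_cast (j + 1).factorial_pos
    have h2 : t ^ j ≤ t ^ (j + 1) := pow_le_pow_right₀ ht (Nat.le_succ j)
    have h3 : 0 ≤ ((j : ℝ) + 1) * ((j + 1).factorial - 1) :=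
      mul_nonneg (by positivity) (by linarith)
    rw [Nat.ascFactorial_succ, Nat.factorial_succ (j + 1)]
    push_cast
    calc ((N : ℝ) + (j + 1)) * (N.ascFactorial (j + 1) : ℝ)
        ≤ (t + (j + 1)) * (t ^ (j + 1) + ((j + 1).factorial - 1 : ℝ) * t ^ j) := by gcongr
      _ ≤ _ := by
        have := mul_le_mul_of_nonneg_left h2 h3
        rw [pow_succ t (j + 1)] at *
        rw [pow_succ t j] at *
        nlinarith

lemma sub_pow_ge (j : ℕ) (t a : ℝ) (ha : 0 ≤ a) (hat : a ≤ t) :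
    t ^ (j + 1) - (j + 1) * a * t ^ j ≤ (t - a) ^ (j + 1) := by
  induction j with
  | zero => simp
  | succ j ih =>
    have h0 : 0 ≤ t ^ j := pow_nonneg (ha.trans hat) j
    have := mul_le_mul_of_nonneg_right ih (sub_nonneg.2 hat)
    rw [pow_succ (t - a) (j + 1)]
    refine le_trans ?_ this
    push_cast
    rw [pow_succ t (j + 1), pow_succ t j]
    have : 0 ≤ (j + 1) * a ^ 2 * t ^ j := by positivity
    nlinarith

/-- `t ^ k / k!` approximates the binomial coefficient `(m + k).choose k` when
`t - k ≤ m + 1 ≤ t`. -/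
lemma abs_choose_sub_le (k m : ℕ) (t : ℝ) (hk : 1 ≤ k) (ht : 1 ≤ t) (h1 : (m : ℝ) + 1 ≤ t)
    (h2 : t - k ≤ (m : ℝ) + 1) :
    |((m + k).choose k : ℝ) - t ^ k / k.factorial| ≤ k * t ^ (k - 1) := by
  obtain ⟨j, rfl⟩ := Nat.exists_eq_add_of_le' hk
  have hf : (0 : ℝ) < (j + 1).factorial := by exact_mod_cast (j + 1).factorial_pos
  have hjf : ((j + 1 : ℕ) : ℝ) ≤ (j + 1).factorial := by exact_mod_cast (j + 1).self_le_factorial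
  have hj : (1 : ℝ) ≤ (j + 1 : ℕ) := by exact_mod_cast hk
  have hc : (((m + 1).ascFactorial (j + 1) : ℕ) : ℝ) =
      (j + 1).factorial * ((m + (j + 1)).choose (j + 1) : ℝ) := by
    exact_mod_cast Nat.ascFactorial_eq_factorial_mul_choose m (j + 1)
  have hup := ascFactorial_cast_le (m + 1) j t ht (by exact_mod_cast h1)
  have hlow : ((m : ℝ) + 1) ^ (j + 1) ≤ ((m + 1).ascFactorial (j + 1) : ℕ) := by
    exact_mod_cast Nat.pow_succ_le_ascFactorial (m + 1) (j + 1)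
  have htj : 0 ≤ t ^ j := by positivity
  have hlow' : t ^ (j + 1) - (j + 1 : ℕ) * (j + 1 : ℕ) * t ^ j ≤
      ((m + 1).ascFactorial (j + 1) : ℕ) := by
    rcases le_total ((j + 1 : ℕ) : ℝ) t with h | h
    · refine (le_trans ?_ (sub_pow_ge j t (j + 1 : ℕ) (by positivity) h)).trans
        ((pow_le_pow_left₀ (by linarith) h2 _).trans hlow)
      push_cast
      exact le_rfl
    · have : t ^ (j + 1) ≤ (j + 1 : ℕ) * (j + 1 : ℕ) * t ^ j := by
        rw [pow_succ']
        gcongr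
        nlinarith
      exact le_trans (by linarith) (Nat.cast_nonneg _)
  have key : ((m + (j + 1)).choose (j + 1) : ℝ) - t ^ (j + 1) / (j + 1).factorial =
      (((m + 1).ascFactorial (j + 1) : ℕ) - t ^ (j + 1)) / (j + 1).factorial := by
    rw [hc]
    field_simp
  rw [key, Nat.add_sub_cancel, abs_div, abs_of_pos hf, div_le_iff₀ hf, abs_le]
  constructor
  · have : ((j + 1 : ℕ) : ℝ) * (j + 1 : ℕ) * t ^ j ≤ (j + 1 : ℕ) * t ^ j * (j + 1).factorial := by
      rw [mul_right_comm]
      gcongr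
    linarith
  · have : ((j + 1).factorial : ℝ) * t ^ j ≤ (j + 1 : ℕ) * t ^ j * (j + 1).factorial := by
      have : (0 : ℝ) ≤ t ^ j * (j + 1).factorial := by positivity
      nlinarith
    linarith

lemma pow_div_factorial_le (k : ℕ) (t : ℝ) (hk : 1 ≤ k) (ht : 0 ≤ t) (htk : t ≤ k) :
    t ^ k / k.factorial ≤ k * t ^ (k - 1) := by
  have hf : (1 : ℝ) ≤ k.factorial := by exact_mod_cast k.factorial_pos
  refine (div_le_self (by positivity) hf).trans ?_
  rw [← mul_pow_sub_one (by omega)]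
  gcongr

/-- Stars and bars. -/
lemma card_fun_sum_eq (k m : ℕ) :
    Nat.card {u : Fin (k + 1) → ℕ // ∑ i, u i = m} = (m + k).choose k := by
  rw [Nat.card_congr (Sym.equivNatSumOfFintype (Fin (k + 1)) m).symm, Nat.card_eq_fintype_card,
    Sym.card_sym_eq_choose, Fintype.card_fin, ← Nat.choose_symm_add]
  congr 1
  omega

lemma le_of_cast_eq {d a b : ℕ} (ha : 0 < a) (hb : b ≤ d) (h : (a : ZMod d) = b) : b ≤ a := by
  by_contra! hab
  have := Nat.le_of_dvd (by omega)
    ((Nat.modEq_iff_dvd' hab.le).1 ((ZMod.natCast_eq_natCast_iff _ _ _).1 h))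
  omega

lemma exists_eq_add_mul {d a b : ℕ} (ha : 0 < a) (hb : b ≤ d) (h : (a : ZMod d) = b) :
    a = b + d * ((a - b) / d) := by
  have hba := le_of_cast_eq ha hb h
  rw [Nat.mul_div_cancel' ((Nat.modEq_iff_dvd' hba).1
    ((ZMod.natCast_eq_natCast_iff _ _ _).1 h.symm))]
  omega

lemma card_fiber_eq_choose (k d m : ℕ) (hd : 0 < d) (ρ : Fin (k + 1) → ℕ)
    (hρ : ∀ i, 0 < ρ i ∧ ρ i ≤ d) :
    Nat.card {v : Fin (k + 1) → ℕ // (∀ i, 0 < v i) ∧ ∑ i, v i = ∑ i, ρ i + d * m ∧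
      ∀ i, (v i : ZMod d) = ρ i} = (m + k).choose k := by
  rw [← card_fun_sum_eq]
  refine Nat.card_congr
    { toFun := fun v => ⟨fun i => (v.1 i - ρ i) / d, ?_⟩
      invFun := fun u => ⟨fun i => ρ i + d * u.1 i, ?_⟩
      left_inv := ?_
      right_inv := ?_ }
  · obtain ⟨v, hv, hs, hc⟩ := v
    have h : ∑ i, v i = ∑ i, ρ i + d * ∑ i, (v i - ρ i) / d := by
      rw [Finset.mul_sum, ← Finset.sum_add_distrib]
      exact Finset.sum_congr rfl fun i _ => exists_eq_add_mul (hv i) (hρ i).2 (hc i)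
    exact Nat.eq_of_mul_eq_mul_left hd (by simp only; omega)
  · obtain ⟨u, hu⟩ := u
    refine ⟨fun i => Nat.add_pos_left (hρ i).1 _, ?_, fun i => by simp⟩
    rw [Finset.sum_add_distrib, ← Finset.mul_sum, hu]
  · rintro ⟨v, hv, hs, hc⟩
    ext i
    exact (exists_eq_add_mul (hv i) (hρ i).2 (hc i)).symm
  · rintro ⟨u, hu⟩
    ext i
    simp [hd.ne']

/-- The number of `v` with prescribed residues and sum `n` is close to `(n / d) ^ k / k!`. -/
lemma abs_card_fiber_sub_le (k n d : ℕ) (hk : 1 ≤ k) (hd : 0 < d) (hdn : d ≤ n)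
    (ρ : Fin (k + 1) → ℕ) (hρ : ∀ i, 0 < ρ i ∧ ρ i ≤ d) (hρ0 : ρ 0 = d)
    (hsum : ((∑ i, ρ i : ℕ) : ZMod d) = n) :
    |(Nat.card {v : Fin (k + 1) → ℕ // (∀ i, 0 < v i) ∧ ∑ i, v i = n ∧
        ∀ i, (v i : ZMod d) = ρ i} : ℝ) - ((n : ℝ) / d) ^ k / k.factorial| ≤
      k * ((n : ℝ) / d) ^ (k - 1) := by
  have hd' : (0 : ℝ) < d := by exact_mod_cast hd
  have ht : 1 ≤ (n : ℝ) / d := by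
    rw [le_div_iff₀ hd']
    simpa using hdn
  have hle : ∑ i, ρ i ≤ (k + 1) * d := by
    simpa using Finset.sum_le_card_nsmul Finset.univ ρ d fun i _ => (hρ i).2
  have hge : d ≤ ∑ i, ρ i := hρ0 ▸ Finset.single_le_sum (f := ρ) (fun i _ => Nat.zero_le _)
    (Finset.mem_univ 0)
  rcases le_or_gt (∑ i, ρ i) n with h | h
  · obtain ⟨m, hm⟩ := (Nat.modEq_iff_dvd' h).1 ((ZMod.natCast_eq_natCast_iff _ _ _).1 hsum)
    obtain rfl : n = ∑ i, ρ i + d * m := by omega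
    rw [card_fiber_eq_choose k d m hd ρ hρ]
    apply abs_choose_sub_le k m _ hk ht
    · rw [le_div_iff₀ hd']
      have : (m + 1) * d ≤ ∑ i, ρ i + d * m := by nlinarith
      exact_mod_cast this
    · rw [sub_le_iff_le_add, div_le_iff₀ hd']
      have : ∑ i, ρ i + d * m ≤ (m + 1 + k) * d := by nlinarith
      exact_mod_cast this
  · have : IsEmpty {v : Fin (k + 1) → ℕ // (∀ i, 0 < v i) ∧ ∑ i, v i = n ∧
        ∀ i, (v i : ZMod d) = ρ i} := by
      constructor
      rintro ⟨v, hv, hs, hc⟩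
      have : ∑ i, ρ i ≤ ∑ i, v i :=
        Finset.sum_le_sum fun i _ => le_of_cast_eq (hv i) (hρ i).2 (hc i)
      omega
    rw [Nat.card_of_isEmpty, Nat.cast_zero, zero_sub, abs_neg, abs_of_nonneg (by positivity)]
    apply pow_div_factorial_le k _ hk (by positivity)
    have hdvd := (Nat.modEq_iff_dvd' h.le).1 ((ZMod.natCast_eq_natCast_iff _ _ _).1 hsum.symm)
    have h3 := Nat.le_of_dvd (by omega) hdvd
    rw [div_le_iff₀ hd']
    have : n ≤ k * d := by nlinarith [Nat.sub_add_cancel h.le]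
    exact_mod_cast this

/-- Residue vectors modulo `d` with sum `s` and vanishing product. -/
abbrev ZeroProd (k d : ℕ) (s : ZMod d) : Type :=
  {z : Fin k → ZMod d // ∑ i, z i = s ∧ ∏ i, z i = 0}

lemma card_sum_eq_add_card_ne (F : Type*) [Field F] [Fintype F] [DecidableEq F] (k : ℕ) (s : F) :
    (Finset.univ.filter fun y : Fin (k + 1) → F => (∀ i, y i ≠ 0) ∧ ∑ i, y i = s).card +
      (Finset.univ.filter fun y : Fin k → F => (∀ i, y i ≠ 0) ∧ ∑ i, y i = s).card =
      (Fintype.card F - 1) ^ k := by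
  have h1 : (Finset.univ.filter fun y : Fin (k + 1) → F => (∀ i, y i ≠ 0) ∧ ∑ i, y i = s).card =
      (Finset.univ.filter fun y : Fin k → F => (∀ i, y i ≠ 0) ∧ ¬ ∑ i, y i = s).card := by
    refine Finset.card_nbij' Fin.tail (fun z => Fin.cons (s - ∑ i, z i) z) ?_ ?_ ?_ ?_
    · intro y hy
      simp only [Finset.coe_filter, Finset.mem_univ, true_and, Set.mem_ofPred_eq,
        Fin.sum_univ_succ] at hy ⊢
      refine ⟨fun i => hy.1 i.succ, fun h => hy.1 0 ?_⟩
      have := hy.2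
      simp only [Fin.tail] at h
      rwa [h, add_eq_right] at this
    · intro z hz
      simp only [Finset.coe_filter, Finset.mem_univ, true_and, Set.mem_ofPred_eq,
        Fin.sum_univ_succ] at hz ⊢
      refine ⟨Fin.forall_fin_succ.2 ⟨?_, ?_⟩, ?_⟩
      · simpa [sub_eq_zero] using Ne.symm hz.2
      · simpa using hz.1
      · simp
    · intro y hy
      simp only [Finset.coe_filter, Finset.mem_univ, true_and, Set.mem_ofPred_eq,
        Fin.sum_univ_succ] at hy
      have : s - ∑ i, Fin.tail y i = y 0 := by rw [← hy.2]; simp [Fin.tail]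
      simp only [this, Fin.cons_self_tail]
    · intro z _
      simp
  have h2 : (Finset.univ.filter fun y : Fin k → F => ∀ i, y i ≠ 0).card =
      (Fintype.card F - 1) ^ k := by
    have : (Finset.univ.filter fun y : Fin k → F => ∀ i, y i ≠ 0) =
        Fintype.piFinset fun _ => Finset.univ.erase 0 := by
      ext y
      simp
    rw [this, Fintype.card_piFinset]
    simp [Finset.card_erase_of_mem]
  rw [h1, ← h2, ← Finset.card_filter_add_card_filter_not
    (s := Finset.univ.filter fun y : Fin k → F => ∀ i, y i ≠ 0) (fun y => ∑ i, y i = s),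
    Finset.filter_filter, Finset.filter_filter, add_comm]

lemma card_mul_card_ne (F : Type*) [Field F] [Fintype F] [DecidableEq F] (k : ℕ) (s : F) :
    (Fintype.card F : ℝ) *
      (Finset.univ.filter fun y : Fin k → F => (∀ i, y i ≠ 0) ∧ ∑ i, y i = s).card =
      ((Fintype.card F : ℝ) - 1) ^ k +
        (-1) ^ k * (if s = 0 then (Fintype.card F : ℝ) - 1 else -1) := by
  induction k with
  | zero =>
    by_cases h : s = 0
    · simp [h]
    · simp [h, eq_comm (a := (0 : F))]
  | succ k ih =>
    have h : (_ : ℝ) = _ := congrArg (Nat.cast (R := ℝ)) (card_sum_eq_add_card_ne F k s)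
    rw [Nat.cast_add, Nat.cast_pow, Nat.cast_sub Fintype.card_pos, Nat.cast_one] at h
    rw [eq_sub_of_add_eq h, mul_sub, ih]
    ring

lemma card_sum_eq (F : Type*) [Field F] [Fintype F] [DecidableEq F] (k : ℕ) (s : F) :
    (Finset.univ.filter fun y : Fin (k + 1) → F => ∑ i, y i = s).card = Fintype.card F ^ k := by
  have : Fintype.card (Fin k → F) = Fintype.card F ^ k := by simp
  rw [← this, ← Finset.card_univ]
  refine Finset.card_nbij' Fin.tail (fun z => Fin.cons (s - ∑ i, z i) z) ?_ ?_ ?_ ?_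
  · simp [Set.MapsTo]
  · intro z _
    simp [Fin.sum_univ_succ]
  · intro y hy
    simp only [Finset.coe_filter, Finset.mem_univ, true_and, Set.mem_ofPred_eq,
      Fin.sum_univ_succ] at hy
    have : s - ∑ i, Fin.tail y i = y 0 := by rw [← hy]; simp [Fin.tail]
    simp only [this, Fin.cons_self_tail]
  · intro z _
    simp

lemma card_zeroProd_prime (k n p : ℕ) (hk : 1 ≤ k) (hp : p.Prime) :
    (Nat.card (ZeroProd k p n) : ℝ) = if p ∣ n then phi k p else psi k p := by
  have := Fact.mk hp
  obtain ⟨j, rfl⟩ := Nat.exists_eq_add_of_le' hk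
  have hp0 : (p : ℝ) ≠ 0 := by exact_mod_cast hp.ne_zero
  have h1 := card_mul_card_ne (ZMod p) (j + 1) n
  have h2 := card_sum_eq (ZMod p) j n
  rw [← Finset.card_filter_add_card_filter_not (fun y => ∏ i, y i = 0), Finset.filter_filter,
    Finset.filter_filter, ZMod.card] at h2
  have h3 : (Finset.univ.filter fun y : Fin (j + 1) → ZMod p =>
      ∑ i, y i = n ∧ ¬ ∏ i, y i = 0) =
      Finset.univ.filter fun y : Fin (j + 1) → ZMod p => (∀ i, y i ≠ 0) ∧ ∑ i, y i = n := by
    ext y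
    simp [Finset.prod_eq_zero_iff, and_comm]
  rw [h3] at h2
  rw [Nat.card_eq_fintype_card, Fintype.card_subtype]
  have h2' := congrArg (Nat.cast (R := ℝ)) h2
  rw [Nat.cast_add, Nat.cast_pow] at h2'
  rw [eq_sub_of_add_eq h2']
  simp only [ZMod.card, ZMod.natCast_eq_zero_iff] at h1
  unfold phi psi
  split_ifs with h <;> simp only [h, if_true, if_false] at h1 <;>
    rw [eq_div_iff hp0, mul_comm, mul_sub, h1] <;> ring

lemma card_zeroProd_mul (k n a b : ℕ) (hab : a.Coprime b) :
    Nat.card (ZeroProd k (a * b) n) = Nat.card (ZeroProd k a n) * Nat.card (ZeroProd k b n) := by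
  rw [← Nat.card_prod]
  let e := ZMod.chineseRemainder hab
  let E : (Fin k → ZMod (a * b)) ≃ (Fin k → ZMod a) × (Fin k → ZMod b) :=
    (Equiv.arrowCongr (Equiv.refl _) e.toEquiv).trans
      (Equiv.arrowProdEquivProdArrow _ (fun _ => ZMod a) (fun _ => ZMod b))
  refine Nat.card_congr ((E.subtypeEquiv
    (q := fun w => (∑ i, w.1 i = (n : ZMod a) ∧ ∏ i, w.1 i = 0) ∧
      (∑ i, w.2 i = (n : ZMod b) ∧ ∏ i, w.2 i = 0))
    fun z => ?_).trans (Equiv.subtypeProdEquivProd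
      (p := fun z : Fin k → ZMod a => ∑ i, z i = n ∧ ∏ i, z i = 0)
      (q := fun z : Fin k → ZMod b => ∑ i, z i = n ∧ ∏ i, z i = 0)))
  have h1 : ∀ i, (E z).1 i = (e (z i)).1 := fun i => rfl
  have h2 : ∀ i, (E z).2 i = (e (z i)).2 := fun i => rfl
  rw [← e.injective.eq_iff, ← e.injective.eq_iff (a := ∏ i, z i), map_sum, map_prod, map_natCast,
    map_zero]
  simp only [h1, h2, Prod.ext_iff, Prod.fst_sum, Prod.snd_sum, Prod.fst_prod, Prod.snd_prod,
    Prod.fst_natCast, Prod.snd_natCast, Prod.fst_zero, Prod.snd_zero]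
  tauto

/-- `Θ` counts the residue vectors modulo `d`. -/
lemma card_zeroProd_eq_Theta (k n d : ℕ) (hk : 1 ≤ k) (hd : Squarefree d) :
    (Nat.card (ZeroProd k d n) : ℝ) = Theta k n d := by
  induction d using induction_on_primes with
  | zero => exact absurd hd not_squarefree_zero
  | one =>
    have : Unique (ZeroProd k 1 n) :=
      { default := ⟨0, Subsingleton.elim _ _, Subsingleton.elim _ _⟩
        uniq := fun _ => Subsingleton.elim _ _ }
    simp [Theta]
  | prime_mul p a hp ih =>
    have hpa := Nat.coprime_of_squarefree_mul hd
    rw [card_zeroProd_mul k n p a hpa, Nat.cast_mul, ih (hd.of_mul_right),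
      card_zeroProd_prime k n p hk hp, Theta, Theta, hpa.primeFactors_mul,
      Finset.prod_union hpa.disjoint_primeFactors, hp.primeFactors, Finset.prod_singleton]

/-- The representative in `[1, d]` of each residue, with `d` representing the first, zero, entry. -/
def residueRep {k d : ℕ} (z : Fin k → ZMod d) : Fin (k + 1) → ℕ :=
  Fin.cons d fun i => (z i - 1).val + 1

lemma residueRep_bounds {k d : ℕ} (hd : 0 < d) (z : Fin k → ZMod d) (i : Fin (k + 1)) :
    0 < residueRep z i ∧ residueRep z i ≤ d := by
  have : NeZero d := ⟨hd.ne'⟩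
  refine Fin.cases ?_ (fun i => ?_) i
  · simpa [residueRep] using hd
  · simpa [residueRep] using Nat.succ_le_of_lt (ZMod.val_lt (z i - 1))

lemma residueRep_succ_cast {k d : ℕ} (hd : 0 < d) (z : Fin k → ZMod d) (i : Fin k) :
    (residueRep z i.succ : ZMod d) = z i := by
  have : NeZero d := ⟨hd.ne'⟩
  simp [residueRep]

lemma prod_erase_zero (k : ℕ) (v : Fin (k + 1) → ℕ) :
    ∏ i ∈ Finset.univ.erase 0, v i = ∏ i : Fin k, v i.succ := by
  rw [Fin.univ_succ]
  simp

/-- The tuples counted by `K` split according to their residues modulo `d`. -/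
lemma K_eq_sum (k n d : ℕ) (hd : 0 < d) [Fintype (ZeroProd k d n)] :
    K k d n = ∑ z : ZeroProd k d n, Nat.card {v : Fin (k + 1) → ℕ // (∀ i, 0 < v i) ∧
      ∑ i, v i = n ∧ ∀ i, (v i : ZMod d) = residueRep z.1 i} := by
  have hfin (P : (Fin (k + 1) → ℕ) → Prop) :
      Finite {v : Fin (k + 1) → ℕ // (∀ i, 0 < v i) ∧ ∑ i, v i = n ∧ P v} := by
    refine Set.Finite.subset (Set.finite_Iic fun _ : Fin (k + 1) => n) ?_
    rintro v ⟨-, hs, -⟩ i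
    exact hs ▸ Finset.single_le_sum (f := v) (fun i _ => Nat.zero_le _) (Finset.mem_univ i)
  rw [K, ← Nat.card_sigma]
  refine Nat.card_congr
    { toFun := fun v => ⟨⟨fun i => v.1 i.succ, ?_, ?_⟩, ⟨v.1, v.2.1, v.2.2.1, ?_⟩⟩
      invFun := fun w => ⟨w.2.1, w.2.2.1, w.2.2.2.1, ?_, ?_⟩
      left_inv := fun v => rfl
      right_inv := ?_ }
  · obtain ⟨v, -, hs, h0, -⟩ := v
    have h := congrArg (Nat.cast (R := ZMod d)) hs
    rwa [Fin.sum_univ_succ, Nat.cast_add, (ZMod.natCast_eq_zero_iff _ _).2 h0, zero_add,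
      Nat.cast_sum] at h
  · obtain ⟨v, -, -, -, hp⟩ := v
    rw [prod_erase_zero] at hp
    rw [← Nat.cast_prod, ZMod.natCast_eq_zero_iff]
    exact hp
  · refine Fin.cases ?_ fun i => ?_
    · simpa [residueRep, ZMod.natCast_eq_zero_iff] using v.2.2.2.1
    · rw [residueRep_succ_cast hd]
  · obtain ⟨z, v, hv, hs, hc⟩ := w
    simpa [residueRep, ZMod.natCast_eq_zero_iff] using hc 0
  · obtain ⟨⟨z, hz⟩, v, hv, hs, hc⟩ := w
    rw [prod_erase_zero, ← ZMod.natCast_eq_zero_iff, Nat.cast_prod]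
    exact (Finset.prod_congr rfl fun i _ => by rw [hc, residueRep_succ_cast hd]).trans hz.2
  · rintro ⟨⟨z, hz⟩, v, hv, hs, hc⟩
    obtain rfl : z = fun i => (v i.succ : ZMod d) :=
      funext fun i => by rw [hc, residueRep_succ_cast hd]
    rfl

theorem statement15 (k n d : ℕ) (hk : 1 ≤ k) (hn : 0 < n) (hd : Squarefree d)
    (hd1 : 1 ≤ d) (hdn : d ≤ n) :
    |(K k d n : ℝ) - Theta k n d * ((n : ℝ) / (d : ℝ)) ^ k / (Nat.factorial k : ℝ)| ≤
      Theta k n d * ((k : ℝ) + Real.exp 1 ^ (k + 1) / Real.sqrt (2 * Real.pi * k)) *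
        ((n : ℝ) / (d : ℝ)) ^ (k - 1) := by
  have : NeZero d := ⟨by omega⟩
  have hΘ := card_zeroProd_eq_Theta k n d hk hd
  rw [Nat.card_eq_fintype_card] at hΘ
  have h1 : |(K k d n : ℝ) - Theta k n d * ((n : ℝ) / d) ^ k / k.factorial| ≤
      Theta k n d * (k * ((n : ℝ) / d) ^ (k - 1)) := by
    rw [K_eq_sum k n d hd1, ← hΘ, Nat.cast_sum, mul_div_assoc, ← nsmul_eq_mul, ← nsmul_eq_mul,
      ← Finset.card_univ, ← Finset.sum_const, ← Finset.sum_const, ← Finset.sum_sub_distrib]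
    refine (Finset.abs_sum_le_sum_abs _ _).trans (Finset.sum_le_sum fun z _ => ?_)
    refine abs_card_fiber_sub_le k n d hk hd1 hdn _ (residueRep_bounds hd1 z.1) rfl ?_
    rw [Fin.sum_univ_succ, Nat.cast_add, Nat.cast_sum]
    simp only [residueRep_succ_cast hd1, z.2.1]
    simp [residueRep]
  refine h1.trans ?_
  rw [← mul_assoc]
  have hΘ0 : 0 ≤ Theta k n d := hΘ ▸ Nat.cast_nonneg _
  gcongr
  exact le_add_of_nonneg_right (by positivity)
end
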